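/- (Existence of an XXL-solution.) Let μ ≤ 1/4, p > 1 and s < β₋(p − 1) + 2. Then there exist a solution U of (*) on all of Ω (U ∈ C²(Ω), U > 0, −ΔU − (μ/δ²)U + U^p/δ^s = 0 in Ω) and a constant γ ∈ (0, 1] such that γ ≤ liminf_{δ(x)→0} U(x)/δ(x)^{(s−2)/(p−1)} and limsup_{δ(x)→0} U(x)/δ(x)^{(s−2)/(p−1)} ≤ 1/γ. -/

import Mathlib

open Set Metric MeasureTheory Real

noncomputable section

/-- Distance to the boundary of `Ω`. -/
def bdist {N : ℕ} (Ω : Set (EuclideanSpace ℝ (Fin N))) (x : EuclideanSpace ℝ (Fin N)) : ℝ :=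
  Metric.infDist x Ωᶜ

/-- The collar `Ω_ρ = {x ∈ Ω : δ(x) < ρ}`. -/
def collar {N : ℕ} (Ω : Set (EuclideanSpace ℝ (Fin N))) (ρ : ℝ) :
    Set (EuclideanSpace ℝ (Fin N)) :=
  {x ∈ Ω | bdist Ω x < ρ}

/-- The ring `Ω_{ε,ρ} = {x ∈ Ω : ε < δ(x) < ρ}`. -/
def ring' {N : ℕ} (Ω : Set (EuclideanSpace ℝ (Fin N))) (ε ρ : ℝ) :
    Set (EuclideanSpace ℝ (Fin N)) :=
  {x ∈ Ω | ε < bdist Ω x ∧ bdist Ω x < ρ}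

/-- The Laplacian. -/
def lap {N : ℕ} (f : EuclideanSpace ℝ (Fin N) → ℝ) (x : EuclideanSpace ℝ (Fin N)) : ℝ :=
  ∑ i : Fin N, fderiv ℝ (fun y => fderiv ℝ f y (EuclideanSpace.single i 1)) x
    (EuclideanSpace.single i 1)

/-- `ρ₀` is a good collar width: `δ` is `C²` on `Ω_{ρ₀}`, `|∇δ| = 1` there, `Δδ` bounded. -/
def GoodCollar {N : ℕ} (Ω : Set (EuclideanSpace ℝ (Fin N))) (ρ₀ : ℝ) : Prop :=
  0 < ρ₀ ∧ ContDiffOn ℝ 2 (bdist Ω) (collar Ω ρ₀) ∧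
    (∀ x ∈ collar Ω ρ₀, ‖gradient (bdist Ω) x‖ = 1) ∧
    ∃ M, ∀ x ∈ collar Ω ρ₀, |lap (bdist Ω) x| ≤ M

/-- A super-harmonic of `L_μ = -Δ - μ/δ²` on `G`. -/
def SuperHarm {N : ℕ} (Ω : Set (EuclideanSpace ℝ (Fin N))) (μ : ℝ)
    (G : Set (EuclideanSpace ℝ (Fin N))) (h : EuclideanSpace ℝ (Fin N) → ℝ) : Prop :=
  ContDiffOn ℝ 2 h G ∧ ∀ x ∈ G, 0 ≤ -(lap h x) - μ / (bdist Ω x) ^ 2 * h x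

/-- A sub-harmonic of `L_μ = -Δ - μ/δ²` on `G`. -/
def SubHarm {N : ℕ} (Ω : Set (EuclideanSpace ℝ (Fin N))) (μ : ℝ)
    (G : Set (EuclideanSpace ℝ (Fin N))) (h : EuclideanSpace ℝ (Fin N) → ℝ) : Prop :=
  ContDiffOn ℝ 2 h G ∧ ∀ x ∈ G, -(lap h x) - μ / (bdist Ω x) ^ 2 * h x ≤ 0

/-- A positive local super-harmonic of `L_μ`, defined on the collar `Ω_σ`. -/
def PosSuperHarmOn {N : ℕ} (Ω : Set (EuclideanSpace ℝ (Fin N))) (μ σ : ℝ)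
    (h : EuclideanSpace ℝ (Fin N) → ℝ) : Prop :=
  SuperHarm Ω μ (collar Ω σ) h ∧ ∀ x ∈ collar Ω σ, 0 < h x

/-- A sub-solution of `(*)`: `-Δu - (μ/δ²)u + u^p/δ^s = 0` on `G`. -/
def SubSol {N : ℕ} (Ω : Set (EuclideanSpace ℝ (Fin N))) (μ s p : ℝ)
    (G : Set (EuclideanSpace ℝ (Fin N))) (u : EuclideanSpace ℝ (Fin N) → ℝ) : Prop :=
  ContDiffOn ℝ 2 u G ∧ (∀ x ∈ G, 0 ≤ u x) ∧
    ∀ x ∈ G, -(lap u x) - μ / (bdist Ω x) ^ 2 * u x + (u x) ^ p / (bdist Ω x) ^ s ≤ 0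

/-- A super-solution of `(*)` on `G`. -/
def SuperSol {N : ℕ} (Ω : Set (EuclideanSpace ℝ (Fin N))) (μ s p : ℝ)
    (G : Set (EuclideanSpace ℝ (Fin N))) (u : EuclideanSpace ℝ (Fin N) → ℝ) : Prop :=
  ContDiffOn ℝ 2 u G ∧ (∀ x ∈ G, 0 < u x) ∧
    ∀ x ∈ G, 0 ≤ -(lap u x) - μ / (bdist Ω x) ^ 2 * u x + (u x) ^ p / (bdist Ω x) ^ s

/-- A regularized distance `(d, c)` on `Ω`. -/
def RegDist {N : ℕ} (Ω : Set (EuclideanSpace ℝ (Fin N))) (d : EuclideanSpace ℝ (Fin N) → ℝ)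
    (c : ℝ) : Prop :=
  1 ≤ c ∧ ContDiffOn ℝ 2 d Ω ∧ (∀ x ∈ Ω, 0 < d x) ∧
    (∀ x ∈ Ω, c⁻¹ * bdist Ω x ≤ d x ∧ d x ≤ c * bdist Ω x) ∧
    (∀ x ∈ Ω, ‖gradient d x‖ ≤ c) ∧ (∀ x ∈ Ω, |lap d x| ≤ c / d x)

section helpers
open scoped Interval BoundedContinuousFunction

/-! ### The truncated powers -/

lemma hasDerivAt_maxpow (n : ℕ) (x : ℝ) :
    HasDerivAt (fun t : ℝ => (max t 0) ^ (n + 2)) ((n + 2 : ℝ) * (max x 0) ^ (n + 1)) x := by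
  rcases lt_trichotomy x 0 with h | h | h
  · have h1 : (fun t : ℝ => (max t 0) ^ (n + 2)) =ᶠ[nhds x] fun _ => 0 := by
      filter_upwards [Iio_mem_nhds h] with t ht
      simp [max_eq_right (le_of_lt (mem_Iio.1 ht))]
    rw [max_eq_right h.le]
    simpa using (hasDerivAt_const x (0 : ℝ)).congr_of_eventuallyEq h1
  · subst h
    simp only [max_self, ne_eq, Nat.add_eq_zero_iff, one_ne_zero, and_false, not_false_eq_true,
      zero_pow, mul_zero]
    rw [hasDerivAt_iff_isLittleO]
    simp only [max_self, ne_eq, Nat.add_eq_zero_iff, OfNat.ofNat_ne_zero, and_false,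
      not_false_eq_true, zero_pow, sub_zero, smul_zero]
    have h2 : (fun t : ℝ => t ^ (n + 2)) =o[nhds 0] fun t : ℝ => t := by
      simpa using Asymptotics.isLittleO_pow_id (𝕜 := ℝ) (n := n + 2) (by omega)
    refine Asymptotics.IsBigO.trans_isLittleO ?_ h2
    refine Asymptotics.IsBigO.of_bound 1 (Filter.Eventually.of_forall fun t => ?_)
    rw [one_mul, norm_pow, norm_pow]
    refine pow_le_pow_left₀ (norm_nonneg _) ?_ _
    rw [Real.norm_eq_abs, Real.norm_eq_abs, abs_of_nonneg (le_max_right _ _)]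
    exact max_le (le_abs_self t) (abs_nonneg t)
  · have h1 : (fun t : ℝ => (max t 0) ^ (n + 2)) =ᶠ[nhds x] fun t => t ^ (n + 2) := by
      filter_upwards [Ioi_mem_nhds h] with t ht
      simp [max_eq_left (le_of_lt (mem_Ioi.1 ht))]
    rw [max_eq_left h.le]
    have := (hasDerivAt_pow (n + 2) x).congr_of_eventuallyEq h1
    simpa using this

lemma contDiff_maxpow (n : ℕ) : ContDiff ℝ n (fun t : ℝ => (max t 0) ^ (n + 1)) := by
  induction n with
  | zero =>
    simp only [CharP.cast_eq_zero]
    rw [contDiff_zero]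
    fun_prop
  | succ n ih =>
    have : ((n + 1 : ℕ) : WithTop ℕ∞) = (n : WithTop ℕ∞) + 1 := by push_cast; rfl
    rw [this, contDiff_succ_iff_deriv]
    refine ⟨fun x => (hasDerivAt_maxpow n x).differentiableAt, by simp, ?_⟩
    have h : deriv (fun t : ℝ => (max t 0) ^ (n + 1 + 1)) =
        fun x => (n + 2 : ℝ) * (max x 0) ^ (n + 1) := by
      funext x; exact (hasDerivAt_maxpow n x).deriv
    rw [h]
    exact contDiff_const.mul ih

/-! ### The kernels -/

/-- Polynomial bump. -/
def pbump {N : ℕ} (n : ℕ) (z : EuclideanSpace ℝ (Fin N)) : ℝ := (max (1 - ‖z‖ ^ 2) 0) ^ n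

section kernels
variable {N : ℕ}


lemma pbump_contDiff (n : ℕ) : ContDiff ℝ n (pbump (n + 1) : (EuclideanSpace ℝ (Fin N)) → ℝ) := by
  unfold pbump
  exact (contDiff_maxpow n).comp (contDiff_const.sub (contDiff_norm_sq ℝ))

lemma pbump_nonneg (n : ℕ) (z : (EuclideanSpace ℝ (Fin N))) : 0 ≤ pbump n z := by unfold pbump; positivity

lemma pbump_eq_zero {n : ℕ} (hn : n ≠ 0) {z : (EuclideanSpace ℝ (Fin N))} (hz : 1 ≤ ‖z‖) : pbump n z = 0 := by
  unfold pbump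
  rw [max_eq_right (by nlinarith), zero_pow hn]

lemma pbump_support {n : ℕ} (hn : n ≠ 0) : Function.support (pbump n : (EuclideanSpace ℝ (Fin N)) → ℝ) ⊆ closedBall 0 1 := by
  intro z hz
  by_contra h
  exact hz (pbump_eq_zero hn (by simpa using (not_le.1 (fun h' => h (by simpa using h'))).le))

lemma pbump_compact {n : ℕ} (hn : n ≠ 0) : HasCompactSupport (pbump n : (EuclideanSpace ℝ (Fin N)) → ℝ) :=
  HasCompactSupport.of_support_subset_isCompact (isCompact_closedBall 0 1) (pbump_support hn)

lemma pbump_hasFDerivAt (n : ℕ) (z : (EuclideanSpace ℝ (Fin N))) :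
    HasFDerivAt (pbump (n + 2) : (EuclideanSpace ℝ (Fin N)) → ℝ) ((-(2 * (n + 2)) * pbump (n + 1) z) • innerSL ℝ z) z := by
  have h1 : HasFDerivAt (fun z : (EuclideanSpace ℝ (Fin N)) => 1 - ‖z‖ ^ 2) (-(2 • innerSL ℝ z)) z := by
    exact ((hasStrictFDerivAt_norm_sq z).hasFDerivAt).const_sub 1
  have h2 := (hasDerivAt_maxpow n (1 - ‖z‖ ^ 2)).comp_hasFDerivAt z h1
  refine h2.congr_fderiv ?_
  ext y
  simp [pbump]
  ring

lemma pbump_integral_pos {n : ℕ} (hn : n ≠ 0) : 0 < ∫ z : (EuclideanSpace ℝ (Fin N)), pbump n z := by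
  have hc : Continuous (pbump n : (EuclideanSpace ℝ (Fin N)) → ℝ) := by unfold pbump; fun_prop
  refine hc.integral_pos_of_hasCompactSupport_nonneg_nonzero (pbump_compact hn)
    (fun z => pbump_nonneg n z) (x := 0) ?_
  simp [pbump]

/-- normalising constant -/
def kc (N : ℕ) : ℝ := (∫ z : EuclideanSpace ℝ (Fin N), 8 * pbump 3 z)⁻¹

lemma kc_pos : 0 < kc N := by
  unfold kc
  rw [integral_const_mul]
  have := pbump_integral_pos (N := N) (n := 3) (by norm_num)
  positivity

/-- The potential profile. -/
def kPsi (z : (EuclideanSpace ℝ (Fin N))) : ℝ := kc N * pbump 4 z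
/-- The averaging profile. -/
def kEta (z : (EuclideanSpace ℝ (Fin N))) : ℝ := kc N * (8 * pbump 3 z)

lemma kPsi_contDiff : ContDiff ℝ 3 (kPsi : (EuclideanSpace ℝ (Fin N)) → ℝ) := by
  unfold kPsi; exact contDiff_const.mul (pbump_contDiff 3)
lemma kEta_contDiff : ContDiff ℝ 2 (kEta : (EuclideanSpace ℝ (Fin N)) → ℝ) := by
  unfold kEta; exact contDiff_const.mul (contDiff_const.mul (pbump_contDiff 2))
lemma kPsi_compact : HasCompactSupport (kPsi : (EuclideanSpace ℝ (Fin N)) → ℝ) := by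
  unfold kPsi; exact (pbump_compact (by norm_num)).mul_left
lemma kEta_compact : HasCompactSupport (kEta : (EuclideanSpace ℝ (Fin N)) → ℝ) := by
  unfold kEta; exact ((pbump_compact (by norm_num)).mul_left).mul_left
lemma kPsi_zero {z : (EuclideanSpace ℝ (Fin N))} (hz : 1 ≤ ‖z‖) : kPsi z = 0 := by
  simp [kPsi, pbump_eq_zero (n := 4) (by norm_num) hz]
lemma kEta_zero {z : (EuclideanSpace ℝ (Fin N))} (hz : 1 ≤ ‖z‖) : kEta z = 0 := by
  simp [kEta, pbump_eq_zero (n := 3) (by norm_num) hz]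
lemma kPsi_nonneg (z : (EuclideanSpace ℝ (Fin N))) : 0 ≤ kPsi z := mul_nonneg kc_pos.le (pbump_nonneg _ _)
lemma kEta_nonneg (z : (EuclideanSpace ℝ (Fin N))) : 0 ≤ kEta z :=
  mul_nonneg kc_pos.le (mul_nonneg (by norm_num) (pbump_nonneg _ _))
lemma kPsi_le (z : (EuclideanSpace ℝ (Fin N))) : kPsi z ≤ kEta z := by
  unfold kPsi kEta
  refine mul_le_mul_of_nonneg_left ?_ kc_pos.le
  have h0 : 0 ≤ max (1 - ‖z‖ ^ 2) 0 := le_max_right _ _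
  have h1 : max (1 - ‖z‖ ^ 2) 0 ≤ 1 := max_le (by nlinarith [norm_nonneg z]) (by norm_num)
  unfold pbump
  have h3 : 0 ≤ (max (1 - ‖z‖ ^ 2) 0) ^ 3 := by positivity
  nlinarith
lemma kEta_integral : ∫ z : (EuclideanSpace ℝ (Fin N)), kEta z = 1 := by
  unfold kEta kc
  rw [integral_const_mul]
  refine inv_mul_cancel₀ ?_
  rw [integral_const_mul]
  have := pbump_integral_pos (N := N) (n := 3) (by norm_num)
  positivity
lemma kPsi_integral_pos : 0 < ∫ z : (EuclideanSpace ℝ (Fin N)), kPsi z := by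
  unfold kPsi
  rw [integral_const_mul]
  exact mul_pos kc_pos (pbump_integral_pos (by norm_num))

lemma kPsi_hasFDerivAt (z : (EuclideanSpace ℝ (Fin N))) : HasFDerivAt (kPsi : (EuclideanSpace ℝ (Fin N)) → ℝ) ((-kEta z) • innerSL ℝ z) z := by
  have := (pbump_hasFDerivAt 2 z).const_mul (kc N)
  refine this.congr_fderiv ?_
  ext y
  simp [kEta]
  ring

lemma kPsi_fderiv_apply (z v : (EuclideanSpace ℝ (Fin N))) : fderiv ℝ kPsi z v = -(kEta z * inner ℝ z v) := by
  rw [(kPsi_hasFDerivAt z).fderiv]; simp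

lemma lap_kPsi (z : (EuclideanSpace ℝ (Fin N))) : lap kPsi z = -(N * kEta z + fderiv ℝ kEta z z) := by
  unfold lap
  have hη : Differentiable ℝ (kEta : (EuclideanSpace ℝ (Fin N)) → ℝ) := kEta_contDiff.differentiable (by norm_num)
  have h1 : ∀ i : Fin N, fderiv ℝ (fun y => fderiv ℝ kPsi y (EuclideanSpace.single i 1)) z
      (EuclideanSpace.single i 1) =
      -(kEta z + fderiv ℝ kEta z (z i • EuclideanSpace.single i 1)) := by
    intro i
    have h2 : (fun y : (EuclideanSpace ℝ (Fin N)) => fderiv ℝ kPsi y (EuclideanSpace.single i 1)) =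
        fun y => -(kEta y * y i) := by
      funext y
      rw [kPsi_fderiv_apply]
      simp [EuclideanSpace.inner_single_right]
    have h3 : HasFDerivAt (fun y : (EuclideanSpace ℝ (Fin N)) => y i) (EuclideanSpace.proj i : (EuclideanSpace ℝ (Fin N)) →L[ℝ] ℝ) z :=
      (EuclideanSpace.proj i : (EuclideanSpace ℝ (Fin N)) →L[ℝ] ℝ).hasFDerivAt
    have h4 : HasFDerivAt (fun y : (EuclideanSpace ℝ (Fin N)) => -(kEta y * y i)) _ z :=
      ((hη z).hasFDerivAt.mul h3).neg
    rw [h2, h4.fderiv]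
    simp
  simp_rw [h1]
  rw [Finset.sum_neg_distrib, Finset.sum_add_distrib, ← map_sum]
  congr 3
  · simp
  · ext j
    simp [Finset.sum_apply, Pi.single_apply]

end kernels

section averages
variable {N : ℕ} {F : Type*} [NormedAddCommGroup F] [NormedSpace ℝ F]


/-- Scaled average of `g` against the kernel `k`. -/
def Av (k : EuclideanSpace ℝ (Fin N) → F) (g : EuclideanSpace ℝ (Fin N) → ℝ) (s : ℝ)
    (x : EuclideanSpace ℝ (Fin N)) : F := ∫ z, g (x - s • z) • k z

variable {k : (EuclideanSpace ℝ (Fin N)) → F} {g : (EuclideanSpace ℝ (Fin N)) → ℝ} {B : ℝ}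

lemma Av_integrable (hk : Continuous k) (hkc : HasCompactSupport k) (hg : Continuous g)
    (s : ℝ) (x : (EuclideanSpace ℝ (Fin N))) : Integrable (fun z => g (x - s • z) • k z) := by
  refine Continuous.integrable_of_hasCompactSupport (by fun_prop) ?_
  exact hkc.smul_left

lemma Av_norm_le (hk : Continuous k) (hkc : HasCompactSupport k)
    (hB : ∀ x, |g x| ≤ B) (s : ℝ) (x : (EuclideanSpace ℝ (Fin N))) : ‖Av k g s x‖ ≤ B * ∫ z, ‖k z‖ := by
  unfold Av
  rw [← integral_const_mul]
  refine norm_integral_le_of_norm_le ?_ (Filter.Eventually.of_forall fun z => ?_)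
  · exact ((hk.integrable_of_hasCompactSupport hkc).norm).const_mul B
  · rw [norm_smul]
    exact mul_le_mul_of_nonneg_right (hB _) (norm_nonneg _)

lemma Av_continuous (hk : Continuous k) (hkc : HasCompactSupport k) (hg : Continuous g)
    (hB : ∀ x, |g x| ≤ B) : Continuous (fun q : ℝ × (EuclideanSpace ℝ (Fin N)) => Av k g q.1 q.2) := by
  unfold Av
  refine continuous_of_dominated (bound := fun z => B * ‖k z‖) ?_ ?_ ?_ ?_
  · intro q
    exact (Av_integrable hk hkc hg q.1 q.2).aestronglyMeasurable
  · intro q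
    refine Filter.Eventually.of_forall fun z => ?_
    rw [norm_smul]
    exact mul_le_mul_of_nonneg_right (hB _) (norm_nonneg _)
  · exact ((hk.integrable_of_hasCompactSupport hkc).norm).const_mul B
  · refine Filter.Eventually.of_forall fun z => ?_
    fun_prop

lemma Av_continuous_s (hk : Continuous k) (hkc : HasCompactSupport k) (hg : Continuous g)
    (hB : ∀ x, |g x| ≤ B) (x : (EuclideanSpace ℝ (Fin N))) : Continuous (fun s : ℝ => Av k g s x) :=
  (Av_continuous hk hkc hg hB).comp (continuous_id.prodMk continuous_const)

lemma Av_continuous_x (hk : Continuous k) (hkc : HasCompactSupport k) (hg : Continuous g)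
    (hB : ∀ x, |g x| ≤ B) (s : ℝ) : Continuous (fun x : (EuclideanSpace ℝ (Fin N)) => Av k g s x) :=
  (Av_continuous hk hkc hg hB).comp (continuous_const.prodMk continuous_id)

lemma Av_lip [CompleteSpace F] (hk : Continuous k) (hkc : HasCompactSupport k) (hg : Continuous g)
    (h0 : ∫ z, k z = 0) {L : ℝ} (hL : ∀ x y, |g x - g y| ≤ L * ‖x - y‖) (s : ℝ) (x : (EuclideanSpace ℝ (Fin N))) :
    ‖Av k g s x‖ ≤ |s| * (L * ∫ z, ‖z‖ * ‖k z‖) := by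
  have h1 : Av k g s x = ∫ z, (g (x - s • z) - g x) • k z := by
    simp_rw [sub_smul]
    rw [integral_sub (Av_integrable hk hkc hg s x)
      (by exact (hk.integrable_of_hasCompactSupport hkc).smul (g x)), integral_smul, h0]
    simp [Av]
  rw [h1, ← integral_const_mul, ← integral_const_mul]
  refine norm_integral_le_of_norm_le ?_ (Filter.Eventually.of_forall fun z => ?_)
  · refine Integrable.const_mul (Integrable.const_mul ?_ _) _
    refine Continuous.integrable_of_hasCompactSupport (by fun_prop) ?_
    exact (hkc.norm).mul_left
  · rw [norm_smul]
    have := hL (x - s • z) x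
    have h2 : ‖x - s • z - x‖ = |s| * ‖z‖ := by
      rw [sub_sub_cancel_left, norm_neg, norm_smul, Real.norm_eq_abs]
    rw [h2] at this
    calc ‖g (x - s • z) - g x‖ * ‖k z‖ ≤ (L * (|s| * ‖z‖)) * ‖k z‖ :=
          mul_le_mul_of_nonneg_right this (norm_nonneg _)
      _ = _ := by ring

lemma Av_eq (k : (EuclideanSpace ℝ (Fin N)) → F) (g : (EuclideanSpace ℝ (Fin N)) → ℝ) {s : ℝ} (hs : 0 < s) (x : (EuclideanSpace ℝ (Fin N))) :
    Av k g s x = (s ^ N)⁻¹ • ∫ y, g y • k (s⁻¹ • (x - y)) := by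
  have h1 : Av k g s x = ∫ z, (fun w => g (x - w) • k (s⁻¹ • w)) (s • z) := by
    unfold Av
    congr 1; funext z
    simp only [smul_smul, inv_mul_cancel₀ hs.ne', one_smul]
  rw [h1, Measure.integral_comp_smul volume (fun w => g (x - w) • k (s⁻¹ • w)) s]
  simp only [finrank_euclideanSpace, Fintype.card_fin]
  rw [abs_of_pos (by positivity)]
  congr 1
  rw [← integral_sub_left_eq_self _ volume x]
  congr 1; funext z
  simp

lemma Av_hasFDerivAt (hk : ContDiff ℝ 1 k) (hkc : HasCompactSupport k) [CompleteSpace F]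
    (hg : Continuous g) {s : ℝ} (hs : 0 < s) (x : (EuclideanSpace ℝ (Fin N))) :
    HasFDerivAt (fun x => Av k g s x) (s⁻¹ • Av (fderiv ℝ k) g s x) x := by
  have hcs : HasCompactSupport (fun z : (EuclideanSpace ℝ (Fin N)) => k (s⁻¹ • z)) :=
    hkc.comp_homeomorph (Homeomorph.smulOfNeZero s⁻¹ (inv_ne_zero hs.ne'))
  have hcd : ContDiff ℝ 1 (fun z : (EuclideanSpace ℝ (Fin N)) => k (s⁻¹ • z)) := hk.comp (contDiff_const_smul _)
  have h := hcs.hasFDerivAt_convolution_right (ContinuousLinearMap.lsmul ℝ ℝ) (μ := volume)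
    (hg.locallyIntegrable) hcd x
  have h' := h.const_smul ((s ^ N)⁻¹)
  have e1 : (fun x => Av k g s x) = fun x => (s ^ N)⁻¹ •
      (convolution g (fun z : (EuclideanSpace ℝ (Fin N)) => k (s⁻¹ • z)) (ContinuousLinearMap.lsmul ℝ ℝ) volume) x := by
    funext x
    rw [Av_eq k g hs x]
    rfl
  rw [e1]
  refine h'.congr_fderiv ?_
  rw [Av_eq _ g hs x, smul_comm s⁻¹]
  congr 1
  rw [← integral_smul]
  unfold convolution
  congr 1; funext y
  have h3 : fderiv ℝ (fun z : (EuclideanSpace ℝ (Fin N)) => k (s⁻¹ • z)) (x - y) =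
      s⁻¹ • fderiv ℝ k (s⁻¹ • (x - y)) := by
    rw [fderiv_comp_smul]
  rw [h3]
  ext v
  simp only [ContinuousLinearMap.precompR_apply, ContinuousLinearMap.lsmul_apply, ContinuousLinearMap.smul_apply]
  rw [smul_comm]
  rfl

lemma integral_fderiv_zero (hk : ContDiff ℝ 1 k) (hkc : HasCompactSupport k) [CompleteSpace F] :
    ∫ z, fderiv ℝ k z = 0 := by
  have h1 := Av_hasFDerivAt (g := fun _ => (1 : ℝ)) hk hkc continuous_const one_pos 0
  have h2 : (fun x : (EuclideanSpace ℝ (Fin N)) => Av k (fun _ => (1 : ℝ)) 1 x) = fun _ => ∫ z, k z := by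
    funext x; simp [Av]
  rw [h2] at h1
  have h3 := h1.unique (hasFDerivAt_const _ _)
  simpa [Av] using h3

end averages

section TT
variable {N : ℕ} {F : Type*} [NormedAddCommGroup F] [NormedSpace ℝ F]


/-- Superposition of averages. -/
def TT (ε : ℝ) (m : ℝ → ℝ) (k : EuclideanSpace ℝ (Fin N) → F)
    (g : EuclideanSpace ℝ (Fin N) → ℝ) (x : EuclideanSpace ℝ (Fin N)) : F :=
  ∫ s in (0 : ℝ)..ε, m s • Av k g s x

variable {k : (EuclideanSpace ℝ (Fin N)) → F} {g : (EuclideanSpace ℝ (Fin N)) → ℝ} {B ε : ℝ} {m : ℝ → ℝ}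

lemma TT_meas (hε : 0 < ε) (hm : ContinuousOn m (Ioc 0 ε)) (hk : Continuous k)
    (hkc : HasCompactSupport k) (hg : Continuous g) (hB : ∀ x, |g x| ≤ B) (x : (EuclideanSpace ℝ (Fin N))) :
    AEStronglyMeasurable (fun s => m s • Av k g s x) (volume.restrict (Ι 0 ε)) := by
  rw [uIoc_of_le hε.le]
  refine ContinuousOn.aestronglyMeasurable ?_ measurableSet_Ioc
  exact hm.smul (Av_continuous_s hk hkc hg hB x).continuousOn

lemma TT_integrable (hε : 0 < ε) (hm : ContinuousOn m (Ioc 0 ε)) (hk : Continuous k)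
    (hkc : HasCompactSupport k) (hg : Continuous g) (hB : ∀ x, |g x| ≤ B) {x : (EuclideanSpace ℝ (Fin N))} {C : ℝ}
    (hC : ∀ s ∈ Ioc 0 ε, ‖m s • Av k g s x‖ ≤ C) :
    IntervalIntegrable (fun s => m s • Av k g s x) volume 0 ε := by
  rw [intervalIntegrable_iff]
  refine Integrable.mono' (g := fun _ => C) ?_ (TT_meas hε hm hk hkc hg hB x) ?_
  · rw [uIoc_of_le hε.le]
    exact integrableOn_const (by simp)
  · refine (ae_restrict_iff' measurableSet_uIoc).2 (Filter.Eventually.of_forall fun s hs => ?_)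
    rw [uIoc_of_le hε.le] at hs
    exact hC s hs

lemma TT_continuous (hε : 0 < ε) (hm : ContinuousOn m (Ioc 0 ε)) (hk : Continuous k)
    (hkc : HasCompactSupport k) (hg : Continuous g) (hB : ∀ x, |g x| ≤ B) {C : ℝ}
    (hC : ∀ x, ∀ s ∈ Ioc 0 ε, ‖m s • Av k g s x‖ ≤ C) : Continuous (TT ε m k g) := by
  unfold TT
  refine intervalIntegral.continuous_of_dominated_interval (bound := fun _ => C)
    (fun x => TT_meas hε hm hk hkc hg hB x) ?_ (by simp) ?_
  · intro x
    refine Filter.Eventually.of_forall fun s hs => ?_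
    rw [uIoc_of_le hε.le] at hs
    exact hC x s hs
  · refine Filter.Eventually.of_forall fun s hs => ?_
    exact (Av_continuous_x hk hkc hg hB s).const_smul (m s)

lemma TT_hasFDerivAt [CompleteSpace F] (hε : 0 < ε) (hm : ContinuousOn m (Ioc 0 ε))
    (hk : ContDiff ℝ 1 k) (hkc : HasCompactSupport k) (hg : Continuous g)
    (hB : ∀ x, |g x| ≤ B) {C C' : ℝ}
    (hC : ∀ x, ∀ s ∈ Ioc 0 ε, ‖m s • Av k g s x‖ ≤ C)
    (hC' : ∀ x, ∀ s ∈ Ioc 0 ε, ‖(m s * s⁻¹) • Av (fderiv ℝ k) g s x‖ ≤ C') (x : (EuclideanSpace ℝ (Fin N))) :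
    HasFDerivAt (TT ε m k g) (TT ε (fun s => m s * s⁻¹) (fderiv ℝ k) g x) x := by
  have hm' : ContinuousOn (fun s => m s * s⁻¹) (Ioc 0 ε) :=
    hm.mul (continuousOn_inv₀.mono (fun s hs => (ne_of_gt hs.1)))
  unfold TT
  refine intervalIntegral.hasFDerivAt_integral_of_dominated_of_fderiv_le
    (F' := fun x s => (m s * s⁻¹) • Av (fderiv ℝ k) g s x) (bound := fun _ => C') (s := univ) Filter.univ_mem
    (Filter.Eventually.of_forall fun x => TT_meas hε hm hk.continuous hkc hg hB x)
    (TT_integrable hε hm hk.continuous hkc hg hB (hC x))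
    (TT_meas hε hm' (hk.continuous_fderiv one_ne_zero) (hkc.fderiv ℝ) hg hB x) ?_ (by simp) ?_
  · refine Filter.Eventually.of_forall fun s hs x _ => ?_
    rw [uIoc_of_le hε.le] at hs
    exact hC' x s hs
  · refine Filter.Eventually.of_forall fun s hs x _ => ?_
    rw [uIoc_of_le hε.le] at hs
    have := (Av_hasFDerivAt hk hkc hg hs.1 x).const_smul (m s)
    rwa [smul_smul] at this

end TT

section lapcalc
variable {N : ℕ}

/-- Trace of a bilinear form. -/
def trL (N : ℕ) : ((EuclideanSpace ℝ (Fin N)) →L[ℝ] (EuclideanSpace ℝ (Fin N)) →L[ℝ] ℝ) →L[ℝ] ℝ :=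
  ∑ i : Fin N, (ContinuousLinearMap.apply ℝ ℝ (EuclideanSpace.single i (1 : ℝ))).comp
    (ContinuousLinearMap.apply ℝ ((EuclideanSpace ℝ (Fin N)) →L[ℝ] ℝ) (EuclideanSpace.single i (1 : ℝ)))

lemma trL_apply (L : (EuclideanSpace ℝ (Fin N)) →L[ℝ] (EuclideanSpace ℝ (Fin N)) →L[ℝ] ℝ) :
    trL N L = ∑ i : Fin N, L (EuclideanSpace.single i 1) (EuclideanSpace.single i 1) := by
  simp [trL, ContinuousLinearMap.sum_apply]

lemma lap_eq_of_hasFDerivAt {f : (EuclideanSpace ℝ (Fin N)) → ℝ} {f' : (EuclideanSpace ℝ (Fin N)) → (EuclideanSpace ℝ (Fin N)) →L[ℝ] ℝ} {f'' : (EuclideanSpace ℝ (Fin N)) →L[ℝ] (EuclideanSpace ℝ (Fin N)) →L[ℝ] ℝ} {x : (EuclideanSpace ℝ (Fin N))}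
    (h : ∀ᶠ y in nhds x, HasFDerivAt f (f' y) y) (h2 : HasFDerivAt f' f'' x) :
    lap f x = trL N f'' := by
  rw [trL_apply]
  unfold lap
  refine Finset.sum_congr rfl fun i _ => ?_
  have h1 : (fun y => fderiv ℝ f y (EuclideanSpace.single i 1)) =ᶠ[nhds x]
      fun y => f' y (EuclideanSpace.single i 1) := by
    filter_upwards [h] with y hy
    rw [hy.fderiv]
  rw [h1.fderiv_eq]
  have h3 := (ContinuousLinearMap.apply ℝ ℝ (EuclideanSpace.single i (1 : ℝ) : (EuclideanSpace ℝ (Fin N)))).hasFDerivAt.comp x h2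
  have h4 : HasFDerivAt (fun y => f' y (EuclideanSpace.single i 1)) _ x := h3
  rw [h4.fderiv]
  rfl

lemma eventually_hasFDerivAt {f : (EuclideanSpace ℝ (Fin N)) → ℝ} {x : (EuclideanSpace ℝ (Fin N))} (h : ContDiffAt ℝ 2 f x) :
    ∀ᶠ y in nhds x, HasFDerivAt f (fderiv ℝ f y) y := by
  have := h.eventually (by simp)
  filter_upwards [this] with y hy
  exact (hy.differentiableAt (by norm_num)).hasFDerivAt

lemma hasFDerivAt_fderiv {f : (EuclideanSpace ℝ (Fin N)) → ℝ} {x : (EuclideanSpace ℝ (Fin N))} (h : ContDiffAt ℝ 2 f x) :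
    HasFDerivAt (fderiv ℝ f) (fderiv ℝ (fderiv ℝ f) x) x := by
  have : ContDiffAt ℝ 1 (fderiv ℝ f) x := h.fderiv_right (by norm_num)
  exact (this.differentiableAt (by norm_num)).hasFDerivAt

lemma lap_eq {f : (EuclideanSpace ℝ (Fin N)) → ℝ} {x : (EuclideanSpace ℝ (Fin N))} (h : ContDiffAt ℝ 2 f x) :
    lap f x = trL N (fderiv ℝ (fderiv ℝ f) x) :=
  lap_eq_of_hasFDerivAt (eventually_hasFDerivAt h) (hasFDerivAt_fderiv h)

lemma lap_congr {f g : (EuclideanSpace ℝ (Fin N)) → ℝ} {x : (EuclideanSpace ℝ (Fin N))} (h : f =ᶠ[nhds x] g) : lap f x = lap g x := by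
  unfold lap
  refine Finset.sum_congr rfl fun i _ => ?_
  have h1 : (fun y => fderiv ℝ f y (EuclideanSpace.single i 1)) =ᶠ[nhds x]
      fun y => fderiv ℝ g y (EuclideanSpace.single i 1) := by
    filter_upwards [h.eventuallyEq_nhds] with y hy
    rw [hy.fderiv_eq]
  rw [h1.fderiv_eq]

lemma lap_continuous {f : (EuclideanSpace ℝ (Fin N)) → ℝ} (h : ContDiff ℝ 2 f) : Continuous (lap f) := by
  have : lap f = fun x => trL N (fderiv ℝ (fderiv ℝ f) x) := by
    funext x; exact lap_eq h.contDiffAt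
  rw [this]
  have h1 : ContDiff ℝ 1 (fderiv ℝ f) := h.fderiv_right (by norm_num)
  exact (trL N).continuous.comp (h1.continuous_fderiv one_ne_zero)

lemma lap_compact {f : (EuclideanSpace ℝ (Fin N)) → ℝ} (h : ContDiff ℝ 2 f) (hc : HasCompactSupport f) :
    HasCompactSupport (lap f) := by
  have : lap f = fun x => trL N (fderiv ℝ (fderiv ℝ f) x) := by
    funext x; exact lap_eq h.contDiffAt
  rw [this]
  exact ((hc.fderiv ℝ).fderiv ℝ).comp_left (g := trL N) (map_zero _)

lemma lap_integral_zero {k : (EuclideanSpace ℝ (Fin N)) → ℝ} (h : ContDiff ℝ 2 k) (hc : HasCompactSupport k) :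
    ∫ z, lap k z = 0 := by
  have : lap k = fun x => trL N (fderiv ℝ (fderiv ℝ k) x) := by
    funext x; exact lap_eq h.contDiffAt
  rw [this]
  have h1 : ContDiff ℝ 1 (fderiv ℝ k) := h.fderiv_right (by norm_num)
  have hcc := ((hc.fderiv ℝ).fderiv ℝ)
  rw [ContinuousLinearMap.integral_comp_comm (trL N)
    ((h1.continuous_fderiv one_ne_zero).integrable_of_hasCompactSupport hcc),
    integral_fderiv_zero h1 (hc.fderiv ℝ), map_zero]

lemma Av_comp {F G : Type*} [NormedAddCommGroup F] [NormedSpace ℝ F] [CompleteSpace F]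
    [NormedAddCommGroup G] [NormedSpace ℝ G] [CompleteSpace G] (L : F →L[ℝ] G)
    {k : (EuclideanSpace ℝ (Fin N)) → F} {g : (EuclideanSpace ℝ (Fin N)) → ℝ} (hk : Continuous k) (hkc : HasCompactSupport k) (hg : Continuous g)
    (s : ℝ) (x : (EuclideanSpace ℝ (Fin N))) : Av (fun z => L (k z)) g s x = L (Av k g s x) := by
  unfold Av
  rw [← ContinuousLinearMap.integral_comp_comm L (Av_integrable hk hkc hg s x)]
  simp

end lapcalc

lemma nsmul_gen {F : Type*} [NormedAddCommGroup F] [NormedSpace ℝ F] (a : ℝ) (v : F) :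
    ‖a • v‖ = |a| * ‖v‖ := by rw [norm_smul, Real.norm_eq_abs]

section TTreg
variable {N : ℕ} {k : (EuclideanSpace ℝ (Fin N)) → ℝ} {g : (EuclideanSpace ℝ (Fin N)) → ℝ} {B ε W : ℝ} {ω : ℝ → ℝ}

lemma TT_bound0 (hω : ∀ s ∈ Ioc 0 ε, |ω s| ≤ W) (hk : Continuous k)
    (hkc : HasCompactSupport k) (hB : ∀ x, |g x| ≤ B) (x : (EuclideanSpace ℝ (Fin N))) (s : ℝ) (hs : s ∈ Ioc 0 ε) :
    ‖(ω s * s) • Av k g s x‖ ≤ W * ε * (B * ∫ z, ‖k z‖) := by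
  have hB0 : 0 ≤ B := (abs_nonneg _).trans (hB 0)
  have hW0 : 0 ≤ W := (abs_nonneg _).trans (hω s hs)
  rw [norm_smul, Real.norm_eq_abs, abs_mul]
  have h1 := Av_norm_le hk hkc hB s x
  have hε0 : 0 ≤ ε := hs.1.le.trans hs.2
  have h2 : |s| ≤ ε := by rw [abs_of_pos hs.1]; exact hs.2
  have h3 := hω s hs
  gcongr

lemma TT_bound1 (hω : ∀ s ∈ Ioc 0 ε, |ω s| ≤ W) (hk : ContDiff ℝ 1 k)
    (hkc : HasCompactSupport k) (hB : ∀ x, |g x| ≤ B) (x : (EuclideanSpace ℝ (Fin N))) (s : ℝ) (hs : s ∈ Ioc 0 ε) :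
    ‖(ω s * s * s⁻¹) • Av (fderiv ℝ k) g s x‖ ≤ W * (B * ∫ z, ‖fderiv ℝ k z‖) := by
  have hB0 : 0 ≤ B := (abs_nonneg _).trans (hB 0)
  have hW0 : 0 ≤ W := (abs_nonneg _).trans (hω s hs)
  rw [mul_assoc, mul_inv_cancel₀ hs.1.ne', mul_one, norm_smul, Real.norm_eq_abs]
  have h1 := Av_norm_le (hk.continuous_fderiv one_ne_zero) (hkc.fderiv ℝ) hB s x
  have h3 := hω s hs
  gcongr

lemma TT_bound2 (hω : ∀ s ∈ Ioc 0 ε, |ω s| ≤ W) (hk : ContDiff ℝ 2 k)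
    (hkc : HasCompactSupport k) (hg : Continuous g) {L : ℝ}
    (hL : ∀ x y, |g x - g y| ≤ L * ‖x - y‖) (x : (EuclideanSpace ℝ (Fin N))) (s : ℝ) (hs : s ∈ Ioc 0 ε) :
    ‖(ω s * s * s⁻¹ * s⁻¹) • Av (fderiv ℝ (fderiv ℝ k)) g s x‖ ≤
      W * (L * ∫ z, ‖z‖ * ‖fderiv ℝ (fderiv ℝ k) z‖) := by
  have hW0 : 0 ≤ W := (abs_nonneg _).trans (hω s hs)
  have hk1 : ContDiff ℝ 1 (fderiv ℝ k) := hk.fderiv_right (by norm_num)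
  have h1 := Av_lip (hk1.continuous_fderiv one_ne_zero) ((hkc.fderiv ℝ).fderiv ℝ) hg
    (integral_fderiv_zero hk1 (hkc.fderiv ℝ)) hL s x
  rw [mul_assoc (ω s), mul_inv_cancel₀ hs.1.ne', mul_one]
  refine (nsmul_gen (F := (EuclideanSpace ℝ (Fin N)) →L[ℝ] (EuclideanSpace ℝ (Fin N)) →L[ℝ] ℝ) (ω s * s⁻¹) (Av (fderiv ℝ (fderiv ℝ k)) g s x)).trans_le ?_
  rw [abs_mul, abs_inv, mul_assoc]
  have h3 := hω s hs
  have h4 : |s|⁻¹ * ‖Av (fderiv ℝ (fderiv ℝ k)) g s x‖ ≤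
      L * ∫ z, ‖z‖ * ‖fderiv ℝ (fderiv ℝ k) z‖ := by
    rw [inv_mul_le_iff₀ (abs_pos.2 hs.1.ne')]
    exact h1
  have : 0 ≤ |s|⁻¹ * ‖Av (fderiv ℝ (fderiv ℝ k)) g s x‖ := by positivity
  gcongr

lemma TT_lip (hε : 0 < ε) (hωc : Continuous ω) (hω : ∀ s ∈ Ioc 0 ε, |ω s| ≤ W)
    (hk : ContDiff ℝ 1 k) (hkc : HasCompactSupport k) (hg : Continuous g)
    (hB : ∀ x, |g x| ≤ B) (x y : (EuclideanSpace ℝ (Fin N))) :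
    |TT ε (fun s => ω s * s) k g x - TT ε (fun s => ω s * s) k g y| ≤
      W * (B * ∫ z, ‖fderiv ℝ k z‖) * ε * ‖x - y‖ := by
  have hd : ∀ x, HasFDerivAt (TT ε (fun s => ω s * s) k g)
      (TT ε (fun s => ω s * s * s⁻¹) (fderiv ℝ k) g x) x := fun x =>
    TT_hasFDerivAt hε (by fun_prop) hk hkc hg hB
      (TT_bound0 hω hk.continuous hkc hB) (TT_bound1 hω hk hkc hB) x
  have hbd : ∀ x, ‖TT ε (fun s => ω s * s * s⁻¹) (fderiv ℝ k) g x‖ ≤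
      W * (B * ∫ z, ‖fderiv ℝ k z‖) * ε := by
    intro x
    have := intervalIntegral.norm_integral_le_of_norm_le_const (a := (0:ℝ)) (b := ε)
      (f := fun s => (ω s * s * s⁻¹) • Av (fderiv ℝ k) g s x)
      (C := W * (B * ∫ z, ‖fderiv ℝ k z‖)) (by
        intro s hs
        rw [uIoc_of_le hε.le] at hs
        exact TT_bound1 hω hk hkc hB x s hs)
    rwa [sub_zero, abs_of_pos hε] at this
  exact convex_univ.norm_image_sub_le_of_norm_hasFDerivWithin_le
    (fun x _ => (hd x).hasFDerivWithinAt) (fun x _ => hbd x) (mem_univ y) (mem_univ x)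

lemma TT_reg (hε : 0 < ε) (hωc : Continuous ω) (hω : ∀ s ∈ Ioc 0 ε, |ω s| ≤ W)
    (hk : ContDiff ℝ 2 k) (hkc : HasCompactSupport k) (hg : Continuous g)
    (hB : ∀ x, |g x| ≤ B) {L : ℝ} (hL : ∀ x y, |g x - g y| ≤ L * ‖x - y‖) :
    ContDiff ℝ 2 (TT ε (fun s => ω s * s) k g) ∧
    ∀ x, lap (TT ε (fun s => ω s * s) k g) x = ∫ s in (0:ℝ)..ε, ω s * (s⁻¹ * Av (lap k) g s x) := by
  have hk0 : ContDiff ℝ 1 k := hk.of_le (by norm_num)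
  have hk1 : ContDiff ℝ 1 (fderiv ℝ k) := hk.fderiv_right (by norm_num)
  have hmc : ContinuousOn (fun s => ω s * s * s⁻¹) (Ioc 0 ε) :=
    (by fun_prop : Continuous fun s => ω s * s).continuousOn.mul
      (continuousOn_inv₀.mono (fun s hs => (ne_of_gt hs.1)))
  have hmc2 : ContinuousOn (fun s => ω s * s * s⁻¹ * s⁻¹) (Ioc 0 ε) :=
    hmc.mul (continuousOn_inv₀.mono (fun s hs => (ne_of_gt hs.1)))
  have hd : ∀ x, HasFDerivAt (TT ε (fun s => ω s * s) k g)
      (TT ε (fun s => ω s * s * s⁻¹) (fderiv ℝ k) g x) x := fun x =>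
    TT_hasFDerivAt hε (by fun_prop) hk0 hkc hg hB
      (TT_bound0 hω hk.continuous hkc hB) (TT_bound1 hω hk0 hkc hB) x
  have hd2 : ∀ x, HasFDerivAt (TT ε (fun s => ω s * s * s⁻¹) (fderiv ℝ k) g)
      (TT ε (fun s => ω s * s * s⁻¹ * s⁻¹) (fderiv ℝ (fderiv ℝ k)) g x) x := fun x =>
    TT_hasFDerivAt hε hmc hk1 (hkc.fderiv ℝ) hg hB
      (TT_bound1 hω hk0 hkc hB) (TT_bound2 hω hk hkc hg hL) x
  have hc3 : Continuous (TT ε (fun s => ω s * s * s⁻¹ * s⁻¹) (fderiv ℝ (fderiv ℝ k)) g) :=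
    TT_continuous hε hmc2 (hk1.continuous_fderiv one_ne_zero) ((hkc.fderiv ℝ).fderiv ℝ) hg hB
      (TT_bound2 hω hk hkc hg hL)
  have e1 : fderiv ℝ (TT ε (fun s => ω s * s) k g) = TT ε (fun s => ω s * s * s⁻¹) (fderiv ℝ k) g :=
    funext fun x => (hd x).fderiv
  have e2 : fderiv ℝ (TT ε (fun s => ω s * s * s⁻¹) (fderiv ℝ k) g) =
      TT ε (fun s => ω s * s * s⁻¹ * s⁻¹) (fderiv ℝ (fderiv ℝ k)) g :=
    funext fun x => (hd2 x).fderiv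
  constructor
  · have : (2 : WithTop ℕ∞) = 1 + 1 := by norm_num
    rw [this, contDiff_succ_iff_fderiv]
    refine ⟨fun x => (hd x).differentiableAt, by simp, ?_⟩
    rw [e1, contDiff_one_iff_fderiv]
    refine ⟨fun x => (hd2 x).differentiableAt, ?_⟩
    rw [e2]; exact hc3
  · intro x
    rw [lap_eq_of_hasFDerivAt (Filter.Eventually.of_forall hd) (hd2 x)]
    unfold TT
    rw [← ContinuousLinearMap.intervalIntegral_comp_comm (trL N)
      (TT_integrable hε hmc2 (hk1.continuous_fderiv one_ne_zero) ((hkc.fderiv ℝ).fderiv ℝ) hg hB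
        (TT_bound2 hω hk hkc hg hL x))]
    have hl : lap k = fun z => trL N (fderiv ℝ (fderiv ℝ k) z) := by
      funext z; exact lap_eq hk.contDiffAt
    refine intervalIntegral.integral_congr_ae (Filter.Eventually.of_forall fun s hs => ?_)
    rw [uIoc_of_le hε.le] at hs
    rw [hl, Av_comp (trL N) (hk1.continuous_fderiv one_ne_zero) ((hkc.fderiv ℝ).fderiv ℝ) hg]
    simp only [map_smul, smul_eq_mul]
    rw [mul_assoc (ω s), mul_inv_cancel₀ hs.1.ne', mul_one, mul_assoc]

end TTreg

section deriv_s
variable {N : ℕ} {g : (EuclideanSpace ℝ (Fin N)) → ℝ} {B : ℝ}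

lemma kernel_hasDerivAt {s : ℝ} (hs : 0 < s) (w : (EuclideanSpace ℝ (Fin N))) :
    HasDerivAt (fun s : ℝ => (s ^ N)⁻¹ * kEta (s⁻¹ • w))
      (s⁻¹ * ((s ^ N)⁻¹ * lap kPsi (s⁻¹ • w))) s := by
  have h1 : HasDerivAt (fun s : ℝ => (s ^ N)⁻¹) (-(N : ℝ) * s⁻¹ * (s ^ N)⁻¹) s := by
    have := (hasDerivAt_pow N s).inv (pow_ne_zero _ hs.ne')
    refine this.congr_deriv ?_
    rcases N with _ | n
    · simp
    · field_simp
      simp; ring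
  have h2 : HasDerivAt (fun s : ℝ => s⁻¹ • w) ((-(s ^ 2)⁻¹) • w) s :=
    (hasDerivAt_inv hs.ne').smul_const w
  have hη : HasFDerivAt (kEta : (EuclideanSpace ℝ (Fin N)) → ℝ) (fderiv ℝ kEta (s⁻¹ • w)) (s⁻¹ • w) :=
    ((kEta_contDiff.differentiable (by norm_num)) _).hasFDerivAt
  have h3 : HasDerivAt (fun s : ℝ => kEta (s⁻¹ • w))
      (fderiv ℝ kEta (s⁻¹ • w) ((-(s ^ 2)⁻¹) • w)) s := by
    have := HasFDerivAt.comp_hasDerivAt (f := fun s : ℝ => s⁻¹ • w) (l := (kEta : (EuclideanSpace ℝ (Fin N)) → ℝ)) s hη h2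
    exact this
  refine (h1.mul h3).congr_deriv ?_
  rw [lap_kPsi, map_smul, map_smul, smul_eq_mul, smul_eq_mul]
  field_simp
  ring

lemma lap_kPsi_zero {z : (EuclideanSpace ℝ (Fin N))} (hz : 1 < ‖z‖) : lap kPsi z = 0 := by
  have h : (kPsi : (EuclideanSpace ℝ (Fin N)) → ℝ) =ᶠ[nhds z] fun _ => 0 := by
    filter_upwards [(isOpen_lt continuous_const continuous_norm).mem_nhds hz] with y hy
    exact kPsi_zero (le_of_lt hy)
  rw [lap_congr h]
  simp [lap]

lemma kPsi_C2 : ContDiff ℝ 2 (kPsi : (EuclideanSpace ℝ (Fin N)) → ℝ) := kPsi_contDiff.of_le (by norm_num)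

lemma Av_hasDerivAt (hg : Continuous g) (hB : ∀ x, |g x| ≤ B) {s : ℝ} (hs : 0 < s) (x : (EuclideanSpace ℝ (Fin N))) :
    HasDerivAt (fun s => Av kEta g s x) (s⁻¹ * Av (lap kPsi) g s x) s := by
  have hB0 : 0 ≤ B := (abs_nonneg _).trans (hB 0)
  have hlc : Continuous (lap (kPsi : (EuclideanSpace ℝ (Fin N)) → ℝ)) := lap_continuous kPsi_C2
  obtain ⟨C, hC⟩ := (lap_compact (N := N) kPsi_C2 kPsi_compact).exists_bound_of_continuous hlc
  have hC0 : 0 ≤ C := (norm_nonneg _).trans (hC 0)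
  have hev : (fun s => Av kEta g s x) =ᶠ[nhds s]
      fun s => ∫ y, g y * ((s ^ N)⁻¹ * kEta (s⁻¹ • (x - y))) := by
    filter_upwards [lt_mem_nhds hs] with t ht
    rw [Av_eq _ g ht, smul_eq_mul, ← integral_const_mul]
    congr 1; funext y; simp only [smul_eq_mul]; ring
  have e2 : s⁻¹ * Av (lap kPsi) g s x =
      ∫ y, g y * (s⁻¹ * ((s ^ N)⁻¹ * lap kPsi (s⁻¹ • (x - y)))) := by
    rw [Av_eq _ g hs, smul_eq_mul, ← integral_const_mul, ← integral_const_mul]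
    congr 1; funext y; simp only [smul_eq_mul]; ring
  rw [e2]
  refine HasDerivAt.congr_of_eventuallyEq ?_ hev
  have hcs : HasCompactSupport (fun y : (EuclideanSpace ℝ (Fin N)) => kEta (s⁻¹ • (x - y))) :=
    (kEta_compact.comp_homeomorph (Homeomorph.smulOfNeZero s⁻¹ (inv_ne_zero hs.ne'))).comp_homeomorph
      (Homeomorph.subLeft x)
  have hηc : Continuous (kEta : (EuclideanSpace ℝ (Fin N)) → ℝ) := kEta_contDiff.continuous
  have hnh : Ioo (s/2) (2*s) ∈ nhds s := Ioo_mem_nhds (by linarith) (by linarith)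
  refine (hasDerivAt_integral_of_dominated_loc_of_deriv_le (s := Ioo (s/2) (2*s))
    (F := fun s y => g y * ((s ^ N)⁻¹ * kEta (s⁻¹ • (x - y))))
    (F' := fun s y => g y * (s⁻¹ * ((s ^ N)⁻¹ * lap kPsi (s⁻¹ • (x - y)))))
    (bound := (closedBall x (2*s)).indicator fun _ => B * ((s/2)⁻¹ * (((s/2) ^ N)⁻¹ * C)))
    hnh ?_ ?_ ?_ ?_ ?_ ?_).2
  · refine Filter.Eventually.of_forall fun t => Continuous.aestronglyMeasurable ?_
    fun_prop
  · refine Continuous.integrable_of_hasCompactSupport (by fun_prop) ?_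
    exact (hcs.mul_left).mul_left
  · refine Continuous.aestronglyMeasurable ?_
    fun_prop
  · refine Filter.Eventually.of_forall fun y t ht => ?_
    have ht0 : 0 < t := by linarith [ht.1]
    by_cases hy : y ∈ closedBall x (2*s)
    · rw [indicator_of_mem hy, norm_mul, norm_mul, norm_mul, norm_inv, norm_inv, norm_pow]
      have a1 : ‖g y‖ ≤ B := hB y
      have a2 := hC (t⁻¹ • (x - y))
      have a3 : s/2 ≤ ‖t‖ := by rw [Real.norm_eq_abs, abs_of_pos ht0]; exact ht.1.le
      have : 0 < s/2 := by linarith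
      gcongr
    · rw [indicator_of_notMem hy]
      have : lap (kPsi : (EuclideanSpace ℝ (Fin N)) → ℝ) (t⁻¹ • (x - y)) = 0 := by
        apply lap_kPsi_zero
        rw [norm_smul, norm_inv, Real.norm_eq_abs, abs_of_pos ht0, ← div_eq_inv_mul,
          one_lt_div ht0]
        rw [mem_closedBall, dist_comm, dist_eq_norm, not_le] at hy
        linarith [ht.2]
      simp [this]
  · refine (integrable_indicator_iff measurableSet_closedBall).2 ?_
    exact integrableOn_const (isCompact_closedBall x (2*s)).measure_ne_top
  · refine Filter.Eventually.of_forall fun y t ht => ?_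
    have ht0 : 0 < t := by linarith [ht.1]
    exact (kernel_hasDerivAt ht0 (x - y)).const_mul (g y)

lemma green {φ ψ : (EuclideanSpace ℝ (Fin N)) → ℝ} (hφ : ContDiff ℝ 2 φ) (hψ : ContDiff ℝ 2 ψ) (hc : HasCompactSupport ψ) :
    ∫ z, φ z * lap ψ z = ∫ z, lap φ z * ψ z := by
  have key : ∀ v : (EuclideanSpace ℝ (Fin N)), (∫ z, φ z * fderiv ℝ (fun y => fderiv ℝ ψ y v) z v =
      ∫ z, fderiv ℝ (fun y => fderiv ℝ φ y v) z v * ψ z) ∧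
      Integrable (fun z => φ z * fderiv ℝ (fun y => fderiv ℝ ψ y v) z v) ∧
      Integrable (fun z => fderiv ℝ (fun y => fderiv ℝ φ y v) z v * ψ z) := by
    intro v
    have c1 : ContDiff ℝ 1 (fun y => fderiv ℝ ψ y v) :=
      (hψ.fderiv_right (m := 1) (by norm_num)).clm_apply contDiff_const
    have c2 : ContDiff ℝ 1 (fun y => fderiv ℝ φ y v) :=
      (hφ.fderiv_right (m := 1) (by norm_num)).clm_apply contDiff_const
    have d1 : Continuous (fun z => fderiv ℝ (fun y => fderiv ℝ ψ y v) z v) :=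
      (c1.continuous_fderiv one_ne_zero).clm_apply continuous_const
    have d2 : Continuous (fun z => fderiv ℝ (fun y => fderiv ℝ φ y v) z v) :=
      (c2.continuous_fderiv one_ne_zero).clm_apply continuous_const
    have s1 : HasCompactSupport (fun y => fderiv ℝ ψ y v) := hc.fderiv_apply ℝ v
    have s2 : HasCompactSupport (fun z => fderiv ℝ (fun y => fderiv ℝ ψ y v) z v) :=
      s1.fderiv_apply ℝ v
    have i1 : Integrable (fun z => φ z * fderiv ℝ (fun y => fderiv ℝ ψ y v) z v) :=
      (hφ.continuous.mul d1).integrable_of_hasCompactSupport s2.mul_left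
    have i2 : Integrable (fun z => fderiv ℝ (fun y => fderiv ℝ φ y v) z v * ψ z) :=
      (d2.mul hψ.continuous).integrable_of_hasCompactSupport hc.mul_left
    have i3 : Integrable (fun z => fderiv ℝ φ z v * fderiv ℝ ψ z v) :=
      (c2.continuous.mul c1.continuous).integrable_of_hasCompactSupport s1.mul_left
    have i4 : Integrable (fun z => φ z * fderiv ℝ ψ z v) :=
      (hφ.continuous.mul c1.continuous).integrable_of_hasCompactSupport s1.mul_left
    have i5 : Integrable (fun z => fderiv ℝ φ z v * ψ z) :=
      (c2.continuous.mul hψ.continuous).integrable_of_hasCompactSupport hc.mul_left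
    refine ⟨?_, i1, i2⟩
    rw [integral_mul_fderiv_eq_neg_fderiv_mul_of_integrable i3 i1 i4
      (fun x _ => (hφ.differentiable (by norm_num)) x) (fun x _ => (c1.differentiable (by norm_num)) x),
      integral_mul_fderiv_eq_neg_fderiv_mul_of_integrable (f := fun z => fderiv ℝ φ z v) i2 i3 i5
      (fun x _ => (c2.differentiable (by norm_num)) x) (fun x _ => (hψ.differentiable (by norm_num)) x), neg_neg]
  unfold lap
  simp_rw [Finset.mul_sum, Finset.sum_mul]
  rw [integral_finsetSum _ (fun i _ => (key _).2.1), integral_finsetSum _ (fun i _ => (key _).2.2)]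
  exact Finset.sum_congr rfl fun i _ => (key _).1

lemma lap_affine {u : (EuclideanSpace ℝ (Fin N)) → ℝ} (hu : ContDiff ℝ 2 u) (s : ℝ) (x z : (EuclideanSpace ℝ (Fin N))) :
    lap (fun z => u (x - s • z)) z = s ^ 2 * lap u (x - s • z) := by
  have h0 : ∀ v : (EuclideanSpace ℝ (Fin N)), ∀ f : (EuclideanSpace ℝ (Fin N)) → ℝ, Differentiable ℝ f → ∀ z, fderiv ℝ (fun z => f (x - s • z)) z v
      = -s * fderiv ℝ f (x - s • z) v := by
    intro v f hf z
    have h1 : HasFDerivAt (fun z : (EuclideanSpace ℝ (Fin N)) => x - s • z) (-(s • ContinuousLinearMap.id ℝ (EuclideanSpace ℝ (Fin N)))) z :=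
      ((hasFDerivAt_id z).const_smul s).const_sub x
    have h2 := ((hf (x - s • z)).hasFDerivAt.comp z h1)
    have h3 : HasFDerivAt (fun z => f (x - s • z)) _ z := h2
    rw [h3.fderiv]
    simp
  unfold lap
  rw [Finset.mul_sum]
  refine Finset.sum_congr rfl fun i _ => ?_
  have c2 : ContDiff ℝ 1 (fun y => fderiv ℝ u y (EuclideanSpace.single i 1)) :=
      (hu.fderiv_right (m := 1) (by norm_num)).clm_apply contDiff_const
  have : (fun y => fderiv ℝ (fun z => u (x - s • z)) y (EuclideanSpace.single i 1)) =
    fun y => -s * (fun w => fderiv ℝ u w (EuclideanSpace.single i 1)) (x - s • y) := by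
    funext y; exact h0 _ u (hu.differentiable (by norm_num)) y
  rw [this, fderiv_const_mul]
  · rw [smul_apply, h0 _ _ (c2.differentiable (by norm_num)), smul_eq_mul]
    ring
  · have := (c2.differentiable (by norm_num))
    fun_prop

lemma Av_lap {u : (EuclideanSpace ℝ (Fin N)) → ℝ} (hu : ContDiff ℝ 2 u) {s : ℝ} (x : (EuclideanSpace ℝ (Fin N))) :
    Av (lap kPsi) u s x = s ^ 2 * Av kPsi (lap u) s x := by
  unfold Av
  simp only [smul_eq_mul]
  rw [green (φ := fun z => u (x - s • z)) (by fun_prop) kPsi_C2 kPsi_compact]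
  rw [← integral_const_mul]
  congr 1; funext z
  rw [lap_affine hu]; ring

end deriv_s

section ops
variable {N : ℕ} 

/-- Bounded continuous functions. -/
def BC {N : ℕ} (g : EuclideanSpace ℝ (Fin N) → ℝ) : Prop :=
  Continuous g ∧ ∃ B, ∀ x, |g x| ≤ B

/-- Bounded Lipschitz functions. -/
def BL {N : ℕ} (g : EuclideanSpace ℝ (Fin N) → ℝ) : Prop :=
  (∃ B, ∀ x, |g x| ≤ B) ∧ ∃ L, ∀ x y, |g x - g y| ≤ L * ‖x - y‖

lemma lip_continuous {g : (EuclideanSpace ℝ (Fin N)) → ℝ} {L : ℝ} (h : ∀ x y, |g x - g y| ≤ L * ‖x - y‖) : Continuous g := by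
  have : LipschitzWith (Real.toNNReal L) g := by
    refine LipschitzWith.of_dist_le_mul fun x y => ?_
    rw [Real.dist_eq, dist_eq_norm]
    refine (h x y).trans ?_
    gcongr
    exact Real.le_coe_toNNReal L
  exact this.continuous

lemma BL.bc {g : (EuclideanSpace ℝ (Fin N)) → ℝ} (h : BL g) : BC g := by
  obtain ⟨hB, L, hL⟩ := h
  exact ⟨lip_continuous hL, hB⟩

lemma BC.add {g h : (EuclideanSpace ℝ (Fin N)) → ℝ} (hg : BC g) (hh : BC h) : BC (fun x => g x + h x) := by
  obtain ⟨c1, B1, h1⟩ := hg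
  obtain ⟨c2, B2, h2⟩ := hh
  exact ⟨c1.add c2, B1 + B2, fun x => (abs_add_le _ _).trans (add_le_add (h1 x) (h2 x))⟩

lemma BC.mul {g h : (EuclideanSpace ℝ (Fin N)) → ℝ} (hg : BC g) (hh : BC h) : BC (fun x => g x * h x) := by
  obtain ⟨c1, B1, h1⟩ := hg
  obtain ⟨c2, B2, h2⟩ := hh
  refine ⟨c1.mul c2, B1 * B2, fun x => ?_⟩
  rw [abs_mul]
  have := (abs_nonneg _).trans (h1 x)
  exact mul_le_mul (h1 x) (h2 x) (abs_nonneg _) this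

lemma BC.const (c : ℝ) : BC (fun _ : (EuclideanSpace ℝ (Fin N)) => c) := ⟨continuous_const, |c|, fun _ => le_rfl⟩

lemma BC.neg {g : (EuclideanSpace ℝ (Fin N)) → ℝ} (hg : BC g) : BC (fun x => - g x) := by
  obtain ⟨c1, B1, h1⟩ := hg
  exact ⟨c1.neg, B1, fun x => by rw [abs_neg]; exact h1 x⟩

lemma BC.sub {g h : (EuclideanSpace ℝ (Fin N)) → ℝ} (hg : BC g) (hh : BC h) : BC (fun x => g x - h x) := by
  simpa only [sub_eq_add_neg] using hg.add hh.neg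

lemma BL.add {g h : (EuclideanSpace ℝ (Fin N)) → ℝ} (hg : BL g) (hh : BL h) : BL (fun x => g x + h x) := by
  obtain ⟨⟨B1, h1⟩, L1, k1⟩ := hg
  obtain ⟨⟨B2, h2⟩, L2, k2⟩ := hh
  refine ⟨⟨B1 + B2, fun x => (abs_add_le _ _).trans (add_le_add (h1 x) (h2 x))⟩, L1 + L2, fun x y => ?_⟩
  have : g x + h x - (g y + h y) = (g x - g y) + (h x - h y) := by ring
  rw [this, add_mul]
  exact (abs_add_le _ _).trans (add_le_add (k1 x y) (k2 x y))

lemma BL.mul {g h : (EuclideanSpace ℝ (Fin N)) → ℝ} (hg : BL g) (hh : BL h) : BL (fun x => g x * h x) := by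
  obtain ⟨⟨B1, h1⟩, L1, k1⟩ := hg
  obtain ⟨⟨B2, h2⟩, L2, k2⟩ := hh
  refine ⟨⟨B1 * B2, fun x => ?_⟩, B1 * L2 + L1 * B2, fun x y => ?_⟩
  · rw [abs_mul]
    have := (abs_nonneg _).trans (h1 x)
    exact mul_le_mul (h1 x) (h2 x) (abs_nonneg _) this
  · have : g x * h x - (g y * h y) = g x * (h x - h y) + (g x - g y) * h y := by ring
    rw [this]
    refine (abs_add_le _ _).trans ?_
    rw [abs_mul, abs_mul]
    have a := mul_le_mul (h1 x) (k2 x y) (abs_nonneg _) ((abs_nonneg _).trans (h1 x))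
    have b := mul_le_mul (k1 x y) (h2 y) (abs_nonneg _) ((abs_nonneg _).trans (k1 x y))
    linarith

lemma BL.const (c : ℝ) : BL (fun _ : (EuclideanSpace ℝ (Fin N)) => c) := ⟨⟨|c|, fun _ => le_rfl⟩, 0, fun _ _ => by simp⟩

lemma BL.neg {g : (EuclideanSpace ℝ (Fin N)) → ℝ} (hg : BL g) : BL (fun x => - g x) := by
  have := (BL.const (N := N) (-1)).mul hg
  simpa using this

lemma BL.sub {g h : (EuclideanSpace ℝ (Fin N)) → ℝ} (hg : BL g) (hh : BL h) : BL (fun x => g x - h x) := by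
  simpa only [sub_eq_add_neg] using hg.add hh.neg

/-- The local potential operator. -/
def KK (ε : ℝ) (g : (EuclideanSpace ℝ (Fin N)) → ℝ) (x : (EuclideanSpace ℝ (Fin N))) : ℝ := TT ε (fun s => (1 - s ^ 2 / ε ^ 2) * s) kPsi g x

/-- The local averaging operator. -/
def SS (ε : ℝ) (g : (EuclideanSpace ℝ (Fin N)) → ℝ) (x : (EuclideanSpace ℝ (Fin N))) : ℝ := TT ε (fun s => (2 / ε ^ 2) * s) kEta g x

variable {ε : ℝ}

lemma wK_bound (hε : 0 < ε) : ∀ s ∈ Ioc 0 ε, |1 - s ^ 2 / ε ^ 2| ≤ 1 := by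
  intro s hs
  have : s ^ 2 / ε ^ 2 ≤ 1 := by
    rw [div_le_one (by positivity)]
    exact pow_le_pow_left₀ hs.1.le hs.2 2
  have : 0 ≤ s ^ 2 / ε ^ 2 := by positivity
  rw [abs_le]; constructor <;> linarith

lemma kPsi_C1 : ContDiff ℝ 1 (kPsi : (EuclideanSpace ℝ (Fin N)) → ℝ) := kPsi_contDiff.of_le (by norm_num)
lemma kEta_C1 : ContDiff ℝ 1 (kEta : (EuclideanSpace ℝ (Fin N)) → ℝ) := kEta_contDiff.of_le (by norm_num)

lemma KK_lip (N : ℕ) (hε : 0 < ε) : ∃ C, 0 ≤ C ∧ ∀ (g : (EuclideanSpace ℝ (Fin N)) → ℝ) (B : ℝ), Continuous g → (∀ x, |g x| ≤ B) →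
    ∀ x y, |KK ε g x - KK ε g y| ≤ C * B * ‖x - y‖ := by
  refine ⟨1 * (1 * ∫ z : (EuclideanSpace ℝ (Fin N)), ‖fderiv ℝ kPsi z‖) * ε, ?_, fun g B hg hB x y => ?_⟩
  · have : 0 ≤ ∫ z : (EuclideanSpace ℝ (Fin N)), ‖fderiv ℝ kPsi z‖ := integral_nonneg fun _ => norm_nonneg _
    positivity
  · refine (TT_lip (ω := fun s => 1 - s ^ 2 / ε ^ 2) hε (by fun_prop) (wK_bound hε) kPsi_C1 kPsi_compact hg hB x y).trans (le_of_eq ?_)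
    ring

lemma SS_lip (N : ℕ) (hε : 0 < ε) : ∃ C, 0 ≤ C ∧ ∀ (g : (EuclideanSpace ℝ (Fin N)) → ℝ) (B : ℝ), Continuous g → (∀ x, |g x| ≤ B) →
    ∀ x y, |SS ε g x - SS ε g y| ≤ C * B * ‖x - y‖ := by
  refine ⟨(2 / ε ^ 2) * (1 * ∫ z : (EuclideanSpace ℝ (Fin N)), ‖fderiv ℝ kEta z‖) * ε, ?_, fun g B hg hB x y => ?_⟩
  · have : 0 ≤ ∫ z : (EuclideanSpace ℝ (Fin N)), ‖fderiv ℝ kEta z‖ := integral_nonneg fun _ => norm_nonneg _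
    positivity
  · refine (TT_lip (ω := fun s => 2 / ε ^ 2) (W := 2 / ε ^ 2) hε (by fun_prop) (fun s _ => ?_) kEta_C1 kEta_compact hg hB x y).trans (le_of_eq ?_)
    · rw [abs_of_pos (by positivity)]
    · ring

lemma SS_C2 (hε : 0 < ε) {g : (EuclideanSpace ℝ (Fin N)) → ℝ} (hg : BL g) : ContDiff ℝ 2 (SS ε g) := by
  obtain ⟨⟨B, hB⟩, L, hL⟩ := hg
  exact (TT_reg (ω := fun s => 2 / ε ^ 2) (W := 2 / ε ^ 2) hε (by fun_prop)
    (fun s _ => by rw [abs_of_pos (by positivity)]) kEta_contDiff kEta_compact (lip_continuous hL) hB hL).1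

lemma Av_zero (g : (EuclideanSpace ℝ (Fin N)) → ℝ) (x : (EuclideanSpace ℝ (Fin N))) : Av kEta g 0 x = g x := by
  unfold Av
  simp only [zero_smul, sub_zero, smul_eq_mul]
  rw [integral_const_mul, kEta_integral, mul_one]

lemma ibp (hε : 0 < ε) {g : (EuclideanSpace ℝ (Fin N)) → ℝ} (hg : BC g) (x : (EuclideanSpace ℝ (Fin N))) {C : ℝ}
    (hD : ∀ s ∈ Ioc 0 ε, |s⁻¹ * Av (lap kPsi) g s x| ≤ C) :
    ∫ s in (0:ℝ)..ε, (1 - s ^ 2 / ε ^ 2) * (s⁻¹ * Av (lap kPsi) g s x) = - (g x - SS ε g x) := by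
  obtain ⟨hgc, B, hB⟩ := hg
  have hIntv : IntervalIntegrable (fun s => s⁻¹ • Av (lap kPsi) g s x) volume 0 ε :=
    TT_integrable hε (continuousOn_inv₀.mono (fun s hs => (ne_of_gt hs.1)))
      (lap_continuous kPsi_C2) (lap_compact kPsi_C2 kPsi_compact) hgc hB (C := C) (by simpa using hD)
  have := intervalIntegral.integral_mul_deriv_eq_deriv_mul_of_hasDerivAt (a := 0) (b := ε)
    (u := fun s => 1 - s ^ 2 / ε ^ 2) (u' := fun s => - (2 / ε ^ 2 * s))
    (v := fun s => Av kEta g s x) (v' := fun s => s⁻¹ * Av (lap kPsi) g s x)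
    (by fun_prop) (Av_continuous_s kEta_contDiff.continuous kEta_compact hgc hB x).continuousOn
    (by
      intro s _
      have := ((hasDerivAt_pow 2 s).div_const (ε ^ 2)).const_sub 1
      refine this.congr_deriv ?_
      simp; ring)
    (by
      intro s hs
      rw [min_eq_left hε.le] at hs
      exact Av_hasDerivAt hgc hB hs.1 x)
    (Continuous.intervalIntegrable (by fun_prop) _ _) hIntv
  rw [this, Av_zero]
  simp only [neg_mul, intervalIntegral.integral_neg]
  have e : SS ε g x = ∫ s in (0:ℝ)..ε, 2 / ε ^ 2 * s * Av kEta g s x := rfl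
  rw [e]
  have : ε ^ 2 / ε ^ 2 = 1 := by field_simp
  simp [this]
  ring

lemma KK_C2 (hε : 0 < ε) {g : (EuclideanSpace ℝ (Fin N)) → ℝ} (hg : BL g) :
    ContDiff ℝ 2 (KK ε g) ∧ ∀ x, -lap (KK ε g) x = g x - SS ε g x := by
  have hbc := hg.bc
  obtain ⟨⟨B, hB⟩, L, hL⟩ := hg
  have h := TT_reg (ω := fun s => 1 - s ^ 2 / ε ^ 2) hε (by fun_prop) (wK_bound hε) kPsi_C2
    kPsi_compact (lip_continuous hL) hB hL
  refine ⟨h.1, fun x => ?_⟩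
  have h2 : lap (KK ε g) x = _ := h.2 x
  rw [h2, ibp hε hbc x (C := L * ∫ z : (EuclideanSpace ℝ (Fin N)), ‖z‖ * ‖lap kPsi z‖), neg_neg]
  intro s hs
  have := Av_lip (lap_continuous kPsi_C2) (lap_compact kPsi_C2 kPsi_compact) (lip_continuous hL)
    (lap_integral_zero kPsi_C2 kPsi_compact) hL s x
  rw [abs_mul, abs_inv, inv_mul_le_iff₀ (abs_pos.2 hs.1.ne')]
  exact this

lemma KK_neg (g : (EuclideanSpace ℝ (Fin N)) → ℝ) (x : (EuclideanSpace ℝ (Fin N))) : KK ε (fun y => - g y) x = - KK ε g x := by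
  unfold KK TT Av
  simp [integral_neg, intervalIntegral.integral_neg]

lemma KS_repr (hε : 0 < ε) {u : (EuclideanSpace ℝ (Fin N)) → ℝ} (hu : ContDiff ℝ 2 u) (hb : BC u) (hl : BC (lap u)) (x : (EuclideanSpace ℝ (Fin N))) :
    u x = SS ε u x + KK ε (fun y => - lap u y) x := by
  have hl' := hl
  obtain ⟨hlc, B, hB⟩ := hl'
  have hA : ∀ s ∈ Ioc 0 ε, s⁻¹ * Av (lap kPsi) u s x = s * Av kPsi (lap u) s x := by
    intro s hs
    rw [Av_lap hu]
    have := hs.1.ne'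
    field_simp
  have := ibp hε hb x (C := ε * (B * ∫ z : (EuclideanSpace ℝ (Fin N)), ‖kPsi z‖)) (by
    intro s hs
    rw [hA s hs, abs_mul, abs_of_pos hs.1]
    have h1 := Av_norm_le kPsi_contDiff.continuous kPsi_compact hB s x
    rw [Real.norm_eq_abs] at h1
    have := hs.2
    have := hs.1
    gcongr)
  have e : KK ε (lap u) x = ∫ s in (0:ℝ)..ε, (1 - s ^ 2 / ε ^ 2) * (s⁻¹ * Av (lap kPsi) u s x) := by
    unfold KK TT
    refine intervalIntegral.integral_congr_ae (Filter.Eventually.of_forall fun s hs => ?_)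
    rw [uIoc_of_le hε.le] at hs
    rw [hA s hs, smul_eq_mul]; ring
  rw [KK_neg, e, this]; ring

end ops

section ops2
variable {N : ℕ} {ε : ℝ} {k : (EuclideanSpace ℝ (Fin N)) → ℝ} {m : ℝ → ℝ} {g h : (EuclideanSpace ℝ (Fin N)) → ℝ}

lemma TT_ii (hm : Continuous m) (hk : Continuous k) (hkc : HasCompactSupport k)
    (hg : BC g) (x : (EuclideanSpace ℝ (Fin N))) : IntervalIntegrable (fun s => m s • Av k g s x) volume 0 ε := by
  obtain ⟨hc, B, hB⟩ := hg
  exact (hm.smul (Av_continuous_s hk hkc hc hB x)).intervalIntegrable _ _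

lemma TT_add (hm : Continuous m) (hk : Continuous k) (hkc : HasCompactSupport k)
    (hg : BC g) (hh : BC h) (x : (EuclideanSpace ℝ (Fin N))) :
    TT ε m k (fun y => g y + h y) x = TT ε m k g x + TT ε m k h x := by
  unfold TT
  rw [← intervalIntegral.integral_add (TT_ii hm hk hkc hg x) (TT_ii hm hk hkc hh x)]
  congr 1; funext s
  rw [← smul_add]
  congr 1
  unfold Av
  rw [← integral_add (Av_integrable hk hkc hg.1 s x) (Av_integrable hk hkc hh.1 s x)]
  congr 1; funext z
  rw [add_smul]

lemma TT_const_mul (c : ℝ) (g : (EuclideanSpace ℝ (Fin N)) → ℝ) (x : (EuclideanSpace ℝ (Fin N))) :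
    TT ε m k (fun y => c * g y) x = c * TT ε m k g x := by
  unfold TT
  rw [← intervalIntegral.integral_const_mul]
  congr 1; funext s
  unfold Av
  simp only [smul_eq_mul]
  have e : ∀ z, c * g (x - s • z) * k z = c * (g (x - s • z) * k z) := fun z => by ring
  simp only [e]
  rw [integral_const_mul]; ring

lemma TT_sub (hm : Continuous m) (hk : Continuous k) (hkc : HasCompactSupport k)
    (hg : BC g) (hh : BC h) (x : (EuclideanSpace ℝ (Fin N))) :
    TT ε m k (fun y => g y - h y) x = TT ε m k g x - TT ε m k h x := by
  have e : (fun y => g y - h y) = fun y => g y + (-1) * h y := by funext y; ring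
  rw [e, TT_add hm hk hkc hg ((BC.const (-1)).mul hh), TT_const_mul]; ring

lemma Av_local (hk0 : ∀ z : (EuclideanSpace ℝ (Fin N)), 1 ≤ ‖z‖ → k z = 0) {x : (EuclideanSpace ℝ (Fin N))} {s : ℝ} (hs : s ∈ Ioc 0 ε)
    (hgh : ∀ y ∈ ball x ε, g y = h y) : Av k g s x = Av k h s x := by
  unfold Av
  congr 1; funext z
  by_cases hz : 1 ≤ ‖z‖
  · rw [hk0 z hz]; simp
  · rw [hgh]
    rw [mem_ball, dist_eq_norm, sub_sub_cancel_left, norm_neg, norm_smul, Real.norm_eq_abs,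
      abs_of_pos hs.1]
    have := hs.1
    have := hs.2
    push Not at hz
    calc s * ‖z‖ < s * 1 := by gcongr
      _ ≤ ε := by linarith

lemma TT_local (hε : 0 < ε) (hk0 : ∀ z : (EuclideanSpace ℝ (Fin N)), 1 ≤ ‖z‖ → k z = 0) {x : (EuclideanSpace ℝ (Fin N))}
    (hgh : ∀ y ∈ ball x ε, g y = h y) : TT ε m k g x = TT ε m k h x := by
  unfold TT
  refine intervalIntegral.integral_congr_ae (Filter.Eventually.of_forall fun s hs => ?_)
  rw [uIoc_of_le hε.le] at hs
  simp only [Av_local hk0 hs hgh]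

lemma Av_nonneg_local (hk0 : ∀ z : (EuclideanSpace ℝ (Fin N)), 1 ≤ ‖z‖ → k z = 0) (hk1 : ∀ z, 0 ≤ k z) {x : (EuclideanSpace ℝ (Fin N))} {s : ℝ}
    (hs : s ∈ Ioc 0 ε)
    (hg : ∀ y ∈ ball x ε, 0 ≤ g y) : 0 ≤ Av k g s x := by
  unfold Av
  refine integral_nonneg fun z => ?_
  by_cases hz : 1 ≤ ‖z‖
  · rw [hk0 z hz]; simp
  · push Not at hz
    refine mul_nonneg (hg _ ?_) (hk1 z)
    have h0 := hs.1
    rw [mem_ball, dist_eq_norm, sub_sub_cancel_left, norm_neg, norm_smul, Real.norm_eq_abs,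
      abs_of_pos h0]
    have := hs.2
    calc s * ‖z‖ < s * 1 := by gcongr
      _ ≤ ε := by linarith

lemma TT_nonneg_local (hε : 0 < ε) (hm : ∀ s ∈ Ioc 0 ε, 0 ≤ m s)
    (hk0 : ∀ z : (EuclideanSpace ℝ (Fin N)), 1 ≤ ‖z‖ → k z = 0) (hk1 : ∀ z, 0 ≤ k z) {x : (EuclideanSpace ℝ (Fin N))}
    (hg : ∀ y ∈ ball x ε, 0 ≤ g y) : 0 ≤ TT ε m k g x := by
  unfold TT
  rw [intervalIntegral.integral_of_le hε.le]
  refine setIntegral_nonneg measurableSet_Ioc fun s hs => ?_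
  exact mul_nonneg (hm s hs) (Av_nonneg_local hk0 hk1 hs hg)

lemma TT_tendsto {gn : ℕ → (EuclideanSpace ℝ (Fin N)) → ℝ} {B : ℝ} (hm : Continuous m) (hk : Continuous k)
    (hkc : HasCompactSupport k) (hc : ∀ n, Continuous (gn n)) (hB : ∀ n x, |gn n x| ≤ B)
    (hlim : ∀ x, Filter.Tendsto (fun n => gn n x) Filter.atTop (nhds (g x))) (x : (EuclideanSpace ℝ (Fin N))) :
    Filter.Tendsto (fun n => TT ε m k (gn n) x) Filter.atTop (nhds (TT ε m k g x)) := by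
  unfold TT
  refine intervalIntegral.tendsto_integral_filter_of_dominated_convergence
    (fun s => |m s| * (B * ∫ z, ‖k z‖)) ?_ ?_ ?_ ?_
  · exact Filter.Eventually.of_forall fun n =>
      (hm.smul (Av_continuous_s hk hkc (hc n) (hB n) x)).aestronglyMeasurable
  · refine Filter.Eventually.of_forall fun n => Filter.Eventually.of_forall fun s _ => ?_
    rw [norm_smul, Real.norm_eq_abs]
    have := Av_norm_le hk hkc (hB n) s x
    gcongr
  · exact Continuous.intervalIntegrable (by fun_prop) _ _
  · refine Filter.Eventually.of_forall fun s _ => ?_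
    refine Filter.Tendsto.const_smul ?_ _
    unfold Av
    refine tendsto_integral_of_dominated_convergence (fun z => B * ‖k z‖) ?_ ?_ ?_ ?_
    · exact fun n => (Av_integrable hk hkc (hc n) s x).aestronglyMeasurable
    · exact ((hk.integrable_of_hasCompactSupport hkc).norm).const_mul B
    · intro n
      refine Filter.Eventually.of_forall fun z => ?_
      rw [norm_smul]
      exact mul_le_mul_of_nonneg_right (hB n _) (norm_nonneg _)
    · exact Filter.Eventually.of_forall fun z => (hlim _).smul_const _

lemma wKc (ε : ℝ) : Continuous (fun s : ℝ => (1 - s ^ 2 / ε ^ 2) * s) := by fun_prop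
lemma wSc (ε : ℝ) : Continuous (fun s : ℝ => (2 / ε ^ 2) * s) := by fun_prop
lemma kPc : Continuous (kPsi : (EuclideanSpace ℝ (Fin N)) → ℝ) := kPsi_contDiff.continuous
lemma kEc : Continuous (kEta : (EuclideanSpace ℝ (Fin N)) → ℝ) := kEta_contDiff.continuous

lemma wK_nonneg (hε : 0 < ε) : ∀ s ∈ Ioc 0 ε, 0 ≤ (1 - s ^ 2 / ε ^ 2) * s := by
  intro s hs
  have : s ^ 2 / ε ^ 2 ≤ 1 := by
    rw [div_le_one (by positivity)]
    exact pow_le_pow_left₀ hs.1.le hs.2 2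
  exact mul_nonneg (by linarith) hs.1.le

lemma wS_nonneg (_hε : 0 < ε) : ∀ s ∈ Ioc 0 ε, 0 ≤ (2 / ε ^ 2) * s := by
  intro s hs
  have := hs.1
  positivity

lemma KK_add (hg : BC g) (hh : BC h) (x : (EuclideanSpace ℝ (Fin N))) :
    KK ε (fun y => g y + h y) x = KK ε g x + KK ε h x := TT_add (wKc ε) kPc kPsi_compact hg hh x
lemma SS_add (hg : BC g) (hh : BC h) (x : (EuclideanSpace ℝ (Fin N))) :
    SS ε (fun y => g y + h y) x = SS ε g x + SS ε h x := TT_add (wSc ε) kEc kEta_compact hg hh x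
lemma KK_sub (hg : BC g) (hh : BC h) (x : (EuclideanSpace ℝ (Fin N))) :
    KK ε (fun y => g y - h y) x = KK ε g x - KK ε h x := TT_sub (wKc ε) kPc kPsi_compact hg hh x
lemma SS_sub (hg : BC g) (hh : BC h) (x : (EuclideanSpace ℝ (Fin N))) :
    SS ε (fun y => g y - h y) x = SS ε g x - SS ε h x := TT_sub (wSc ε) kEc kEta_compact hg hh x
lemma KK_const_mul (c : ℝ) (g : (EuclideanSpace ℝ (Fin N)) → ℝ) (x : (EuclideanSpace ℝ (Fin N))) : KK ε (fun y => c * g y) x = c * KK ε g x :=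
  TT_const_mul c g x
lemma SS_const_mul (c : ℝ) (g : (EuclideanSpace ℝ (Fin N)) → ℝ) (x : (EuclideanSpace ℝ (Fin N))) : SS ε (fun y => c * g y) x = c * SS ε g x :=
  TT_const_mul c g x
lemma KK_local (hε : 0 < ε) {x : (EuclideanSpace ℝ (Fin N))} (hgh : ∀ y ∈ ball x ε, g y = h y) : KK ε g x = KK ε h x :=
  TT_local hε (fun _ => kPsi_zero) hgh
lemma SS_local (hε : 0 < ε) {x : (EuclideanSpace ℝ (Fin N))} (hgh : ∀ y ∈ ball x ε, g y = h y) : SS ε g x = SS ε h x :=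
  TT_local hε (fun _ => kEta_zero) hgh
lemma KK_nonneg (hε : 0 < ε) {x : (EuclideanSpace ℝ (Fin N))} (hg : ∀ y ∈ ball x ε, 0 ≤ g y) : 0 ≤ KK ε g x :=
  TT_nonneg_local hε (wK_nonneg hε) (fun _ => kPsi_zero) kPsi_nonneg hg
lemma SS_nonneg (hε : 0 < ε) {x : (EuclideanSpace ℝ (Fin N))} (hg : ∀ y ∈ ball x ε, 0 ≤ g y) : 0 ≤ SS ε g x :=
  TT_nonneg_local hε (wS_nonneg hε) (fun _ => kEta_zero) kEta_nonneg hg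

/-- Mass of `kPsi`. -/
def kap (N : ℕ) : ℝ := ∫ z : EuclideanSpace ℝ (Fin N), kPsi z

lemma kap_pos : 0 < kap N := kPsi_integral_pos

lemma KK_one (hε : 0 < ε) (x : (EuclideanSpace ℝ (Fin N))) : KK ε (fun _ => 1) x = kap N * ε ^ 2 / 4 := by
  unfold KK TT Av
  simp only [smul_eq_mul, one_mul]
  rw [intervalIntegral.integral_mul_const]
  have : ∫ s in (0:ℝ)..ε, (1 - s ^ 2 / ε ^ 2) * s = ε ^ 2 / 4 := by
    have e : (fun s : ℝ => (1 - s ^ 2 / ε ^ 2) * s) = fun s => s - s ^ 3 * (ε ^ 2)⁻¹ := by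
      funext s; field_simp
    rw [e, intervalIntegral.integral_sub (Continuous.intervalIntegrable (by fun_prop) _ _)
      (Continuous.intervalIntegrable (by fun_prop) _ _), intervalIntegral.integral_mul_const,
      integral_id, integral_pow]
    field_simp
    norm_num
    ring
  rw [this, kap]; ring

lemma SS_one (hε : 0 < ε) (x : (EuclideanSpace ℝ (Fin N))) : SS ε (fun _ => 1) x = 1 := by
  unfold SS TT Av
  simp only [smul_eq_mul, one_mul]
  rw [intervalIntegral.integral_mul_const, intervalIntegral.integral_const_mul, integral_id, kEta_integral]
  field_simp
  norm_num

/-- The operator `S - Λ K`. -/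
def EE (ε Λ : ℝ) (g : (EuclideanSpace ℝ (Fin N)) → ℝ) (x : (EuclideanSpace ℝ (Fin N))) : ℝ := SS ε g x - Λ * KK ε g x

lemma EE_nonneg {Λ : ℝ} (hε : 0 < ε) (hΛ : 0 ≤ Λ) (hεΛ : ε ^ 2 * Λ ≤ 2) (hg : BC g)
    (hg0 : ∀ y, 0 ≤ g y) (x : (EuclideanSpace ℝ (Fin N))) : 0 ≤ EE ε Λ g x := by
  unfold EE
  have e : SS ε g x - Λ * KK ε g x = ∫ s in (0:ℝ)..ε, ((2 / ε ^ 2 * s) • Av kEta g s x -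
      Λ * (((1 - s ^ 2 / ε ^ 2) * s) • Av kPsi g s x)) := by
    rw [intervalIntegral.integral_sub (TT_ii (wSc ε) kEc kEta_compact hg x)
      ((TT_ii (wKc ε) kPc kPsi_compact hg x).const_mul Λ), intervalIntegral.integral_const_mul]
    rfl
  rw [e, intervalIntegral.integral_of_le hε.le]
  refine setIntegral_nonneg measurableSet_Ioc fun s hs => ?_
  have h1 : 0 ≤ Av kPsi g s x :=
    Av_nonneg_local (fun _ => kPsi_zero) kPsi_nonneg hs (fun y _ => hg0 y)
  have h2 : Av kPsi g s x ≤ Av kEta g s x := by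
    unfold Av
    refine integral_mono (Av_integrable kPc kPsi_compact hg.1 s x)
      (Av_integrable kEc kEta_compact hg.1 s x) fun z => ?_
    exact mul_le_mul_of_nonneg_left (kPsi_le z) (hg0 _)
  have h3 : Λ * (1 - s ^ 2 / ε ^ 2) ≤ 2 / ε ^ 2 := by
    have : 0 ≤ s ^ 2 / ε ^ 2 := by positivity
    rw [le_div_iff₀ (by positivity)]
    nlinarith [mul_nonneg hΛ this, sq_nonneg ε, mul_nonneg (mul_nonneg hΛ this) (sq_nonneg ε)]
  simp only [smul_eq_mul]
  have h4 : Λ * ((1 - s ^ 2 / ε ^ 2) * s * Av kPsi g s x) ≤ 2 / ε ^ 2 * s * Av kPsi g s x := by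
    have := mul_le_mul_of_nonneg_right h3 (mul_nonneg hs.1.le h1)
    linarith
  have h5 : 2 / ε ^ 2 * s * Av kPsi g s x ≤ 2 / ε ^ 2 * s * Av kEta g s x :=
    mul_le_mul_of_nonneg_left h2 (wS_nonneg hε s hs)
  linarith

lemma EE_sub {Λ : ℝ} (hg : BC g) (hh : BC h) (x : (EuclideanSpace ℝ (Fin N))) :
    EE ε Λ (fun y => g y - h y) x = EE ε Λ g x - EE ε Λ h x := by
  unfold EE
  rw [SS_sub hg hh, KK_sub hg hh]; ring

lemma EE_mono {Λ : ℝ} (hε : 0 < ε) (hΛ : 0 ≤ Λ) (hεΛ : ε ^ 2 * Λ ≤ 2) (hg : BC g) (hh : BC h)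
    (hgh : ∀ y, g y ≤ h y) (x : (EuclideanSpace ℝ (Fin N))) : EE ε Λ g x ≤ EE ε Λ h x := by
  have := EE_nonneg hε hΛ hεΛ (hh.sub hg) (fun y => sub_nonneg.2 (hgh y)) x
  rw [EE_sub hh hg] at this
  linarith

lemma KK_mono (hε : 0 < ε) (hg : BC g) (hh : BC h)
    (hgh : ∀ y, g y ≤ h y) (x : (EuclideanSpace ℝ (Fin N))) : KK ε g x ≤ KK ε h x := by
  have := KK_nonneg (x := x) hε (g := fun y => h y - g y) (fun y _ => sub_nonneg.2 (hgh y))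
  rw [KK_sub hh hg] at this
  linarith

lemma EE_const {Λ : ℝ} (hε : 0 < ε) (c : ℝ) (x : (EuclideanSpace ℝ (Fin N))) :
    EE ε Λ (fun _ => c) x = (1 - Λ * (kap N * ε ^ 2 / 4)) * c := by
  have e : (fun _ : (EuclideanSpace ℝ (Fin N)) => c) = fun y => c * (fun _ => (1:ℝ)) y := by funext; simp
  unfold EE
  rw [e, SS_const_mul, KK_const_mul, SS_one hε, KK_one hε]; ring

lemma EE_bound {Λ B : ℝ} (hε : 0 < ε) (hΛ : 0 ≤ Λ) (hεΛ : ε ^ 2 * Λ ≤ 2) (hg : Continuous g)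
    (hB : ∀ y, |g y| ≤ B) (x : (EuclideanSpace ℝ (Fin N))) : |EE ε Λ g x| ≤ (1 - Λ * (kap N * ε ^ 2 / 4)) * B := by
  have hbc : BC g := ⟨hg, B, hB⟩
  rw [abs_le]
  constructor
  · have := EE_mono hε hΛ hεΛ (BC.const (-B)) hbc (fun y => (abs_le.1 (hB y)).1) x
    rw [EE_const hε] at this
    linarith
  · have := EE_mono hε hΛ hεΛ hbc (BC.const B) (fun y => (abs_le.1 (hB y)).2) x
    rw [EE_const hε] at this
    linarith

lemma KK_bl (hε : 0 < ε) (hg : BC g) : BL (KK ε g) := by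
  obtain ⟨hc, B, hB⟩ := hg
  obtain ⟨C, -, hC⟩ := KK_lip N hε
  refine ⟨⟨kap N * ε ^ 2 / 4 * B, fun x => ?_⟩, C * B, hC g B hc hB⟩
  have hbc : BC g := ⟨hc, B, hB⟩
  have h1 : ∀ c, KK ε (fun _ : (EuclideanSpace ℝ (Fin N)) => c) x = c * (kap N * ε ^ 2 / 4) := by
    intro c
    have e : (fun _ : (EuclideanSpace ℝ (Fin N)) => c) = fun y => c * (fun _ => (1:ℝ)) y := by funext; simp
    rw [e, KK_const_mul, KK_one hε]
  rw [abs_le]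
  constructor
  · have := KK_mono hε (BC.const (-B)) hbc (fun y => (abs_le.1 (hB y)).1) x
    rw [h1] at this
    linarith
  · have := KK_mono hε hbc (BC.const B) (fun y => (abs_le.1 (hB y)).2) x
    rw [h1] at this
    linarith

lemma SS_bl (hε : 0 < ε) (hg : BC g) : BL (SS ε g) := by
  obtain ⟨hc, B, hB⟩ := hg
  obtain ⟨C, -, hC⟩ := SS_lip N hε
  refine ⟨⟨B, fun x => ?_⟩, C * B, hC g B hc hB⟩
  have := EE_bound (Λ := 0) hε le_rfl (by simp) hc hB x
  simpa [EE] using this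

lemma EE_bl {Λ : ℝ} (hε : 0 < ε) (hg : BC g) : BL (EE ε Λ g) :=
  (SS_bl hε hg).sub ((BL.const Λ).mul (KK_bl hε hg))

end ops2

section exist
variable {N : ℕ}

lemma EE_fix_zero {ε Λ : ℝ} (hε : 0 < ε) (hΛ : 0 < Λ) (hεΛ : ε ^ 2 * Λ ≤ 2) {z : (EuclideanSpace ℝ (Fin N)) → ℝ}
    (hz : BC z) (hfix : ∀ x, z x = EE ε Λ z x) (x : (EuclideanSpace ℝ (Fin N))) : z x = 0 := by
  obtain ⟨hc, B, hB⟩ := hz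
  set θ := 1 - Λ * (kap N * ε ^ 2 / 4) with hθ
  have hθ1 : θ < 1 := by
    have := kap_pos (N := N)
    have : 0 < Λ * (kap N * ε ^ 2 / 4) := by positivity
    linarith
  have hθ0 : 0 ≤ θ := by
    have := EE_nonneg (N := N) hε hΛ.le hεΛ (BC.const 1) (fun _ => zero_le_one) 0
    rw [EE_const hε] at this
    linarith
  have key : ∀ n : ℕ, ∀ x, |z x| ≤ θ ^ n * B := by
    intro n
    induction n with
    | zero => simpa using hB
    | succ n ih =>
      intro x
      rw [hfix x]
      refine (EE_bound hε hΛ.le hεΛ hc ih x).trans (le_of_eq ?_)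
      rw [← hθ]; ring
  have ht : Filter.Tendsto (fun n : ℕ => θ ^ n * B) Filter.atTop (nhds (0 * B)) :=
    (tendsto_pow_atTop_nhds_zero_of_lt_one hθ0 hθ1).mul_const B
  have h0 := ge_of_tendsto' ht (fun n => key n x)
  rw [zero_mul] at h0
  exact abs_nonpos_iff.1 h0

lemma EE_solve {ε Λ : ℝ} (hε : 0 < ε) (hΛ : 0 < Λ) (hεΛ : ε ^ 2 * Λ ≤ 2) {h : (EuclideanSpace ℝ (Fin N)) → ℝ}
    (hh : BL h) : ∃ g, BL g ∧ ∀ x, g x = h x + EE ε Λ g x := by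
  set θ := 1 - Λ * (kap N * ε ^ 2 / 4) with hθ
  have hθ1 : θ < 1 := by
    have := kap_pos (N := N)
    have : 0 < Λ * (kap N * ε ^ 2 / 4) := by positivity
    linarith
  have hθ0 : 0 ≤ θ := by
    have := EE_nonneg (N := N) hε hΛ.le hεΛ (BC.const 1) (fun _ => zero_le_one) 0
    rw [EE_const hε] at this
    linarith
  have hbcf : ∀ g : (EuclideanSpace ℝ (Fin N)) →ᵇ ℝ, BC g := fun g => ⟨g.continuous, ‖g‖, fun x => g.norm_coe_le_norm x⟩
  have hT : ∀ g : (EuclideanSpace ℝ (Fin N)) →ᵇ ℝ, ∃ f : (EuclideanSpace ℝ (Fin N)) →ᵇ ℝ, ∀ x, f x = h x + EE ε Λ g x := by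
    intro g
    obtain ⟨c, B, hB⟩ := hh.bc.add (EE_bl (Λ := Λ) hε (hbcf g)).bc
    exact ⟨BoundedContinuousFunction.ofNormedAddCommGroup _ c B hB, fun x => rfl⟩
  choose T hT using hT
  have hcontr : ContractingWith ⟨θ, hθ0⟩ T := by
    refine ⟨by exact_mod_cast hθ1, LipschitzWith.of_dist_le_mul fun g g' => ?_⟩
    rw [BoundedContinuousFunction.dist_le (by positivity)]
    intro x
    rw [hT, hT, Real.dist_eq, add_sub_add_left_eq_sub, ← EE_sub (hbcf g) (hbcf g')]
    refine EE_bound hε hΛ.le hεΛ (g.continuous.sub g'.continuous) (fun y => ?_) x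
    rw [Pi.sub_apply, ← Real.dist_eq]
    exact BoundedContinuousFunction.dist_coe_le_dist y
  have hfp := hcontr.fixedPoint_isFixedPt
  set g := ContractingWith.fixedPoint T hcontr
  have e : ∀ x, g x = h x + EE ε Λ g x := by
    intro x
    have : T g = g := hfp
    calc g x = T g x := by rw [this]
      _ = _ := hT g x
  refine ⟨g, ?_, e⟩
  have := hh.add (EE_bl (Λ := Λ) hε (hbcf g))
  have e' : (g : (EuclideanSpace ℝ (Fin N)) → ℝ) = fun x => h x + EE ε Λ g x := funext e
  rw [e']; exact this

/-- Solutions of the integral equation are classical solutions. -/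
lemma classical_of_integral {ε Λ : ℝ} (hε : 0 < ε) (hΛ : 0 < Λ) (hεΛ : ε ^ 2 * Λ ≤ 2)
    {u h : (EuclideanSpace ℝ (Fin N)) → ℝ} (hu : BL u) (hh : BL h) (he : ∀ x, u x = SS ε u x + KK ε h x) :
    ContDiff ℝ 2 u ∧ ∀ x, -lap u x = h x := by
  obtain ⟨g, hg, hge⟩ := EE_solve hε hΛ hεΛ (hh.add ((BL.const Λ).mul hu))
  obtain ⟨hy2, hyl⟩ := KK_C2 hε hg
  have hyb := KK_bl hε hg.bc
  have hl : ∀ x, -lap (KK ε g) x = h x + Λ * u x - Λ * KK ε g x := by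
    intro x
    rw [hyl, hge x]; unfold EE; ring
  have hlb : BC (lap (KK ε g)) := by
    have : lap (KK ε g) = fun x => -(h x + Λ * u x - Λ * KK ε g x) := by
      funext x; rw [← hl, neg_neg]
    rw [this]
    exact ((hh.add ((BL.const Λ).mul hu)).sub ((BL.const Λ).mul hyb)).neg.bc
  have hr : ∀ x, KK ε g x = EE ε Λ (KK ε g) x + KK ε (fun x => h x + Λ * u x) x := by
    intro x
    conv_lhs => rw [KS_repr hε hy2 hyb.bc hlb x]
    rw [funext hl, KK_sub (hh.add ((BL.const Λ).mul hu)).bc ((BL.const Λ).mul hyb).bc, KK_const_mul]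
    unfold EE; ring
  have hz := EE_fix_zero hε hΛ hεΛ (hu.bc.sub hyb.bc) (by
    intro x
    rw [EE_sub hu.bc hyb.bc]
    have h1 := hr x
    have h2 := he x
    rw [KK_add hh.bc ((BL.const Λ).mul hu).bc, KK_const_mul] at h1
    have h3 : EE ε Λ u x = SS ε u x - Λ * KK ε u x := rfl
    linarith)
  have hu' : u = KK ε g := funext fun x => by linarith [hz x]
  refine ⟨by rw [hu']; exact hy2, fun x => ?_⟩
  have := hl x
  rw [← hu'] at this
  linarith

theorem exists_sol_between (F : (EuclideanSpace ℝ (Fin N)) → ℝ → ℝ) {v V : (EuclideanSpace ℝ (Fin N)) → ℝ} (hv2 : ContDiff ℝ 2 v) (hvb : BL v)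
    (hvl : BC (lap v)) (hV2 : ContDiff ℝ 2 V) (hVb : BL V) (hVl : BC (lap V))
    (hvV : ∀ x, v x ≤ V x) (hsup : ∀ x, F x (V x) ≤ -lap V x) (hsub : ∀ x, -lap v x ≤ F x (v x))
    {Λ : ℝ} (hΛ : 0 < Λ)
    (hmono : ∀ x t t', v x ≤ t → t ≤ t' → t' ≤ V x → F x t + Λ * t ≤ F x t' + Λ * t')
    (hcont : ∀ x, ContinuousOn (F x) (Icc (v x) (V x)))
    {BF : ℝ} (hFb : ∀ x t, v x ≤ t → t ≤ V x → |F x t| ≤ BF)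
    (hBL : ∀ u, BL u → (∀ x, v x ≤ u x ∧ u x ≤ V x) → BL (fun x => F x (u x))) :
    ∃ u, ContDiff ℝ 2 u ∧ (∀ x, v x ≤ u x ∧ u x ≤ V x) ∧ ∀ x, -lap u x = F x (u x) := by
  obtain ⟨ε, hε, hεΛ⟩ : ∃ ε : ℝ, 0 < ε ∧ ε ^ 2 * Λ ≤ 2 := by
    refine ⟨min 1 Λ⁻¹, by positivity, ?_⟩
    have h1 : min 1 Λ⁻¹ ≤ 1 := min_le_left _ _
    have h2 : min 1 Λ⁻¹ ≤ Λ⁻¹ := min_le_right _ _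
    have h0 : 0 < min 1 Λ⁻¹ := by positivity
    have h3 : min 1 Λ⁻¹ * Λ ≤ 1 := by
      calc min 1 Λ⁻¹ * Λ ≤ Λ⁻¹ * Λ := by gcongr
        _ = 1 := inv_mul_cancel₀ hΛ.ne'
    nlinarith [mul_nonneg h0.le hΛ.le]
  -- admissible functions
  let Adm : ((EuclideanSpace ℝ (Fin N)) → ℝ) → Prop := fun u => BL u ∧ ∀ x, v x ≤ u x ∧ u x ≤ V x
  have hAf : ∀ u, Adm u → BL (fun x => F x (u x)) := fun u hu => hBL u hu.1 hu.2
  let Φ : ((EuclideanSpace ℝ (Fin N)) → ℝ) → (EuclideanSpace ℝ (Fin N)) → ℝ := fun u x => SS ε u x + KK ε (fun y => F y (u y)) x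
  have hΦE : ∀ u, Adm u → ∀ x, Φ u x = EE ε Λ u x + KK ε (fun y => F y (u y) + Λ * u y) x := by
    intro u hu x
    rw [KK_add (hAf u hu).bc ((BL.const Λ).mul hu.1).bc, KK_const_mul]
    simp only [Φ, EE]; ring
  have hΦm : ∀ a b, Adm a → Adm b → (∀ x, a x ≤ b x) → ∀ x, Φ a x ≤ Φ b x := by
    intro a b ha hb hab x
    rw [hΦE a ha, hΦE b hb]
    refine add_le_add (EE_mono hε hΛ.le hεΛ ha.1.bc hb.1.bc hab x) ?_
    refine KK_mono hε ((hAf a ha).add ((BL.const Λ).mul ha.1)).bc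
      ((hAf b hb).add ((BL.const Λ).mul hb.1)).bc (fun y => ?_) x
    exact hmono y _ _ (ha.2 y).1 (hab y) (hb.2 y).2
  have hAV : Adm V := ⟨hVb, fun x => ⟨hvV x, le_rfl⟩⟩
  have hAv : Adm v := ⟨hvb, fun x => ⟨le_rfl, hvV x⟩⟩
  have hΦV : ∀ x, Φ V x ≤ V x := by
    intro x
    conv_rhs => rw [KS_repr hε hV2 hVb.bc hVl x]
    exact add_le_add le_rfl (KK_mono hε (hAf V hAV).bc hVl.neg hsup x)
  have hΦv : ∀ x, v x ≤ Φ v x := by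
    intro x
    conv_lhs => rw [KS_repr hε hv2 hvb.bc hvl x]
    exact add_le_add le_rfl (KK_mono hε hvl.neg (hAf v hAv).bc hsub x)
  let u : ℕ → (EuclideanSpace ℝ (Fin N)) → ℝ := fun n => Φ^[n] V
  have hus : ∀ n, u (n+1) = Φ (u n) := fun n => Function.iterate_succ_apply' Φ n V
  have hinv : ∀ n, Adm (u n) ∧ ∀ x, u (n+1) x ≤ u n x := by
    intro n
    induction n with
    | zero => exact ⟨hAV, hΦV⟩
    | succ n ih =>
      have hA : Adm (u (n+1)) := by
        refine ⟨?_, fun x => ⟨?_, (ih.2 x).trans (ih.1.2 x).2⟩⟩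
        · rw [hus]
          exact (SS_bl hε ih.1.1.bc).add (KK_bl hε (hAf _ ih.1).bc)
        · rw [hus]
          exact (hΦv x).trans (hΦm v _ hAv ih.1 (fun y => (ih.1.2 y).1) x)
      refine ⟨hA, fun x => ?_⟩
      rw [hus (n+1)]
      conv_rhs => rw [hus n]
      exact hΦm _ _ hA ih.1 ih.2 x
  have hanti : ∀ x, Antitone (fun n => u n x) := fun x => antitone_nat_of_succ_le fun n => (hinv n).2 x
  let U : (EuclideanSpace ℝ (Fin N)) → ℝ := fun x => ⨅ n, u n x
  have hlim : ∀ x, Filter.Tendsto (fun n => u n x) Filter.atTop (nhds (U x)) := fun x =>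
    tendsto_atTop_ciInf (hanti x) ⟨v x, by rintro _ ⟨n, rfl⟩; exact ((hinv n).1.2 x).1⟩
  have hU : ∀ x, v x ≤ U x ∧ U x ≤ V x := fun x =>
    ⟨ge_of_tendsto' (hlim x) fun n => ((hinv n).1.2 x).1,
      le_of_tendsto' (hlim x) fun n => ((hinv n).1.2 x).2⟩
  obtain ⟨Bv, hBv⟩ := hvb.1
  obtain ⟨BV, hBV⟩ := hVb.1
  have hbd : ∀ t x, v x ≤ t → t ≤ V x → |t| ≤ max Bv BV := by
    intro t x h1 h2
    have a1 := (abs_le.1 (hBv x)).1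
    have a2 := (abs_le.1 (hBV x)).2
    rw [abs_le]
    constructor
    · linarith [le_max_left Bv BV]
    · linarith [le_max_right Bv BV]
  obtain ⟨C1, -, hC1⟩ := SS_lip N hε
  obtain ⟨C2, -, hC2⟩ := KK_lip N hε
  have hUL : ∀ x y, |U x - U y| ≤ (C1 * max Bv BV + C2 * BF) * ‖x - y‖ := by
    intro x y
    have ht := (((hlim x).sub (hlim y)).abs).comp (Filter.tendsto_add_atTop_nat 1)
    refine le_of_tendsto' ht fun n => ?_
    simp only [Function.comp, hus]
    have a1 := hC1 (u n) _ (hinv n).1.1.bc.1 (fun x => hbd _ x ((hinv n).1.2 x).1 ((hinv n).1.2 x).2) x y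
    have a2 := hC2 (fun x => F x (u n x)) BF (hAf _ (hinv n).1).bc.1
      (fun x => hFb x _ ((hinv n).1.2 x).1 ((hinv n).1.2 x).2) x y
    have e : Φ (u n) x - Φ (u n) y = (SS ε (u n) x - SS ε (u n) y) +
      (KK ε (fun x => F x (u n x)) x - KK ε (fun x => F x (u n x)) y) := by simp only [Φ]; ring
    rw [e, add_mul]
    exact (abs_add_le _ _).trans (add_le_add a1 a2)
  have hUb : BL U := ⟨⟨max Bv BV, fun x => hbd _ x (hU x).1 (hU x).2⟩, _, hUL⟩
  have hUA : Adm U := ⟨hUb, hU⟩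
  have hUe : ∀ x, U x = SS ε U x + KK ε (fun y => F y (U y)) x := by
    intro x
    refine tendsto_nhds_unique ((hlim x).comp (Filter.tendsto_add_atTop_nat 1)) ?_
    have e : ((fun n => u n x) ∘ fun n => n + 1) = fun n => SS ε (u n) x + KK ε (fun y => F y (u n y)) x := by
      funext n; simp only [Function.comp, hus]; rfl
    rw [e]
    refine Filter.Tendsto.add ?_ ?_
    · exact TT_tendsto (wSc ε) kEc kEta_compact (fun n => (hinv n).1.1.bc.1)
        (fun n x => hbd _ x ((hinv n).1.2 x).1 ((hinv n).1.2 x).2) hlim x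
    · refine TT_tendsto (wKc ε) kPc kPsi_compact (fun n => (hAf _ (hinv n).1).bc.1)
        (fun n x => hFb x _ ((hinv n).1.2 x).1 ((hinv n).1.2 x).2) (fun y => ?_) x
      have h1 : Filter.Tendsto (fun n => u n y) Filter.atTop (nhdsWithin (U y) (Icc (v y) (V y))) :=
        tendsto_nhdsWithin_iff.2 ⟨hlim y, Filter.Eventually.of_forall fun n => (hinv n).1.2 y⟩
      exact (hcont y (U y) (hU y)).tendsto.comp h1
  obtain ⟨c2, hl⟩ := classical_of_integral hε hΛ hεΛ hUb (hAf U hUA) hUe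
  exact ⟨U, c2, hU, hl⟩

end exist

section limit
variable {N : ℕ}

lemma BL.cutmul {χ g : (EuclideanSpace ℝ (Fin N)) → ℝ} {S : Set (EuclideanSpace ℝ (Fin N))} (hχ : BL χ) (h0 : ∀ x ∉ S, χ x = 0) {B L : ℝ}
    (hB : ∀ x ∈ S, |g x| ≤ B) (hL : ∀ x ∈ S, ∀ y ∈ S, |g x - g y| ≤ L * ‖x - y‖) :
    BL (fun x => χ x * g x) := by
  obtain ⟨⟨B1, h1⟩, L1, k1⟩ := hχ
  have hB1 : 0 ≤ B1 := (abs_nonneg _).trans (h1 0)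
  refine ⟨⟨B1 * |B|, fun x => ?_⟩, B1 * |L| + |L1| * |B|, fun x y => ?_⟩
  · show |χ x * g x| ≤ _
    by_cases hx : x ∈ S
    · rw [abs_mul]
      exact mul_le_mul (h1 x) ((hB x hx).trans (le_abs_self B)) (abs_nonneg _) hB1
    · rw [h0 x hx]; simp; positivity
  · have hk : ∀ x y, |χ x - χ y| ≤ |L1| * ‖x - y‖ := fun x y =>
      (k1 x y).trans (mul_le_mul_of_nonneg_right (le_abs_self _) (norm_nonneg _))
    have key : ∀ x y, x ∈ S → y ∉ S → |χ x * g x| ≤ (B1 * |L| + |L1| * |B|) * ‖x - y‖ := by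
      intro x y hx hy
      have e : χ x * g x = (χ x - χ y) * g x := by rw [h0 y hy]; ring
      rw [e, abs_mul]
      have a := mul_le_mul (hk x y) ((hB x hx).trans (le_abs_self B)) (abs_nonneg _) (by positivity)
      have : 0 ≤ B1 * |L| * ‖x - y‖ := by positivity
      linarith
    show |χ x * g x - χ y * g y| ≤ _
    by_cases hx : x ∈ S <;> by_cases hy : y ∈ S
    · have e : χ x * g x - χ y * g y = χ x * (g x - g y) + (χ x - χ y) * g y := by ring
      rw [e]
      refine (abs_add_le _ _).trans ?_
      rw [abs_mul, abs_mul]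
      have hL' : |g x - g y| ≤ |L| * ‖x - y‖ :=
        (hL x hx y hy).trans (mul_le_mul_of_nonneg_right (le_abs_self _) (norm_nonneg _))
      have a := mul_le_mul (h1 x) hL' (abs_nonneg _) hB1
      have b := mul_le_mul (hk x y) ((hB y hy).trans (le_abs_self B)) (abs_nonneg _) (by positivity)
      linarith
    · rw [h0 y hy]; simpa using key x y hx hy
    · rw [h0 x hx]
      have := key y x hy hx
      rw [norm_sub_rev] at this
      simpa using this
    · rw [h0 x hx, h0 y hy]; simp; positivity

lemma KK_zero_aux {q : (EuclideanSpace ℝ (Fin N)) → ℝ} (hq : BC q) {x0 : (EuclideanSpace ℝ (Fin N))} {r0 : ℝ} (hr0 : 0 < r0)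
    (h : ∀ ε, 0 < ε → ε ≤ r0 → KK ε q x0 = 0) : q x0 ≤ 0 := by
  by_contra hpos
  push Not at hpos
  have hev : ∀ᶠ y in nhds x0, q x0 / 2 < q y :=
    hq.1.continuousAt.eventually (lt_mem_nhds (half_lt_self hpos))
  obtain ⟨r, hr, hball⟩ := Metric.eventually_nhds_iff_ball.1 hev
  set ε := min r r0
  have hε : 0 < ε := lt_min hr hr0
  have h1 := h ε hε (min_le_right _ _)
  have h2 := KK_nonneg (x := x0) hε (g := fun y => q y - q x0 / 2) (fun y hy => by
    have := hball y (ball_subset_ball (min_le_left _ _) hy)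
    linarith)
  rw [KK_sub hq (BC.const _), h1] at h2
  have e : (fun _ : (EuclideanSpace ℝ (Fin N)) => q x0 / 2) = fun y => (q x0 / 2) * (fun _ => (1:ℝ)) y := by funext; simp
  rw [e, KK_const_mul, KK_one hε] at h2
  have := kap_pos (N := N)
  have : 0 < q x0 / 2 * (kap N * ε ^ 2 / 4) := by positivity
  linarith

lemma KK_zero {q : (EuclideanSpace ℝ (Fin N)) → ℝ} (hq : BC q) {x0 : (EuclideanSpace ℝ (Fin N))} {r0 : ℝ} (hr0 : 0 < r0)
    (h : ∀ ε, 0 < ε → ε ≤ r0 → KK ε q x0 = 0) : q x0 = 0 := by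
  refine le_antisymm (KK_zero_aux hq hr0 h) ?_
  have := KK_zero_aux hq.neg hr0 (x0 := x0) (fun ε h1 h2 => by rw [KK_neg, h ε h1 h2, neg_zero])
  linarith

lemma BL_of_C1_compact {χ : (EuclideanSpace ℝ (Fin N)) → ℝ} (h : ContDiff ℝ 1 χ) (hc : HasCompactSupport χ) : BL χ := by
  obtain ⟨B, hB⟩ := hc.exists_bound_of_continuous h.continuous
  obtain ⟨C, hC⟩ := h.lipschitzWith_of_hasCompactSupport hc one_ne_zero
  refine ⟨⟨B, hB⟩, C, fun x y => ?_⟩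
  have := hC.dist_le_mul x y
  rwa [Real.dist_eq, dist_eq_norm] at this

lemma exists_bump (x0 : (EuclideanSpace ℝ (Fin N))) {a b : ℝ} (ha : 0 < a) (hab : a < b) : ∃ χ : (EuclideanSpace ℝ (Fin N)) → ℝ, ContDiff ℝ 2 χ ∧
    HasCompactSupport χ ∧ (∀ x, 0 ≤ χ x ∧ χ x ≤ 1) ∧ (∀ x ∈ closedBall x0 a, χ x = 1) ∧
    (∀ x ∉ ball x0 b, χ x = 0) ∧ BL χ := by
  let f : ContDiffBump x0 := ⟨a, b, ha, hab⟩
  have h2 : ContDiff ℝ 2 f := f.contDiff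
  refine ⟨f, h2, f.hasCompactSupport, fun x => ⟨f.nonneg, f.le_one⟩, fun x hx => f.one_of_mem_closedBall hx,
    fun x hx => ?_, BL_of_C1_compact (h2.of_le (by norm_num)) f.hasCompactSupport⟩
  have : x ∉ Function.support f := by rw [f.support_eq]; exact hx
  simpa using this

/-- Local Lipschitz hypothesis on the nonlinearity. -/
def LocLip {N : ℕ} (Ω : Set (EuclideanSpace ℝ (Fin N))) (f : EuclideanSpace ℝ (Fin N) → ℝ → ℝ) : Prop :=
  ∀ K ⊆ Ω, IsCompact K → ∀ a b : ℝ, 0 < a → ∃ L B, 0 ≤ L ∧ ∀ x ∈ K, ∀ y ∈ K, ∀ t ∈ Icc a b, ∀ t' ∈ Icc a b,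
    |f x t - f y t'| ≤ L * (‖x - y‖ + |t - t'|) ∧ |f x t| ≤ B

lemma compact_bounds {K : Set (EuclideanSpace ℝ (Fin N))} (hK : IsCompact K) {v V : (EuclideanSpace ℝ (Fin N)) → ℝ} (hv : ContinuousOn v K)
    (hV : ContinuousOn V K) (hpos : ∀ x ∈ K, 0 < v x) :
    ∃ a b : ℝ, 0 < a ∧ ∀ x ∈ K, a ≤ v x ∧ V x ≤ b := by
  rcases K.eq_empty_or_nonempty with rfl | hne
  · exact ⟨1, 1, one_pos, by simp⟩
  obtain ⟨x1, h1, m1⟩ := hK.exists_isMinOn hne hv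
  obtain ⟨x2, h2, m2⟩ := hK.exists_isMaxOn hne hV
  exact ⟨v x1, V x2, hpos x1 h1, fun x hx => ⟨m1 hx, m2 hx⟩⟩

variable {Ω : Set (EuclideanSpace ℝ (Fin N))} {f : (EuclideanSpace ℝ (Fin N)) → ℝ → ℝ} {v V : (EuclideanSpace ℝ (Fin N)) → ℝ} {u : ℕ → (EuclideanSpace ℝ (Fin N)) → ℝ}

/-- Setup for sequences of approximate solutions. -/
structure ApproxSeq (Ω : Set (EuclideanSpace ℝ (Fin N))) (f : (EuclideanSpace ℝ (Fin N)) → ℝ → ℝ) (v V : (EuclideanSpace ℝ (Fin N)) → ℝ) (u : ℕ → (EuclideanSpace ℝ (Fin N)) → ℝ) : Prop where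
  op : IsOpen Ω
  hf : LocLip Ω f
  hv : ContinuousOn v Ω
  hV : ContinuousOn V Ω
  pos : ∀ x ∈ Ω, 0 < v x
  c2 : ∀ n, ContDiff ℝ 2 (u n)
  bc : ∀ n, BC (u n)
  bcl : ∀ n, BC (lap (u n))
  sol : ∀ K ⊆ Ω, IsCompact K → ∀ᶠ n in Filter.atTop, ∀ x ∈ K,
    v x ≤ u n x ∧ u n x ≤ V x ∧ -lap (u n) x = f x (u n x)

/-- Local representation formula with cutoff. -/
lemma cut_repr {w : (EuclideanSpace ℝ (Fin N)) → ℝ} (h2 : ContDiff ℝ 2 w) (hb : BC w) (hl : BC (lap w)) {χ : (EuclideanSpace ℝ (Fin N)) → ℝ}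
    {x0 y : (EuclideanSpace ℝ (Fin N))} {ε R : ℝ} (hε : 0 < ε) (hχ : ∀ x ∈ closedBall x0 R, χ x = 1)
    (hy : dist y x0 + ε ≤ R) :
    w y = SS ε (fun z => χ z * w z) y + KK ε (fun z => χ z * (-lap w z)) y := by
  have hsub : ∀ z ∈ ball y ε, χ z = 1 := by
    intro z hz
    apply hχ
    rw [mem_closedBall]
    rw [mem_ball] at hz
    linarith [dist_triangle z y x0]
  rw [SS_local hε (g := fun z => χ z * w z) (h := w) (fun z hz => by simp [hsub z hz]),
    KK_local hε (g := fun z => χ z * (-lap w z)) (h := fun z => -lap w z) (fun z hz => by simp [hsub z hz])]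
  exact KS_repr hε h2 hb hl y

lemma equi_lip (H : ApproxSeq Ω f v V u) {x0 : (EuclideanSpace ℝ (Fin N))} {r : ℝ} (hr : 0 < r)
    (hsub : closedBall x0 (7 * r) ⊆ Ω) :
    ∃ L, 0 ≤ L ∧ ∀ᶠ n in Filter.atTop, ∀ x ∈ closedBall x0 (5 * r), ∀ y ∈ closedBall x0 (5 * r),
      |u n x - u n y| ≤ L * ‖x - y‖ := by
  have hK := isCompact_closedBall x0 (7 * r)
  obtain ⟨a, b, ha, hab⟩ := compact_bounds hK (H.hv.mono hsub) (H.hV.mono hsub) (fun x hx => H.pos x (hsub hx))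
  obtain ⟨L, B, hL0, hLB⟩ := H.hf _ hsub hK a b ha
  obtain ⟨χ, hχ2, -, hχ01, hχ1, hχ0, hχb⟩ := exists_bump x0 (a := 6 * r) (b := 7 * r) (by positivity) (by linarith)
  obtain ⟨C1, hC10, hC1⟩ := SS_lip N hr
  obtain ⟨C2, hC20, hC2⟩ := KK_lip N hr
  refine ⟨C1 * |b| + C2 * |B|, by positivity, ?_⟩
  filter_upwards [H.sol _ hsub hK] with n hn x hx y hy
  rw [mem_closedBall] at hx hy
  have bd : ∀ (w : (EuclideanSpace ℝ (Fin N)) → ℝ) (M : ℝ), 0 ≤ M → (∀ x ∈ closedBall x0 (7 * r), |w x| ≤ M) → ∀ x, |χ x * w x| ≤ M := by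
    intro w M hM hw x
    by_cases hx : x ∈ ball x0 (7 * r)
    · rw [abs_mul, abs_of_nonneg (hχ01 x).1]
      have := hw x (ball_subset_closedBall hx)
      calc χ x * |w x| ≤ 1 * M := mul_le_mul (hχ01 x).2 this (abs_nonneg _) zero_le_one
        _ = M := one_mul M
    · rw [hχ0 x hx]; simpa using hM
  have b1 := bd (u n) |b| (abs_nonneg _) (fun x hx => by
    have h1 := hn x hx
    have h2 := hab x hx
    rw [abs_of_pos (by linarith)]
    exact (by linarith : u n x ≤ b).trans (le_abs_self b))
  have b2 := bd (fun z => -lap (u n) z) |B| (abs_nonneg _) (fun x hx => by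
    have h1 := hn x hx
    have h2 := hab x hx
    rw [h1.2.2]
    have ht : u n x ∈ Icc a b := ⟨by linarith, by linarith⟩
    exact ((hLB x hx x hx _ ht _ ht).2).trans (le_abs_self B))
  have c1 : Continuous (fun z => χ z * u n z) := hχ2.continuous.mul (H.bc n).1
  have c2 : Continuous (fun z => χ z * (-lap (u n) z)) := hχ2.continuous.mul (H.bcl n).1.neg
  rw [cut_repr (H.c2 n) (H.bc n) (H.bcl n) hr hχ1 (y := x) (by linarith),
    cut_repr (H.c2 n) (H.bc n) (H.bcl n) hr hχ1 (y := y) (by linarith)]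
  have a1 := hC1 _ _ c1 b1 x y
  have a2 := hC2 _ _ c2 b2 x y
  rw [add_sub_add_comm, add_mul]
  exact (abs_add_le _ _).trans (add_le_add a1 a2)

lemma exists_radius (hΩ : IsOpen Ω) {x0 : (EuclideanSpace ℝ (Fin N))} (hx : x0 ∈ Ω) : ∃ r, 0 < r ∧ closedBall x0 (7 * r) ⊆ Ω := by
  obtain ⟨ρ, hρ, h⟩ := Metric.nhds_basis_closedBall.mem_iff.1 (hΩ.mem_nhds hx)
  exact ⟨ρ / 7, by positivity, by rwa [mul_div_cancel₀ _ (by norm_num : (7:ℝ) ≠ 0)]⟩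

lemma exists_subseq (H : ApproxSeq Ω f v V u) : ∃ φ : ℕ → ℕ, StrictMono φ ∧ ∀ x ∈ Ω,
    ∃ l, Filter.Tendsto (fun n => u (φ n) x) Filter.atTop (nhds l) := by
  classical
  let D := TopologicalSpace.denseSeq (EuclideanSpace ℝ (Fin N))
  let lo : ℕ → ℝ := fun i => if D i ∈ Ω then min (v (D i)) (V (D i)) else 0
  let hi : ℕ → ℝ := fun i => if D i ∈ Ω then max (v (D i)) (V (D i)) else 0
  let A : ℕ → ℕ → ℝ := fun n i => max (lo i) (min (hi i) (u n (D i)))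
  have hlohi : ∀ i, lo i ≤ hi i := by
    intro i
    simp only [lo, hi]
    split_ifs
    · exact min_le_max
    · exact le_rfl
  have hcomp : IsCompact (Set.pi univ fun i => Icc (lo i) (hi i)) := isCompact_univ_pi fun i => isCompact_Icc
  obtain ⟨l, -, φ, hφ, hlim⟩ := hcomp.tendsto_subseq (x := A) (by
    intro n i _
    exact ⟨le_max_left _ _, max_le (hlohi i) (min_le_left _ _)⟩)
  refine ⟨φ, hφ, fun x hx => ?_⟩
  have hD : ∀ i, D i ∈ Ω → Filter.Tendsto (fun n => u (φ n) (D i)) Filter.atTop (nhds (l i)) := by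
    intro i hi'
    have h1 := (tendsto_pi_nhds.1 hlim i)
    refine h1.congr' ?_
    have := H.sol {D i} (by simpa using hi') isCompact_singleton
    filter_upwards [hφ.tendsto_atTop.eventually this] with n hn
    have h2 := hn (D i) rfl
    simp only [A, lo, hi, Function.comp, if_pos hi']
    rw [min_eq_right (h2.2.1.trans (le_max_right _ _)), max_eq_right ((min_le_left _ _).trans h2.1)]
  obtain ⟨r, hr, hsub⟩ := exists_radius H.op hx
  obtain ⟨L, hL0, hL⟩ := equi_lip H hr hsub
  refine cauchySeq_tendsto_of_complete (Metric.cauchySeq_iff'.2 fun e he => ?_)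
  obtain ⟨y, hy⟩ := (TopologicalSpace.denseRange_denseSeq (EuclideanSpace ℝ (Fin N))).exists_dist_lt x
    (ε := min (5 * r) (e / (4 * (L + 1)))) (by positivity)
  have hy1 : dist x (D y) < 5 * r := hy.trans_le (min_le_left _ _)
  have hy2 : dist x (D y) < e / (4 * (L + 1)) := hy.trans_le (min_le_right _ _)
  have hyB : D y ∈ closedBall x (5 * r) := by rw [mem_closedBall, dist_comm]; exact hy1.le
  have hxB : x ∈ closedBall x (5 * r) := mem_closedBall_self (by positivity)
  have hyΩ : D y ∈ Ω := hsub (closedBall_subset_closedBall (by linarith) hyB)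
  have hLe : L * ‖x - D y‖ ≤ e / 4 := by
    rw [← dist_eq_norm]
    rw [lt_div_iff₀ (by positivity)] at hy2
    nlinarith [dist_nonneg (x := x) (y := D y)]
  obtain ⟨n1, h1⟩ := Filter.eventually_atTop.1 (hφ.tendsto_atTop.eventually hL)
  obtain ⟨n2, h2⟩ := Metric.cauchySeq_iff.1 (hD y hyΩ).cauchySeq (e / 4) (by positivity)
  refine ⟨max n1 n2, fun n hn => ?_⟩
  have a1 := h1 n ((le_max_left _ _).trans hn) x hxB (D y) hyB
  have a2 := h1 (max n1 n2) (le_max_left _ _) x hxB (D y) hyB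
  have a3 := h2 n ((le_max_right _ _).trans hn) (max n1 n2) (le_max_right _ _)
  rw [Real.dist_eq] at a3 ⊢
  rw [abs_lt] at a3 ⊢
  have b1 := abs_le.1 (a1.trans hLe)
  have b2 := abs_le.1 (a2.trans hLe)
  constructor <;> linarith [b1.1, b1.2, b2.1, b2.2, a3.1, a3.2]

end limit

section limit2
variable {N : ℕ} {Ω : Set (EuclideanSpace ℝ (Fin N))} {f : (EuclideanSpace ℝ (Fin N)) → ℝ → ℝ} {v V U : (EuclideanSpace ℝ (Fin N)) → ℝ} {u : ℕ → (EuclideanSpace ℝ (Fin N)) → ℝ}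

lemma ApproxSeq.comp (H : ApproxSeq Ω f v V u) {φ : ℕ → ℕ} (hφ : Filter.Tendsto φ Filter.atTop Filter.atTop) :
    ApproxSeq Ω f v V (fun n => u (φ n)) where
  op := H.op
  hf := H.hf
  hv := H.hv
  hV := H.hV
  pos := H.pos
  c2 := fun n => H.c2 _
  bc := fun n => H.bc _
  bcl := fun n => H.bcl _
  sol := fun K hK hc => hφ.eventually (H.sol K hK hc)

lemma local_limit (H : ApproxSeq Ω f v V u)
    (hU : ∀ x ∈ Ω, Filter.Tendsto (fun n => u n x) Filter.atTop (nhds (U x)))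
    {x0 : (EuclideanSpace ℝ (Fin N))} {r : ℝ} (hr : 0 < r) (hsub : closedBall x0 (7 * r) ⊆ Ω) :
    ∃ χ : (EuclideanSpace ℝ (Fin N)) → ℝ, ContDiff ℝ 2 χ ∧ HasCompactSupport χ ∧ (∀ x ∈ closedBall x0 (3 * r), χ x = 1) ∧
      (∀ x ∉ ball x0 (4 * r), χ x = 0) ∧ BL (fun x => χ x * U x) ∧ BL (fun x => χ x * f x (U x)) ∧
      ∀ ε, 0 < ε → ε ≤ r → ∀ y ∈ closedBall x0 (2 * r),
        U y = SS ε (fun x => χ x * U x) y + KK ε (fun x => χ x * f x (U x)) y := by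
  have hK := isCompact_closedBall x0 (7 * r)
  have h57 : closedBall x0 (5 * r) ⊆ closedBall x0 (7 * r) := closedBall_subset_closedBall (by linarith)
  have h45 : ball x0 (4 * r) ⊆ closedBall x0 (5 * r) :=
    ball_subset_closedBall.trans (closedBall_subset_closedBall (by linarith))
  obtain ⟨a, b, ha, hab⟩ := compact_bounds hK (H.hv.mono hsub) (H.hV.mono hsub) (fun x hx => H.pos x (hsub hx))
  obtain ⟨L, B, hL0, hLB⟩ := H.hf _ hsub hK a b ha
  obtain ⟨χ, hχ2, hχc, hχ01, hχ1, hχ0, hχb⟩ := exists_bump x0 (a := 3 * r) (b := 4 * r) (by positivity) (by linarith)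
  obtain ⟨Lu, hLu0, hLu⟩ := equi_lip H hr hsub
  have hsol := H.sol _ hsub hK
  have hUab : ∀ x ∈ closedBall x0 (7 * r), U x ∈ Icc a b := by
    intro x hx
    refine isClosed_Icc.mem_of_tendsto (hU x (hsub hx)) ?_
    filter_upwards [hsol] with n hn
    have h1 := hn x hx
    have h2 := hab x hx
    exact ⟨by linarith, by linarith⟩
  have hULip : ∀ x ∈ closedBall x0 (5 * r), ∀ y ∈ closedBall x0 (5 * r), |U x - U y| ≤ Lu * ‖x - y‖ := by
    intro x hx y hy
    refine le_of_tendsto (((hU x (hsub (h57 hx))).sub (hU y (hsub (h57 hy)))).abs) ?_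
    filter_upwards [hLu] with n hn using hn x hx y hy
  have hχ5 : ∀ x ∉ closedBall x0 (5 * r), χ x = 0 := fun x hx => hχ0 x fun h => hx (h45 h)
  have bd : ∀ (w : (EuclideanSpace ℝ (Fin N)) → ℝ) (M : ℝ), 0 ≤ M → (∀ x ∈ closedBall x0 (7 * r), |w x| ≤ M) → ∀ x, |χ x * w x| ≤ M := by
    intro w M hM hw x
    by_cases hx : x ∈ ball x0 (4 * r)
    · rw [abs_mul, abs_of_nonneg (hχ01 x).1]
      have := hw x (h57 (h45 hx))
      calc χ x * |w x| ≤ 1 * M := mul_le_mul (hχ01 x).2 this (abs_nonneg _) zero_le_one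
        _ = M := one_mul M
    · rw [hχ0 x hx]; simpa using hM
  refine ⟨χ, hχ2, hχc, hχ1, hχ0, ?_, ?_, ?_⟩
  · refine BL.cutmul hχb hχ5 (B := b) (L := Lu) (fun x hx => ?_) hULip
    have := hUab x (h57 hx)
    rw [abs_of_pos (by linarith [this.1])]
    exact this.2
  · refine BL.cutmul hχb hχ5 (B := B) (L := L * (1 + Lu)) (fun x hx => ?_) (fun x hx y hy => ?_)
    · exact (hLB x (h57 hx) x (h57 hx) _ (hUab x (h57 hx)) _ (hUab x (h57 hx))).2
    · refine (hLB x (h57 hx) y (h57 hy) _ (hUab x (h57 hx)) _ (hUab y (h57 hy))).1.trans ?_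
      rw [mul_assoc]
      refine mul_le_mul_of_nonneg_left ?_ hL0
      linarith [hULip x hx y hy]
  · intro ε hε hεr y hy
    rw [mem_closedBall] at hy
    obtain ⟨n0, hn0⟩ := Filter.eventually_atTop.1 hsol
    have hyΩ : y ∈ Ω := hsub (by rw [mem_closedBall]; linarith)
    have hsh : Filter.Tendsto (fun n : ℕ => n + n0) Filter.atTop Filter.atTop := Filter.tendsto_add_atTop_nat n0
    have t1 := (hU y hyΩ).comp hsh
    have t2 : Filter.Tendsto (fun n => SS ε (fun z => χ z * u (n + n0) z) y) Filter.atTop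
        (nhds (SS ε (fun x => χ x * U x) y)) := by
      refine TT_tendsto (wSc ε) kEc kEta_compact (B := |b|) (fun n => hχ2.continuous.mul (H.bc _).1)
        (fun n => bd _ _ (abs_nonneg _) (fun x hx => ?_)) (fun x => ?_) y
      · have h1 := hn0 (n + n0) (by omega) x hx
        have h2 := hab x hx
        rw [abs_of_pos (by linarith)]
        exact (by linarith : u (n + n0) x ≤ b).trans (le_abs_self b)
      · by_cases hx : x ∈ ball x0 (4 * r)
        · exact ((hU x (hsub (h57 (h45 hx)))).comp hsh).const_mul _
        · simp [hχ0 x hx]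
    have t3 : Filter.Tendsto (fun n => KK ε (fun z => χ z * (-lap (u (n + n0)) z)) y) Filter.atTop
        (nhds (KK ε (fun x => χ x * f x (U x)) y)) := by
      refine TT_tendsto (wKc ε) kPc kPsi_compact (B := |B|) (fun n => hχ2.continuous.mul (H.bcl _).1.neg)
        (fun n => bd (fun z => -lap (u (n + n0)) z) _ (abs_nonneg _) (fun x hx => ?_)) (fun x => ?_) y
      · have h1 := hn0 (n + n0) (by omega) x hx
        have h2 := hab x hx
        rw [h1.2.2]
        have ht : u (n + n0) x ∈ Icc a b := ⟨by linarith, by linarith⟩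
        exact ((hLB x hx x hx _ ht _ ht).2).trans (le_abs_self B)
      · by_cases hx : x ∈ ball x0 (4 * r)
        · have hx7 := h57 (h45 hx)
          refine Filter.Tendsto.const_mul _ ?_
          have e : ∀ n, -lap (u (n + n0)) x = f x (u (n + n0) x) := fun n => (hn0 (n + n0) (by omega) x hx7).2.2
          refine Filter.Tendsto.congr (fun n => (e n).symm) ?_
          have ht : ∀ n, u (n + n0) x ∈ Icc a b := fun n => by
            have h1 := hn0 (n + n0) (by omega) x hx7
            have h2 := hab x hx7
            exact ⟨by linarith, by linarith⟩
          rw [tendsto_iff_dist_tendsto_zero]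
          have lim0 : Filter.Tendsto (fun n => L * |u (n + n0) x - U x|) Filter.atTop (nhds 0) := by
            have := (((hU x (hsub hx7)).comp hsh).sub_const (U x)).abs.const_mul L
            simpa using this
          refine squeeze_zero (fun _ => dist_nonneg) (fun n => ?_) lim0
          rw [Real.dist_eq]
          have := (hLB x hx7 x hx7 _ (ht n) _ (hUab x hx7)).1
          simpa using this
        · simp [hχ0 x hx]
    refine tendsto_nhds_unique t1 ((t2.add t3).congr fun n => ?_)
    exact (cut_repr (H.c2 _) (H.bc _) (H.bcl _) hε hχ1 (by linarith)).symm

lemma limit_sol (H : ApproxSeq Ω f v V u) : ∃ U : (EuclideanSpace ℝ (Fin N)) → ℝ, ContDiffOn ℝ 2 U Ω ∧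
    ∀ x ∈ Ω, v x ≤ U x ∧ U x ≤ V x ∧ -lap U x = f x (U x) := by
  classical
  obtain ⟨φ, hφ, hlim⟩ := exists_subseq H
  have H' := H.comp hφ.tendsto_atTop
  choose! U hU using hlim
  have hC : ∀ x ∈ Ω, ContDiffAt ℝ 2 U x := by
    intro x0 hx0
    obtain ⟨r, hr, hsub⟩ := exists_radius H.op hx0
    obtain ⟨χ, -, -, -, -, b1, b2, hrep⟩ := local_limit H' hU hr hsub
    have := ((SS_C2 hr b1).add (KK_C2 hr b2).1).contDiffAt (x := x0)
    refine this.congr_of_eventuallyEq ?_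
    filter_upwards [closedBall_mem_nhds x0 (by positivity : 0 < 2 * r)] with y hy
    exact hrep r hr le_rfl y hy
  refine ⟨U, fun x hx => (hC x hx).contDiffWithinAt, fun x0 hx0 => ?_⟩
  have hs1 := H'.sol {x0} (by simpa using hx0) isCompact_singleton
  refine ⟨ge_of_tendsto (hU x0 hx0) ?_, le_of_tendsto (hU x0 hx0) ?_, ?_⟩
  · filter_upwards [hs1] with n hn using (hn x0 rfl).1
  · filter_upwards [hs1] with n hn using (hn x0 rfl).2.1
  obtain ⟨r, hr, hsub⟩ := exists_radius H.op hx0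
  obtain ⟨χ, hχ2, hχc, hχ1, hχ0, b1, b2, hrep⟩ := local_limit H' hU hr hsub
  set Y : (EuclideanSpace ℝ (Fin N)) → ℝ := fun x => χ x * U x with hY
  have hYc : HasCompactSupport Y := hχc.mul_right
  have hY2 : ContDiff ℝ 2 Y := by
    rw [contDiff_iff_contDiffAt]
    intro x
    by_cases hx : x ∈ Ω
    · exact hχ2.contDiffAt.mul (hC x hx)
    · have : Y =ᶠ[nhds x] fun _ => 0 := by
        have hx' : x ∈ (closedBall x0 (4 * r))ᶜ := fun h =>
          hx (hsub (closedBall_subset_closedBall (by linarith) h))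
        filter_upwards [isClosed_closedBall.isOpen_compl.mem_nhds hx'] with y hy
        simp only [hY, hχ0 y (fun h => hy (ball_subset_closedBall h)), zero_mul]
      exact contDiffAt_const.congr_of_eventuallyEq this
  have hlc : BC (lap Y) := by
    refine ⟨lap_continuous hY2, ?_⟩
    obtain ⟨C, hC⟩ := (lap_compact hY2 hYc).exists_bound_of_continuous (lap_continuous hY2)
    exact ⟨C, hC⟩
  have hYU : Y =ᶠ[nhds x0] U := by
    filter_upwards [closedBall_mem_nhds x0 (by positivity : 0 < 3 * r)] with y hy
    simp [hY, hχ1 y hy]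
  have hz := KK_zero (q := fun y => χ y * f y (U y) - (- lap Y y)) (b2.bc.sub hlc.neg) (x0 := x0) hr (by
    intro ε hε hεr
    rw [KK_sub b2.bc hlc.neg]
    have h1 := hrep ε hε hεr x0 (mem_closedBall_self (by positivity))
    have h2 := KS_repr hε hY2 b1.bc hlc x0
    rw [hYU.eq_of_nhds] at h2
    linarith)
  simp only [hχ1 x0 (mem_closedBall_self (by positivity))] at hz
  rw [lap_congr hYU] at hz
  linarith

end limit2

section approx
variable {N : ℕ} {Ω : Set (EuclideanSpace ℝ (Fin N))} {f : (EuclideanSpace ℝ (Fin N)) → ℝ → ℝ} {v V : (EuclideanSpace ℝ (Fin N)) → ℝ}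

open scoped Manifold in
lemma exists_cut {K : Set (EuclideanSpace ℝ (Fin N))} (hK : IsCompact K) (hΩ : IsOpen Ω) (hKΩ : K ⊆ Ω) :
    ∃ ζ : (EuclideanSpace ℝ (Fin N)) → ℝ, ContDiff ℝ 2 ζ ∧ HasCompactSupport ζ ∧ tsupport ζ ⊆ Ω ∧ (∀ x, 0 ≤ ζ x ∧ ζ x ≤ 1) ∧
      (∀ x ∈ K, ζ x = 1) := by
  obtain ⟨L, hL, hKL, hLΩ⟩ := exists_compact_between hK hΩ hKΩ
  have hdis : Disjoint (interior L)ᶜ K := by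
    rw [Set.disjoint_left]
    exact fun x hx hk => hx (hKL hk)
  obtain ⟨ζ, h2, h01, h0, h1⟩ := exists_contMDiff_zero_iff_one_iff_of_isClosed (n := 2) 𝓘(ℝ, (EuclideanSpace ℝ (Fin N)))
    isOpen_interior.isClosed_compl hK.isClosed hdis
  have hs : tsupport ζ ⊆ L := by
    refine closure_minimal (fun x hx => ?_) hL.isClosed
    by_contra hxL
    exact hx ((h0 x).1 fun h => hxL (interior_subset h))
  refine ⟨ζ, h2.contDiff, ?_, hs.trans hLΩ, fun x => h01 (mem_range_self x), fun x hx => (h1 x).1 hx⟩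
  exact hL.of_isClosed_subset (isClosed_tsupport ζ) hs

lemma lap_const_add (c : ℝ) (g : (EuclideanSpace ℝ (Fin N)) → ℝ) (x : (EuclideanSpace ℝ (Fin N))) : lap (fun y => c + g y) x = lap g x := by
  unfold lap
  simp only [fderiv_const_add]

lemma cut_C2 {w ζ : (EuclideanSpace ℝ (Fin N)) → ℝ} (hΩ : IsOpen Ω) (hw : ContDiffOn ℝ 2 w Ω) (hζ : ContDiff ℝ 2 ζ)
    (hs : tsupport ζ ⊆ Ω) : ContDiff ℝ 2 (fun x => ζ x * w x) := by
  rw [contDiff_iff_contDiffAt]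
  intro x
  by_cases hx : x ∈ Ω
  · exact hζ.contDiffAt.mul (hw.contDiffAt (hΩ.mem_nhds hx))
  · have : (fun x => ζ x * w x) =ᶠ[nhds x] fun _ => 0 := by
      filter_upwards [(isClosed_tsupport ζ).isOpen_compl.mem_nhds (fun h => hx (hs h))] with y hy
      simp [image_eq_zero_of_notMem_tsupport hy]
    exact contDiffAt_const.congr_of_eventuallyEq this

lemma ext_const {w ζ : (EuclideanSpace ℝ (Fin N)) → ℝ} (c : ℝ) (hΩ : IsOpen Ω) (hw : ContDiffOn ℝ 2 w Ω) (hζ : ContDiff ℝ 2 ζ)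
    (hc : HasCompactSupport ζ) (hs : tsupport ζ ⊆ Ω) :
    ContDiff ℝ 2 (fun x => c + ζ x * (w x - c)) ∧ BL (fun x => c + ζ x * (w x - c)) ∧
      BC (lap (fun x => c + ζ x * (w x - c))) := by
  have h2 := cut_C2 hΩ (hw.sub (contDiffOn_const (c := c))) hζ hs
  have hcc : HasCompactSupport (fun x => ζ x * (w x - c)) := hc.mul_right
  refine ⟨contDiff_const.add h2, (BL.const c).add (BL_of_C1_compact (h2.of_le (by norm_num)) hcc), ?_⟩
  have e : lap (fun x => c + ζ x * (w x - c)) = lap (fun x => ζ x * (w x - c)) := by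
    funext x; exact lap_const_add c _ x
  rw [e]
  refine ⟨lap_continuous h2, ?_⟩
  obtain ⟨C, hC⟩ := (lap_compact h2 hcc).exists_bound_of_continuous (lap_continuous h2)
  exact ⟨C, hC⟩

lemma approx_one (hΩ : IsOpen Ω) (hf : LocLip Ω f) (hv : ContDiffOn ℝ 2 v Ω) (hV : ContDiffOn ℝ 2 V Ω)
    (hpos : ∀ x ∈ Ω, 0 < v x) (hvV : ∀ x ∈ Ω, v x ≤ V x / 4)
    (hsup : ∀ x ∈ Ω, f x (V x) ≤ -lap V x) (hsub : ∀ x ∈ Ω, -lap v x ≤ f x (v x))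
    {K : Set (EuclideanSpace ℝ (Fin N))} (hK : IsCompact K) (hKΩ : K ⊆ Ω) :
    ∃ u : (EuclideanSpace ℝ (Fin N)) → ℝ, ContDiff ℝ 2 u ∧ BC u ∧ BC (lap u) ∧
      ∀ x ∈ K, v x ≤ u x ∧ u x ≤ V x ∧ -lap u x = f x (u x) := by
  obtain ⟨ζ, z2, zc, zs, z01, zK⟩ := exists_cut hK hΩ hKΩ
  obtain ⟨K2, hK2, hK12, hK2Ω⟩ := exists_compact_between zc.isCompact hΩ zs
  obtain ⟨ξ, x2, xc, xs, x01, xK⟩ := exists_cut hK2 hΩ hK2Ω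
  obtain ⟨V2, VL, Vl⟩ := ext_const 1 hΩ hV x2 xc xs
  obtain ⟨v2, vL, vl⟩ := ext_const (1/4) hΩ hv x2 xc xs
  set W : (EuclideanSpace ℝ (Fin N)) → ℝ := fun x => 1 + ξ x * (V x - 1) with hW
  set w : (EuclideanSpace ℝ (Fin N)) → ℝ := fun x => 1 / 4 + ξ x * (v x - 1 / 4) with hw
  -- near the support of `ζ`
  have near : ∀ x, ζ x ≠ 0 → w =ᶠ[nhds x] v ∧ W =ᶠ[nhds x] V := by
    intro x hx
    have hx1 : x ∈ interior K2 := hK12 (subset_tsupport _ hx)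
    constructor <;> filter_upwards [isOpen_interior.mem_nhds hx1] with y hy
    · simp [hw, xK y (interior_subset hy)]
    · simp [hW, xK y (interior_subset hy)]
  have zΩ : ∀ x, ζ x ≠ 0 → x ∈ Ω := fun x hx => zs (subset_tsupport _ hx)
  have ξΩ : ∀ x, x ∉ tsupport ξ → ξ x = 0 := fun x hx => image_eq_zero_of_notMem_tsupport hx
  obtain ⟨a, b, ha, hab⟩ := compact_bounds xc.isCompact (hv.continuousOn.mono xs) (hV.continuousOn.mono xs)
    (fun x hx => hpos x (xs hx))
  obtain ⟨m, hm⟩ : ∃ m, m = min a (1/4) := ⟨_, rfl⟩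
  have hm0 : 0 < m := by rw [hm]; positivity
  have hma : m ≤ a := by rw [hm]; exact min_le_left _ _
  have hm4 : m ≤ 1 / 4 := by rw [hm]; exact min_le_right _ _
  obtain ⟨b', hb'⟩ : ∃ b', b' = max b 1 := ⟨_, rfl⟩
  have hbb : b ≤ b' := by rw [hb']; exact le_max_left _ _
  have hb1 : 1 ≤ b' := by rw [hb']; exact le_max_right _ _
  have hwm : ∀ x, m ≤ w x := by
    intro x
    show m ≤ 1 / 4 + ξ x * (v x - 1 / 4)
    by_cases hx : x ∈ tsupport ξ
    · have := (hab x hx).1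
      nlinarith [x01 x]
    · rw [ξΩ x hx]; linarith
  have hwW : ∀ x, w x ≤ W x / 4 := by
    intro x
    show 1 / 4 + ξ x * (v x - 1 / 4) ≤ (1 + ξ x * (V x - 1)) / 4
    by_cases hx : x ∈ tsupport ξ
    · have := hvV x (xs hx)
      nlinarith [x01 x]
    · rw [ξΩ x hx]; linarith
  have hWb : ∀ x, W x ≤ b' := by
    intro x
    show 1 + ξ x * (V x - 1) ≤ b'
    by_cases hx : x ∈ tsupport ξ
    · have := (hab x hx).2
      nlinarith [x01 x]
    · rw [ξΩ x hx]; linarith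
  obtain ⟨C1, hC1⟩ := Vl.2
  obtain ⟨C2, hC2⟩ := vl.2
  obtain ⟨C, hC⟩ : ∃ C, C = |C1| + |C2| + 1 := ⟨_, rfl⟩
  have hC0 : 0 < C := by rw [hC]; positivity
  have hVC : ∀ x, lap W x ≤ C := fun x => by
    rw [hC]; linarith [le_abs_self C1, abs_nonneg C2, le_abs_self (lap W x), hC1 x]
  have hvC : ∀ x, -C ≤ lap w x := fun x => by
    rw [hC]; linarith [le_abs_self C2, abs_nonneg C1, neg_abs_le (lap w x), hC2 x]
  obtain ⟨M, hM⟩ : ∃ M, M = C / m := ⟨_, rfl⟩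
  have hM0 : 0 < M := by rw [hM]; positivity
  have hMm : M * m = C := by rw [hM]; field_simp
  obtain ⟨L, B, hL0, hLB⟩ := hf _ zs zc.isCompact m b' hm0
  have zt : ∀ x, ζ x ≠ 0 → x ∈ tsupport ζ := fun x hx => subset_tsupport _ hx
  set F : (EuclideanSpace ℝ (Fin N)) → ℝ → ℝ := fun x t => ζ x * f x t + (1 - ζ x) * (M * (W x / 2 - t)) with hF
  have Icc_sub : ∀ x t, w x ≤ t → t ≤ W x → t ∈ Icc m b' := fun x t h1 h2 =>
    ⟨(hwm x).trans h1, h2.trans (hWb x)⟩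
  have hBF : ∀ x t, w x ≤ t → t ≤ W x → |F x t| ≤ |B| + M * (2 * b') := by
    intro x t h1 h2
    have h3 : |ζ x * f x t| ≤ |B| := by
      by_cases hz : ζ x = 0
      · rw [hz]; simp
      · have := (hLB x (zt x hz) x (zt x hz) t (Icc_sub x t h1 h2) t (Icc_sub x t h1 h2)).2
        rw [abs_mul, abs_of_nonneg (z01 x).1]
        calc ζ x * |f x t| ≤ 1 * |B| :=
              mul_le_mul (z01 x).2 (this.trans (le_abs_self _)) (abs_nonneg _) zero_le_one
          _ = |B| := one_mul _
    have h4 : |(1 - ζ x) * (M * (W x / 2 - t))| ≤ M * (2 * b') := by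
      have h5 : |W x / 2 - t| ≤ 2 * b' := by
        rw [abs_le]
        have := hwm x
        have := hWb x
        constructor <;> linarith
      rw [abs_mul, abs_mul, abs_of_pos hM0, abs_of_nonneg (by linarith [(z01 x).2])]
      calc (1 - ζ x) * (M * |W x / 2 - t|) ≤ 1 * (M * (2 * b')) :=
            mul_le_mul (by linarith [(z01 x).1]) (mul_le_mul_of_nonneg_left h5 hM0.le) (by positivity) zero_le_one
        _ = _ := one_mul _
    exact (abs_add_le _ _).trans (add_le_add h3 h4)
  have hwW' : ∀ x, w x ≤ W x := fun x => by linarith [hwW x, hwm x]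
  obtain ⟨u, u2, ub, ue⟩ := exists_sol_between F v2 vL vl V2 VL Vl hwW' (Λ := L + M) (BF := |B| + M * (2 * b'))
    (by
      intro x
      show ζ x * f x (W x) + (1 - ζ x) * (M * (W x / 2 - W x)) ≤ - lap W x
      have h1 : M * (W x / 2 - W x) ≤ - lap W x := by
        have : m ≤ W x / 2 := by linarith [hwm x, hwW x]
        nlinarith [hVC x]
      have h2 : ζ x * f x (W x) ≤ ζ x * (- lap W x) := by
        by_cases hz : ζ x = 0
        · simp [hz]
        · rw [lap_congr (near x hz).2, (near x hz).2.eq_of_nhds]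
          exact mul_le_mul_of_nonneg_left (hsup x (zΩ x hz)) (z01 x).1
      have h3 := mul_le_mul_of_nonneg_left h1 (by linarith [(z01 x).2] : 0 ≤ 1 - ζ x)
      linarith)
    (by
      intro x
      show - lap w x ≤ ζ x * f x (w x) + (1 - ζ x) * (M * (W x / 2 - w x))
      have h1 : - lap w x ≤ M * (W x / 2 - w x) := by
        have : m ≤ W x / 2 - w x := by linarith [hwm x, hwW x]
        nlinarith [hvC x]
      have h2 : ζ x * (- lap w x) ≤ ζ x * f x (w x) := by
        by_cases hz : ζ x = 0
        · simp [hz]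
        · rw [lap_congr (near x hz).1, (near x hz).1.eq_of_nhds]
          exact mul_le_mul_of_nonneg_left (hsub x (zΩ x hz)) (z01 x).1
      have h3 := mul_le_mul_of_nonneg_left h1 (by linarith [(z01 x).2] : 0 ≤ 1 - ζ x)
      linarith)
    (by positivity)
    (by
      intro x t t' h1 h2 h3
      show ζ x * f x t + (1 - ζ x) * (M * (W x / 2 - t)) + _ ≤ ζ x * f x t' + (1 - ζ x) * (M * (W x / 2 - t')) + _
      have h4 : ζ x * f x t - ζ x * f x t' ≤ L * (t' - t) := by
        by_cases hz : ζ x = 0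
        · rw [hz]; simp; exact mul_nonneg hL0 (by linarith)
        · have := (hLB x (zt x hz) x (zt x hz) t (Icc_sub x t h1 (h2.trans h3)) t'
            (Icc_sub x t' (h1.trans h2) h3)).1
          rw [sub_self, norm_zero, zero_add, abs_sub_comm t, abs_of_nonneg (by linarith : 0 ≤ t' - t)] at this
          have h5 := (le_abs_self _).trans this
          have h6 : 0 ≤ L * (t' - t) := mul_nonneg hL0 (by linarith)
          nlinarith [z01 x]
      have h7 : 0 ≤ ζ x * (M * (t' - t)) := mul_nonneg (z01 x).1 (mul_nonneg hM0.le (by linarith))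
      nlinarith)
    (by
      intro x
      by_cases hz : ζ x = 0
      · simp only [hF, hz, zero_mul, zero_add]
        fun_prop
      · have hc : ContinuousOn (f x) (Icc (w x) (W x)) := by
          have : LipschitzOnWith ⟨L, hL0⟩ (f x) (Icc (w x) (W x)) := by
            refine LipschitzOnWith.of_dist_le_mul fun t ht t' ht' => ?_
            have := (hLB x (zt x hz) x (zt x hz) t (Icc_sub x t ht.1 ht.2) t' (Icc_sub x t' ht'.1 ht'.2)).1
            rw [sub_self, norm_zero, zero_add] at this
            exact this
          exact this.continuousOn
        simp only [hF]
        fun_prop)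
    hBF
    (by
      intro u hu hub
      have hζL : BL ζ := BL_of_C1_compact (z2.of_le (by norm_num)) zc
      obtain ⟨Lu, hLu⟩ := hu.2
      have h1 : BL (fun x => ζ x * f x (u x)) := by
        refine BL.cutmul hζL (S := tsupport ζ) (fun x hx => image_eq_zero_of_notMem_tsupport hx) (B := B)
          (L := L * (1 + Lu)) (fun x hx => ?_) (fun x hx y hy => ?_)
        · exact (hLB x hx x hx _ (Icc_sub x _ (hub x).1 (hub x).2) _ (Icc_sub x _ (hub x).1 (hub x).2)).2
        · refine (hLB x hx y hy _ (Icc_sub x _ (hub x).1 (hub x).2) _ (Icc_sub y _ (hub y).1 (hub y).2)).1.trans ?_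
          rw [mul_assoc]
          refine mul_le_mul_of_nonneg_left ?_ hL0
          linarith [hLu x y]
      have h2 : BL (fun x => (1 - ζ x) * (M * (W x * (1 / 2) - u x))) :=
        ((BL.const 1).sub hζL).mul ((BL.const M).mul ((VL.mul (BL.const (1/2))).sub hu))
      have h3 := h1.add h2
      convert h3 using 3
      ring)
  refine ⟨u, u2, ⟨u2.continuous, b', fun x => ?_⟩, ⟨lap_continuous u2, |B| + M * (2 * b'), fun x => ?_⟩, fun x hx => ?_⟩
  · have := ub x
    rw [abs_of_pos (by linarith [hwm x])]
    linarith [hWb x]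
  · have := hBF x _ (ub x).1 (ub x).2
    rw [← ue x, abs_neg] at this
    exact this
  · have hz : ζ x = 1 := zK x hx
    have hz' : ζ x ≠ 0 := by rw [hz]; norm_num
    have h1 := (near x hz').1.eq_of_nhds
    have h2 := (near x hz').2.eq_of_nhds
    refine ⟨h1 ▸ (ub x).1, h2 ▸ (ub x).2, ?_⟩
    rw [ue x]
    simp [hF, hz]

lemma sol_of_subsuper (hΩ : IsOpen Ω) (hb : Bornology.IsBounded Ω) (hf : LocLip Ω f)
    (hv : ContDiffOn ℝ 2 v Ω) (hV : ContDiffOn ℝ 2 V Ω)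
    (hpos : ∀ x ∈ Ω, 0 < v x) (hvV : ∀ x ∈ Ω, v x ≤ V x / 4)
    (hsup : ∀ x ∈ Ω, f x (V x) ≤ -lap V x) (hsub : ∀ x ∈ Ω, -lap v x ≤ f x (v x)) :
    ∃ U : (EuclideanSpace ℝ (Fin N)) → ℝ, ContDiffOn ℝ 2 U Ω ∧
      ∀ x ∈ Ω, v x ≤ U x ∧ U x ≤ V x ∧ -lap U x = f x (U x) := by
  by_cases hne : (Ωᶜ).Nonempty
  · have key : ∀ n : ℕ, ∃ u : (EuclideanSpace ℝ (Fin N)) → ℝ, ContDiff ℝ 2 u ∧ BC u ∧ BC (lap u) ∧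
        ∀ x, 1 / ((n:ℝ) + 1) ≤ infDist x Ωᶜ → v x ≤ u x ∧ u x ≤ V x ∧ -lap u x = f x (u x) := by
      intro n
      have hsb : {x | 1 / ((n:ℝ) + 1) ≤ infDist x Ωᶜ} ⊆ Ω := by
        intro x hx
        by_contra hxΩ
        rw [mem_setOf_eq, infDist_zero_of_mem hxΩ] at hx
        have : 0 < 1 / ((n:ℝ) + 1) := by positivity
        linarith
      refine approx_one hΩ hf hv hV hpos hvV hsup hsub (K := {x | 1 / ((n:ℝ) + 1) ≤ infDist x Ωᶜ}) ?_ hsb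
      exact Metric.isCompact_of_isClosed_isBounded
        (isClosed_le continuous_const (continuous_infDist_pt _)) (hb.subset hsb)
    choose u u2 ub ul us using key
    refine limit_sol (u := u) ⟨hΩ, hf, hv.continuousOn, hV.continuousOn, hpos, u2, ub, ul, fun K hKΩ hK => ?_⟩
    rcases K.eq_empty_or_nonempty with rfl | hKne
    · simp
    obtain ⟨x1, hx1, hmin⟩ := hK.exists_isMinOn hKne (continuous_infDist_pt Ωᶜ).continuousOn
    have hp : 0 < infDist x1 Ωᶜ :=
      (hΩ.isClosed_compl.notMem_iff_infDist_pos hne).1 (fun h => h (hKΩ hx1))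
    obtain ⟨n0, hn0⟩ := exists_nat_one_div_lt hp
    filter_upwards [Filter.eventually_ge_atTop n0] with n hn x hx
    refine us n x ((?_ : 1 / ((n:ℝ) + 1) ≤ 1 / ((n0:ℝ) + 1)).trans (hn0.le.trans (hmin hx)))
    gcongr
  · rw [Set.not_nonempty_iff_eq_empty, Set.compl_empty_iff] at hne
    subst hne
    have hc : IsCompact (univ : Set (EuclideanSpace ℝ (Fin N))) := Metric.isCompact_of_isClosed_isBounded isClosed_univ hb
    obtain ⟨u, u2, -, -, h⟩ := approx_one hΩ hf hv hV hpos hvV hsup hsub hc subset_rfl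
    exact ⟨u, u2.contDiffOn, h⟩

end approx

section calc_lap
variable {N : ℕ} {Ω : Set (EuclideanSpace ℝ (Fin N))}

lemma gradient_sq {d : (EuclideanSpace ℝ (Fin N)) → ℝ} (x : (EuclideanSpace ℝ (Fin N))) :
    ‖gradient d x‖ ^ 2 = ∑ i : Fin N, (fderiv ℝ d x (EuclideanSpace.single i 1)) ^ 2 := by
  rw [EuclideanSpace.norm_sq_eq]
  refine Finset.sum_congr rfl fun i _ => ?_
  have : fderiv ℝ d x (EuclideanSpace.single i 1) = (gradient d x) i := by
    have h : inner ℝ (gradient d x) (EuclideanSpace.single i (1:ℝ)) = fderiv ℝ d x (EuclideanSpace.single i 1) := by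
      unfold gradient
      rw [InnerProductSpace.toDual_symm_apply]
    rw [← h, EuclideanSpace.inner_single_right]
    exact one_mul _
  rw [this, Real.norm_eq_abs, sq_abs]

lemma lap_comp {φ φ' : ℝ → ℝ} {φ'' : ℝ} {d : (EuclideanSpace ℝ (Fin N)) → ℝ} {x : (EuclideanSpace ℝ (Fin N))} (hd : ContDiffAt ℝ 2 d x)
    (h1 : ∀ᶠ t in nhds (d x), HasDerivAt φ (φ' t) t) (h2 : HasDerivAt φ' φ'' (d x)) :
    lap (fun y => φ (d y)) x = φ'' * ‖gradient d x‖ ^ 2 + φ' (d x) * lap d x := by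
  have a1 : ∀ᶠ y in nhds x, HasFDerivAt (fun y => φ (d y)) (φ' (d y) • fderiv ℝ d y) y := by
    filter_upwards [eventually_hasFDerivAt hd, hd.continuousAt.eventually h1] with y hy hy2
    exact hy2.comp_hasFDerivAt y hy
  have a2 := (h2.comp_hasFDerivAt x (eventually_hasFDerivAt hd).self_of_nhds).smul (hasFDerivAt_fderiv hd)
  rw [lap_eq_of_hasFDerivAt a1 a2, lap_eq hd, gradient_sq, trL_apply, trL_apply]
  simp [Finset.mul_sum, ← Finset.sum_add_distrib]
  refine Finset.sum_congr rfl fun i _ => ?_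
  ring

lemma lap_add' {g h : (EuclideanSpace ℝ (Fin N)) → ℝ} {x : (EuclideanSpace ℝ (Fin N))} (hg : ContDiffAt ℝ 2 g x) (hh : ContDiffAt ℝ 2 h x) :
    lap (fun y => g y + h y) x = lap g x + lap h x := by
  have a1 : ∀ᶠ y in nhds x, HasFDerivAt (fun y => g y + h y) (fderiv ℝ g y + fderiv ℝ h y) y := by
    filter_upwards [eventually_hasFDerivAt hg, eventually_hasFDerivAt hh] with y h1 h2
    exact h1.add h2
  rw [lap_eq_of_hasFDerivAt a1 ((hasFDerivAt_fderiv hg).add (hasFDerivAt_fderiv hh)), lap_eq hg, lap_eq hh]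
  simp

lemma lap_cmul {g : (EuclideanSpace ℝ (Fin N)) → ℝ} {x : (EuclideanSpace ℝ (Fin N))} (c : ℝ) (hg : ContDiffAt ℝ 2 g x) :
    lap (fun y => c * g y) x = c * lap g x := by
  have a1 : ∀ᶠ y in nhds x, HasFDerivAt (fun y => c * g y) (c • fderiv ℝ g y) y := by
    filter_upwards [eventually_hasFDerivAt hg] with y h1
    exact h1.const_mul c
  rw [lap_eq_of_hasFDerivAt a1 ((hasFDerivAt_fderiv hg).const_smul c), lap_eq hg]
  simp

lemma lap_exp (i : Fin N) (K : ℝ) (x : (EuclideanSpace ℝ (Fin N))) :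
    lap (fun y : (EuclideanSpace ℝ (Fin N)) => Real.exp (K * y i)) x = K ^ 2 * Real.exp (K * x i) := by
  have hf : ∀ y : (EuclideanSpace ℝ (Fin N)), HasFDerivAt (fun y : (EuclideanSpace ℝ (Fin N)) => y i) (EuclideanSpace.proj i : (EuclideanSpace ℝ (Fin N)) →L[ℝ] ℝ) y := fun y =>
    (EuclideanSpace.proj i : (EuclideanSpace ℝ (Fin N)) →L[ℝ] ℝ).hasFDerivAt
  have hc : ContDiffAt ℝ 2 (fun y : (EuclideanSpace ℝ (Fin N)) => y i) x := (EuclideanSpace.proj i : (EuclideanSpace ℝ (Fin N)) →L[ℝ] ℝ).contDiff.contDiffAt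
  have hl : lap (fun y : (EuclideanSpace ℝ (Fin N)) => y i) x = 0 := by
    rw [lap_eq_of_hasFDerivAt (Filter.Eventually.of_forall hf) (hasFDerivAt_const _ _)]
    simp
  have hgr : ‖gradient (fun y : (EuclideanSpace ℝ (Fin N)) => y i) x‖ ^ 2 = 1 := by
    rw [gradient_sq, (hf x).fderiv]
    simp [Pi.single_apply]
  have e1 : ∀ t : ℝ, HasDerivAt (fun t => Real.exp (K * t)) (K * Real.exp (K * t)) t := fun t => by
    have := ((hasDerivAt_id t).const_mul K).exp
    simpa [mul_comm] using this
  have := lap_comp (φ := fun t => Real.exp (K * t)) (φ' := fun t => K * Real.exp (K * t)) hc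
    (Filter.Eventually.of_forall e1) ((e1 (x i)).const_mul K)
  rw [this, hl, hgr]
  ring

lemma ratio_pow {c q : ℝ} (s : ℝ) (hc : 1 ≤ c) (h1 : c⁻¹ ≤ q) (h2 : q ≤ c) :
    c ^ (-|s|) ≤ q ^ s ∧ q ^ s ≤ c ^ |s| := by
  have hc0 : 0 < c := by linarith
  have hq : 0 < q := lt_of_lt_of_le (inv_pos.2 hc0) h1
  have l1 : -Real.log c ≤ Real.log q := by rw [← Real.log_inv]; exact Real.log_le_log (inv_pos.2 hc0) h1
  have l2 : Real.log q ≤ Real.log c := Real.log_le_log hq h2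
  have l3 : |s * Real.log q| ≤ |s| * Real.log c := by
    rw [abs_mul]
    exact mul_le_mul_of_nonneg_left (abs_le.2 ⟨l1, l2⟩) (abs_nonneg _)
  rw [abs_le] at l3
  rw [Real.rpow_def_of_pos hc0, Real.rpow_def_of_pos hq, Real.rpow_def_of_pos hc0, Real.exp_le_exp, Real.exp_le_exp]
  constructor <;> nlinarith [l3.1, l3.2]

/-- The nonlinearity. -/
def nonl {N : ℕ} (Ω : Set (EuclideanSpace ℝ (Fin N))) (μ s p : ℝ) (x : EuclideanSpace ℝ (Fin N)) (t : ℝ) : ℝ :=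
  μ / (bdist Ω x) ^ 2 * t - t ^ p / (bdist Ω x) ^ s

lemma bdist_cont (Ω : Set (EuclideanSpace ℝ (Fin N))) : Continuous (bdist Ω) := continuous_infDist_pt _

lemma bdist_lip (Ω : Set (EuclideanSpace ℝ (Fin N))) (x y : (EuclideanSpace ℝ (Fin N))) : |bdist Ω x - bdist Ω y| ≤ ‖x - y‖ := by
  have := (lipschitz_infDist_pt (Ωᶜ)).dist_le_mul x y
  rw [Real.dist_eq, dist_eq_norm] at this
  simpa [bdist] using this

lemma bdist_pos (hΩ : IsOpen Ω) (hne : (Ωᶜ).Nonempty) {x : (EuclideanSpace ℝ (Fin N))} (hx : x ∈ Ω) : 0 < bdist Ω x :=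
  (hΩ.isClosed_compl.notMem_iff_infDist_pos hne).1 (fun h => h hx)

lemma mem_of_bdist_pos {x : (EuclideanSpace ℝ (Fin N))} (h : 0 < bdist Ω x) : x ∈ Ω := by
  by_contra hx
  rw [bdist, infDist_zero_of_mem hx] at h
  exact lt_irrefl _ h

lemma nonl_locLip (hΩ : IsOpen Ω) (hne : (Ωᶜ).Nonempty) (μ s p : ℝ) : LocLip Ω (nonl Ω μ s p) := by
  intro K hKΩ hK a b ha
  obtain ⟨δ1, D, hδ1, hD⟩ := compact_bounds hK (bdist_cont Ω).continuousOn (bdist_cont Ω).continuousOn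
    (fun x hx => bdist_pos hΩ hne (hKΩ hx))
  let Φ : ℝ × ℝ → ℝ := fun q => μ / q.1 ^ 2 * q.2 - q.2 ^ p / q.1 ^ s
  have hΦ : ContDiffOn ℝ 1 Φ (Icc δ1 D ×ˢ Icc a b) := by
    intro q hq
    have h1 : q.1 ≠ 0 := (hδ1.trans_le hq.1.1).ne'
    have h2 : q.2 ≠ 0 := (ha.trans_le hq.2.1).ne'
    have h3 : q.1 ^ s ≠ 0 := (Real.rpow_pos_of_pos (hδ1.trans_le hq.1.1) s).ne'
    refine ContDiffAt.contDiffWithinAt ?_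
    have c1 : ContDiffAt ℝ 1 (fun q : ℝ × ℝ => q.1) q := contDiffAt_fst
    have c2 : ContDiffAt ℝ 1 (fun q : ℝ × ℝ => q.2) q := contDiffAt_snd
    exact ((contDiffAt_const.div (c1.pow 2) (pow_ne_zero 2 h1)).mul c2).sub
      ((c2.rpow_const_of_ne h2).div (c1.rpow_const_of_ne h1) h3)
  have hcomp : IsCompact (Icc δ1 D ×ˢ Icc a b) := isCompact_Icc.prod isCompact_Icc
  obtain ⟨L, hL⟩ := hΦ.exists_lipschitzOnWith one_ne_zero ((convex_Icc _ _).prod (convex_Icc _ _)) hcomp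
  obtain ⟨B, hB⟩ := hcomp.exists_bound_of_continuousOn hΦ.continuousOn
  refine ⟨L, B, L.2, fun x hx y hy t ht t' ht' => ⟨?_, hB (bdist Ω x, t) ⟨hD x hx, ht⟩⟩⟩
  have h1 := hL.dist_le_mul (bdist Ω x, t) ⟨hD x hx, ht⟩ (bdist Ω y, t') ⟨hD y hy, ht'⟩
  rw [Real.dist_eq] at h1
  refine h1.trans (mul_le_mul_of_nonneg_left ?_ L.2)
  rw [Prod.dist_eq]
  refine max_le ?_ ?_
  · rw [Real.dist_eq]
    exact (bdist_lip Ω x y).trans (by linarith [abs_nonneg (t - t')])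
  · rw [Real.dist_eq]
    linarith [norm_nonneg (x - y)]

end calc_lap

section supersub
variable {N : ℕ} {Ω : Set (EuclideanSpace ℝ (Fin N))}

lemma super_exists (hΩ : IsOpen Ω) (hne : (Ωᶜ).Nonempty) {d : (EuclideanSpace ℝ (Fin N)) → ℝ} {c : ℝ} (hd : RegDist Ω d c)
    {μ s p α : ℝ} (hp : 1 < p) (hα : α * (p - 1) + 2 = s) :
    ∃ A, 0 < A ∧ ContDiffOn ℝ 2 (fun x => A * d x ^ α) Ω ∧
      ∀ x ∈ Ω, nonl Ω μ s p x (A * d x ^ α) ≤ -lap (fun x => A * d x ^ α) x := by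
  obtain ⟨hc, d2, dpos, dδ, dg, dl⟩ := hd
  have hc0 : 0 < c := by linarith
  set Q : ℝ := |α * (α - 1)| * c ^ 2 + |α| * c + |μ| * c ^ 2 with hQ
  have hQ0 : 0 ≤ Q := by positivity
  set A : ℝ := ((Q + 1) * c ^ |s|) ^ (1 / (p - 1)) with hA
  have hcs : 0 < c ^ |s| := Real.rpow_pos_of_pos hc0 _
  have hA0 : 0 < A := Real.rpow_pos_of_pos (by positivity) _
  have hAp : A ^ (p - 1) = (Q + 1) * c ^ |s| := by
    rw [hA, ← Real.rpow_mul (by positivity), one_div_mul_cancel (by linarith), Real.rpow_one]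
  have hAt : ∀ x ∈ Ω, ContDiffAt ℝ 2 d x := fun x hx => d2.contDiffAt (hΩ.mem_nhds hx)
  refine ⟨A, hA0, ?_, ?_⟩
  · intro x hx
    exact (contDiffAt_const.mul ((hAt x hx).rpow_const_of_ne (dpos x hx).ne')).contDiffWithinAt
  intro x hx
  have hx0 := dpos x hx
  have hδ0 : 0 < bdist Ω x := bdist_pos hΩ hne hx
  have r1 : ∀ t : ℝ, t ≠ 0 → ∀ β : ℝ, HasDerivAt (fun r : ℝ => r ^ β) (β * t ^ (β - 1)) t := fun t ht β =>
    Real.hasDerivAt_rpow_const (Or.inl ht)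
  have hl := lap_comp (φ := fun r => A * r ^ α) (φ' := fun r => A * (α * r ^ (α - 1)))
    (φ'' := A * (α * ((α - 1) * (d x) ^ (α - 1 - 1)))) (hAt x hx)
    (by
      filter_upwards [isOpen_ne.mem_nhds hx0.ne'] with t ht
      exact (r1 t ht α).const_mul A)
    (((r1 _ hx0.ne' (α - 1)).const_mul α).const_mul A)
  rw [hl]
  unfold nonl
  obtain ⟨q1, q2⟩ := dδ x hx
  set t := d x with ht
  set δ := bdist Ω x with hδ
  set P := t ^ (α - 2) with hP
  have hP0 : 0 < P := Real.rpow_pos_of_pos hx0 _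
  have e1 : t ^ (α - 1 - 1) = P := by rw [hP]; congr 1; ring
  have e2 : t ^ (α - 1) = P * t := by
    rw [hP, ← Real.rpow_add_one hx0.ne']; congr 1; ring
  have e3 : t ^ α = P * t ^ 2 := by
    rw [hP, ← Real.rpow_natCast t 2, ← Real.rpow_add hx0]; congr 1; push_cast; ring
  -- power term
  have ratio := (ratio_pow (q := t / δ) s hc (by rw [le_div_iff₀ hδ0]; exact q1) (by rw [div_le_iff₀ hδ0]; exact q2)).1
  have e4 : (A * t ^ α) ^ p / δ ^ s = A * A ^ (p - 1) * P * (t / δ) ^ s := by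
    rw [Real.mul_rpow hA0.le (by positivity), Real.div_rpow hx0.le hδ0.le, ← Real.rpow_mul hx0.le]
    have : t ^ (α * p) = P * t ^ s := by
      rw [hP, ← Real.rpow_add hx0]; congr 1; linarith
    have h2 : A ^ p = A * A ^ (p - 1) := by
      rw [mul_comm, ← Real.rpow_add_one hA0.ne']; congr 1; ring
    rw [this, h2]; ring
  have e5 : A * A ^ (p - 1) * P * (t / δ) ^ s ≥ A * (Q + 1) * P := by
    rw [hAp]
    have h1 : c ^ |s| * c ^ (-|s|) = 1 := by rw [← Real.rpow_add hc0]; simp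
    calc A * (Q + 1) * P = A * ((Q + 1) * c ^ |s|) * P * c ^ (-|s|) := by
          linear_combination (-A * (Q + 1) * P) * h1
      _ ≤ _ := mul_le_mul_of_nonneg_left ratio (by positivity)
  -- linear terms
  have g1 : A * (α * ((α - 1) * P)) * ‖gradient d x‖ ^ 2 ≤ A * P * (|α * (α - 1)| * c ^ 2) := by
    have h1 : ‖gradient d x‖ ^ 2 ≤ c ^ 2 := pow_le_pow_left₀ (norm_nonneg _) (dg x hx) 2
    have h2 : α * (α - 1) * ‖gradient d x‖ ^ 2 ≤ |α * (α - 1)| * c ^ 2 :=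
      mul_le_mul (le_abs_self _) h1 (by positivity) (abs_nonneg _)
    calc _ = A * P * (α * (α - 1) * ‖gradient d x‖ ^ 2) := by ring
      _ ≤ _ := mul_le_mul_of_nonneg_left h2 (by positivity)
  have g2 : A * (α * (P * t)) * lap d x ≤ A * P * (|α| * c) := by
    have h1 : t * |lap d x| ≤ c := by
      have := dl x hx
      rw [le_div_iff₀ hx0] at this
      linarith
    have h2 : α * (t * lap d x) ≤ |α| * c := by
      refine (le_abs_self _).trans ?_
      rw [abs_mul, abs_mul, abs_of_pos hx0]
      exact mul_le_mul_of_nonneg_left h1 (abs_nonneg _)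
    calc _ = A * P * (α * (t * lap d x)) := by ring
      _ ≤ _ := mul_le_mul_of_nonneg_left h2 (by positivity)
  have g3 : μ / δ ^ 2 * (A * (P * t ^ 2)) ≤ A * P * (|μ| * c ^ 2) := by
    have h1 : t ^ 2 / δ ^ 2 ≤ c ^ 2 := by
      rw [div_le_iff₀ (by positivity), ← mul_pow]
      exact pow_le_pow_left₀ hx0.le q2 2
    have h2 : μ * (t ^ 2 / δ ^ 2) ≤ |μ| * c ^ 2 :=
      mul_le_mul (le_abs_self _) h1 (by positivity) (abs_nonneg _)
    calc _ = A * P * (μ * (t ^ 2 / δ ^ 2)) := by ring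
      _ ≤ _ := mul_le_mul_of_nonneg_left h2 (by positivity)
  have e6 : A * (Q + 1) * P ≥ A * P * (|α * (α - 1)| * c ^ 2) + A * P * (|α| * c) + A * P * (|μ| * c ^ 2) := by
    have : 0 < A * P := by positivity
    rw [hQ]; nlinarith
  rw [e4, e1]
  show μ / δ ^ 2 * (A * t ^ α) - _ ≤ -(_ + A * (α * t ^ (α - 1)) * lap d x)
  rw [e2, e3]
  linarith

/-- Profile of the boundary subsolution. -/
def Gf (α b k r : ℝ) : ℝ := r ^ α * (max (1 - k * r ^ b) 0) ^ 3

/-- First derivative of the profile. -/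
def Gf1 (α b k r : ℝ) : ℝ := α * r ^ (α - 1) * (max (1 - k * r ^ b) 0) ^ 3
  + r ^ α * (3 * (max (1 - k * r ^ b) 0) ^ 2 * (-(k * (b * r ^ (b - 1)))))

lemma Gf_deriv (α b k : ℝ) {r : ℝ} (hr : 0 < r) : HasDerivAt (Gf α b k) (Gf1 α b k r) r := by
  have r1 : ∀ β : ℝ, HasDerivAt (fun r : ℝ => r ^ β) (β * r ^ (β - 1)) r := fun β =>
    Real.hasDerivAt_rpow_const (Or.inl hr.ne')
  have y1 : HasDerivAt (fun r => 1 - k * r ^ b) (-(k * (b * r ^ (b - 1)))) r :=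
    ((r1 b).const_mul k).const_sub 1
  have y3 := (hasDerivAt_maxpow 1 (1 - k * r ^ b)).comp r y1
  have := (r1 α).mul y3
  refine HasDerivAt.congr_deriv (f := Gf α b k) this ?_
  simp only [Gf1, Function.comp]
  norm_num

lemma Gf1_deriv (α b k : ℝ) {r : ℝ} (hr : 0 < r) (hb : 2 * α = 1 - 2 * b) : ∃ G2, HasDerivAt (Gf1 α b k) G2 r ∧
    r ^ 2 * G2 = r ^ α * (-(α * (1 - α)) * (max (1 - k * r ^ b) 0) ^ 3 +
      3 * b ^ 2 * (k * r ^ b) * (max (1 - k * r ^ b) 0) ^ 2 + 6 * b ^ 2 * (k * r ^ b) ^ 2 * max (1 - k * r ^ b) 0) := by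
  have r1 : ∀ β : ℝ, HasDerivAt (fun r : ℝ => r ^ β) (β * r ^ (β - 1)) r := fun β =>
    Real.hasDerivAt_rpow_const (Or.inl hr.ne')
  have y1 : HasDerivAt (fun r => 1 - k * r ^ b) (-(k * (b * r ^ (b - 1)))) r :=
    ((r1 b).const_mul k).const_sub 1
  have y3 := (hasDerivAt_maxpow 1 (1 - k * r ^ b)).comp r y1
  have y2 := (hasDerivAt_maxpow 0 (1 - k * r ^ b)).comp r y1
  have z := (((r1 (α - 1)).const_mul α).mul y3).add
    ((r1 α).mul ((y2.const_mul 3).mul (((r1 (b - 1)).const_mul b).const_mul k).neg))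
  refine ⟨_, z, ?_⟩
  simp only [Function.comp, Pi.mul_apply, Pi.neg_apply]
  have e1 : r ^ (α - 1) = r ^ α / r := Real.rpow_sub_one hr.ne' α
  have e2 : r ^ (α - 1 - 1) = r ^ α / r / r := by rw [Real.rpow_sub_one hr.ne', e1]
  have e3 : r ^ (b - 1) = r ^ b / r := Real.rpow_sub_one hr.ne' b
  have e4 : r ^ (b - 1 - 1) = r ^ b / r / r := by rw [Real.rpow_sub_one hr.ne', e3]
  rw [e1, e2, e3, e4]
  generalize max (1 - k * r ^ b) 0 = y
  have hα : α = 1 / 2 - b := by linarith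
  generalize r ^ α = R
  subst hα
  field_simp
  push_cast
  ring

lemma Gf_C2 (α b k : ℝ) {r : ℝ} (hr : 0 < r) : ContDiffAt ℝ 2 (Gf α b k) r := by
  have r1 : ∀ β : ℝ, ContDiffAt ℝ 2 (fun r : ℝ => r ^ β) r := fun β => contDiffAt_id.rpow_const_of_ne hr.ne'
  have y1 : ContDiffAt ℝ 2 (fun r => 1 - k * r ^ b) r := contDiffAt_const.sub (contDiffAt_const.mul (r1 b))
  exact (r1 α).mul ((contDiff_maxpow 2).contDiffAt.comp r y1)

end supersub

section subsol
variable {N : ℕ} {Ω : Set (EuclideanSpace ℝ (Fin N))}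

lemma sub_v1 (hΩ : IsOpen Ω) (hne : (Ωᶜ).Nonempty) {ρ₀ : ℝ} (hρ : GoodCollar Ω ρ₀) {α μ c0 : ℝ}
    (hα : α < 1 / 2) (hc0 : 0 < c0) (hc : 3 * c0 ≤ μ - α * (1 - α)) :
    ∃ σ, 0 < σ ∧ ∃ v1 : (EuclideanSpace ℝ (Fin N)) → ℝ, ContDiffOn ℝ 2 v1 Ω ∧ (∀ x ∈ Ω, 0 ≤ v1 x ∧ v1 x ≤ bdist Ω x ^ α) ∧
      (∀ x ∈ Ω, bdist Ω x < σ → 0 < v1 x) ∧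
      (∀ x ∈ Ω, 0 ≤ lap v1 x + (μ - 2 * c0) / bdist Ω x ^ 2 * v1 x) ∧
      ∃ ρ', 0 < ρ' ∧ ∀ x ∈ collar Ω ρ', bdist Ω x ^ α / 8 ≤ v1 x := by
  obtain ⟨hρ0, hδ2, hgrad, M, hM⟩ := hρ
  obtain ⟨b, hb⟩ : ∃ b, b = (1 - 2 * α) / 2 := ⟨_, rfl⟩
  have hb0 : 0 < b := by rw [hb]; linarith
  have hb2 : 2 * α = 1 - 2 * b := by rw [hb]; ring
  obtain ⟨σ, hσ⟩ : ∃ σ, σ = min (ρ₀ / 2) (min (c0 / ((|M| + 1) * (|α| + 1))) (b / (|M| + 1))) := ⟨_, rfl⟩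
  have hσ0 : 0 < σ := by rw [hσ]; positivity
  have hσ1 : σ < ρ₀ := by
    have : σ ≤ ρ₀ / 2 := by rw [hσ]; exact min_le_left _ _
    linarith
  have hσ2 : σ * |M| * |α| ≤ c0 := by
    have : σ ≤ c0 / ((|M| + 1) * (|α| + 1)) := by rw [hσ]; exact (min_le_right _ _).trans (min_le_left _ _)
    rw [le_div_iff₀ (by positivity)] at this
    nlinarith [mul_nonneg hσ0.le (abs_nonneg M), mul_nonneg hσ0.le (abs_nonneg α)]
  have hσ3 : σ * |M| ≤ b := by
    have : σ ≤ b / (|M| + 1) := by rw [hσ]; exact (min_le_right _ _).trans (min_le_right _ _)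
    rw [le_div_iff₀ (by positivity)] at this
    linarith
  clear hσ
  obtain ⟨k, hk⟩ : ∃ k, k = σ ^ (-b) := ⟨_, rfl⟩
  have hk0 : 0 < k := by rw [hk]; exact Real.rpow_pos_of_pos hσ0 _
  have hkσ : k * σ ^ b = 1 := by rw [hk, ← Real.rpow_add hσ0]; simp
  have hlt : ∀ r, 0 < r → r < σ → k * r ^ b < 1 := fun r h0 h => by
    rw [← hkσ]; exact mul_lt_mul_of_pos_left (Real.rpow_lt_rpow h0.le h hb0) hk0
  have hge : ∀ r, σ ≤ r → max (1 - k * r ^ b) 0 = 0 := fun r h => by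
    refine max_eq_right ?_
    have := mul_le_mul_of_nonneg_left (Real.rpow_le_rpow hσ0.le h hb0.le) hk0.le
    linarith
  have hδ : ∀ x ∈ Ω, 0 < bdist Ω x := fun x hx => bdist_pos hΩ hne hx
  have hco : IsOpen (collar Ω ρ₀) := hΩ.inter (isOpen_lt (bdist_cont Ω) continuous_const)
  have hcol : ∀ x ∈ Ω, bdist Ω x < ρ₀ → ContDiffAt ℝ 2 (bdist Ω) x := fun x hx h =>
    hδ2.contDiffAt (hco.mem_nhds ⟨hx, h⟩)
  have hfar : ∀ x ∈ Ω, ρ₀ ≤ bdist Ω x → (fun x => Gf α b k (bdist Ω x)) =ᶠ[nhds x] fun _ => 0 := by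
    intro x hx h
    filter_upwards [(isOpen_lt continuous_const (bdist_cont Ω)).mem_nhds (hσ1.trans_le h)] with z hz
    simp [Gf, hge _ (le_of_lt hz)]
  refine ⟨σ, hσ0, fun x => Gf α b k (bdist Ω x), ?_, ?_, ?_, ?_, ?_⟩
  · intro x hx
    refine ContDiffAt.contDiffWithinAt ?_
    by_cases h : bdist Ω x < ρ₀
    · exact (Gf_C2 α b k (hδ x hx)).comp x (hcol x hx h)
    · exact contDiffAt_const.congr_of_eventuallyEq (hfar x hx (not_lt.1 h))
  · intro x hx
    have hR : 0 < bdist Ω x ^ α := Real.rpow_pos_of_pos (hδ x hx) _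
    have h1 : 0 ≤ max (1 - k * bdist Ω x ^ b) 0 := le_max_right _ _
    have h2 : max (1 - k * bdist Ω x ^ b) 0 ≤ 1 := max_le (by
      have := Real.rpow_pos_of_pos (hδ x hx) b
      have := mul_pos hk0 this
      linarith) zero_le_one
    have h3 := pow_le_one₀ h1 h2 (n := 3)
    unfold Gf
    constructor
    · positivity
    · nlinarith
  · intro x hx h
    have := hlt _ (hδ x hx) h
    have h1 : 0 < max (1 - k * bdist Ω x ^ b) 0 := lt_max_of_lt_left (by linarith)
    exact mul_pos (Real.rpow_pos_of_pos (hδ x hx) _) (pow_pos h1 3)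
  · intro x hx
    by_cases h : bdist Ω x < ρ₀
    · obtain ⟨G2, hG2, hG2e⟩ := Gf1_deriv α b k (hδ x hx) hb2
      have hl := lap_comp (φ := Gf α b k) (φ' := Gf1 α b k) (hcol x hx h)
        (by
          filter_upwards [lt_mem_nhds (hδ x hx)] with t ht using Gf_deriv α b k ht) hG2
      rw [hl, hgrad x ⟨hx, h⟩]
      beta_reduce
      have hℓ : |lap (bdist Ω) x| ≤ |M| := (hM x ⟨hx, h⟩).trans (le_abs_self M)
      have hr := hδ x hx
      have hge' := hge (bdist Ω x)
      generalize lap (bdist Ω) x = ℓ at *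
      generalize bdist Ω x = r at *
      have hR : 0 < r ^ α := Real.rpow_pos_of_pos hr _
      have hT : 0 < k * r ^ b := mul_pos hk0 (Real.rpow_pos_of_pos hr _)
      have hG1e : r * Gf1 α b k r = r ^ α * (α * (max (1 - k * r ^ b) 0) ^ 3 -
          3 * b * (k * r ^ b) * (max (1 - k * r ^ b) 0) ^ 2) := by
        unfold Gf1
        rw [Real.rpow_sub_one hr.ne', Real.rpow_sub_one hr.ne']
        field_simp
        ring
      have hGe : Gf α b k r = r ^ α * (max (1 - k * r ^ b) 0) ^ 3 := rfl
      have hy0 : 0 ≤ max (1 - k * r ^ b) 0 := le_max_right _ _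
      have hylt : max (1 - k * r ^ b) 0 = 0 ∨ r < σ := by
        rcases lt_or_ge r σ with h' | h'
        · exact Or.inr h'
        · exact Or.inl (hge' h')
      generalize max (1 - k * r ^ b) 0 = y at *
      generalize k * r ^ b = t at *
      generalize r ^ α = R at *
      have key : 0 ≤ r ^ 2 * G2 + r * (r * Gf1 α b k r) * ℓ + (μ - 2 * c0) * Gf α b k r := by
        rw [hG2e, hG1e, hGe]
        rcases hylt with h0 | h0
        · rw [h0]; simp
        · have hrℓ : |r * ℓ| ≤ σ * |M| := by
            rw [abs_mul, abs_of_pos hr]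
            exact mul_le_mul h0.le hℓ (abs_nonneg _) hσ0.le
          have a1 : -c0 ≤ α * (r * ℓ) := by
            have : |α * (r * ℓ)| ≤ c0 := by
              rw [abs_mul]
              calc |α| * |r * ℓ| ≤ |α| * (σ * |M|) := mul_le_mul_of_nonneg_left hrℓ (abs_nonneg _)
                _ ≤ c0 := by linarith
            exact (abs_le.1 this).1
          have a2 : r * ℓ ≤ b := (le_abs_self _).trans (hrℓ.trans hσ3)
          have b1 : 0 ≤ (α * (r * ℓ) + c0) * y ^ 3 := mul_nonneg (by linarith) (by positivity)
          have b2 : 0 ≤ (b - r * ℓ) * (3 * b * t * y ^ 2) := mul_nonneg (by linarith) (by positivity)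
          have b3 : 0 ≤ (μ - α * (1 - α) - 3 * c0) * y ^ 3 := mul_nonneg (by linarith) (by positivity)
          have b4 : 0 ≤ 6 * b ^ 2 * t ^ 2 * y := by positivity
          have := mul_nonneg hR.le (add_nonneg (add_nonneg (add_nonneg b1 b2) b3) b4)
          refine this.trans (le_of_eq ?_)
          ring
      have e : G2 * 1 ^ 2 + Gf1 α b k r * ℓ + (μ - 2 * c0) / r ^ 2 * Gf α b k r =
          (r ^ 2 * G2 + r * (r * Gf1 α b k r) * ℓ + (μ - 2 * c0) * Gf α b k r) / r ^ 2 := by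
        field_simp
      rw [e]
      exact div_nonneg key (by positivity)
    · have h1 := hfar x hx (not_lt.1 h)
      rw [lap_congr h1]
      have h2 : Gf α b k (bdist Ω x) = 0 := h1.eq_of_nhds
      show 0 ≤ lap (fun _ => (0:ℝ)) x + (μ - 2 * c0) / bdist Ω x ^ 2 * Gf α b k (bdist Ω x)
      rw [h2]
      simp [lap]
  · refine ⟨(1 / (2 * k)) ^ (1 / b), by positivity, fun x hx => ?_⟩
    have hr := hδ x hx.1
    have h1 : bdist Ω x ^ b ≤ 1 / (2 * k) := by
      have := Real.rpow_le_rpow hr.le hx.2.le hb0.le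
      rwa [← Real.rpow_mul (by positivity), one_div_mul_cancel hb0.ne', Real.rpow_one] at this
    have h2 : k * bdist Ω x ^ b ≤ 1 / 2 := by
      have := mul_le_mul_of_nonneg_left h1 hk0.le
      refine this.trans (le_of_eq ?_)
      field_simp
    have h3 : (1 / 2 : ℝ) ≤ max (1 - k * bdist Ω x ^ b) 0 := le_max_of_le_left (by linarith)
    have h4 := pow_le_pow_left₀ (by norm_num) h3 3
    have hR : 0 < bdist Ω x ^ α := Real.rpow_pos_of_pos hr _
    show _ ≤ bdist Ω x ^ α * (max (1 - k * bdist Ω x ^ b) 0) ^ 3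
    nlinarith

end subsol

section subsol2
variable {N : ℕ} {Ω : Set (EuclideanSpace ℝ (Fin N))}

lemma sub_g (i : Fin N) (hΩ : IsOpen Ω) (hb : Bornology.IsBounded Ω) (hne : (Ωᶜ).Nonempty)
    {ρ₀ : ℝ} (hρ : GoodCollar Ω ρ₀) {α μ c0 : ℝ}
    (hα : α < 1 / 2) (hc0 : 0 < c0) (hc : 3 * c0 ≤ μ - α * (1 - α)) :
    ∃ g : (EuclideanSpace ℝ (Fin N)) → ℝ, ContDiffOn ℝ 2 g Ω ∧ (∀ x ∈ Ω, 0 < g x) ∧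
      (∃ C, 0 < C ∧ ∀ x ∈ Ω, g x ≤ C * bdist Ω x ^ α) ∧
      (∀ x ∈ Ω, 0 ≤ lap g x + (μ - c0) / bdist Ω x ^ 2 * g x) ∧
      ∃ ρ', 0 < ρ' ∧ ∀ x ∈ collar Ω ρ', bdist Ω x ^ α / 8 ≤ g x := by
  obtain ⟨σ, hσ, v1, v2, vb, vpos, vl, ρ', hρ', vlow⟩ := sub_v1 hΩ hne hρ hα hc0 hc
  have hδ : ∀ x ∈ Ω, 0 < bdist Ω x := fun x hx => bdist_pos hΩ hne hx
  obtain ⟨τ, hτ⟩ : ∃ τ, τ = σ / 2 := ⟨_, rfl⟩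
  have hτ0 : 0 < τ := by rw [hτ]; positivity
  have hτσ : τ < σ := by rw [hτ]; linarith
  have hKΩ : {x | τ ≤ bdist Ω x} ⊆ Ω := fun x hx => mem_of_bdist_pos (hτ0.trans_le hx)
  have hK : IsCompact {x | τ ≤ bdist Ω x} := Metric.isCompact_of_isClosed_isBounded
    (isClosed_le continuous_const (bdist_cont Ω)) (hb.subset hKΩ)
  obtain ⟨ζ, z2, zc, zs, z01, zK⟩ := exists_cut hK hΩ hKΩ
  obtain ⟨K, hKdef⟩ : ∃ K, K = 1 + |μ - c0| / τ ^ 2 := ⟨_, rfl⟩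
  have hK1 : |μ - c0| / τ ^ 2 ≤ K ^ 2 := by
    have : 0 ≤ |μ - c0| / τ ^ 2 := by positivity
    rw [hKdef]; nlinarith
  have ex2 : ContDiff ℝ 2 (fun y : (EuclideanSpace ℝ (Fin N)) => Real.exp (K * y i)) :=
    (contDiff_const.mul (EuclideanSpace.proj i : (EuclideanSpace ℝ (Fin N)) →L[ℝ] ℝ).contDiff).exp
  set E : (EuclideanSpace ℝ (Fin N)) → ℝ := fun x => ζ x * Real.exp (K * x i) with hE
  have E2 : ContDiff ℝ 2 E := z2.mul ex2
  have Ec : HasCompactSupport E := zc.mul_right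
  have E0 : ∀ x, 0 ≤ E x := fun x => mul_nonneg (z01 x).1 (Real.exp_pos _).le
  obtain ⟨B, hB⟩ := Ec.exists_bound_of_continuous E2.continuous
  obtain ⟨C, hC⟩ := (lap_compact E2 Ec).exists_bound_of_continuous (lap_continuous E2)
  have hB0 : 0 ≤ B := (norm_nonneg _).trans (hB 0)
  have hC0 : 0 ≤ C := (norm_nonneg _).trans (hC 0)
  obtain ⟨δ1, D, hδ1, hD⟩ := compact_bounds zc.isCompact (bdist_cont Ω).continuousOn (bdist_cont Ω).continuousOn
    (fun x hx => hδ x (zs hx))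
  have Eoff : ∀ x ∉ tsupport ζ, E x = 0 ∧ lap E x = 0 := by
    intro x hx
    have h1 : E =ᶠ[nhds x] fun _ => 0 := by
      filter_upwards [(isClosed_tsupport ζ).isOpen_compl.mem_nhds hx] with y hy
      simp [hE, image_eq_zero_of_notMem_tsupport hy]
    refine ⟨h1.eq_of_nhds, ?_⟩
    rw [lap_congr h1]; simp [lap]
  -- lower bound of v1 / δ² on middle region
  have hK3 : IsCompact (tsupport ζ ∩ {x | bdist Ω x ≤ τ}) :=
    zc.isCompact.inter_right (isClosed_le (bdist_cont Ω) continuous_const)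
  obtain ⟨m, b1, hm0, hm⟩ := compact_bounds hK3 (v2.continuousOn.mono (inter_subset_left.trans zs))
    (v2.continuousOn.mono (inter_subset_left.trans zs))
    (fun x hx => vpos x (zs hx.1) (lt_of_le_of_lt hx.2 hτσ))
  obtain ⟨η, hη⟩ : ∃ η, η = c0 / τ ^ 2 * m / (C + |μ - c0| / δ1 ^ 2 * B + 1) := ⟨_, rfl⟩
  have hden : 0 < C + |μ - c0| / δ1 ^ 2 * B + 1 := by positivity
  have hη0 : 0 < η := by rw [hη]; positivity
  have hη1 : η * (C + |μ - c0| / δ1 ^ 2 * B + 1) = c0 / τ ^ 2 * m := by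
    rw [hη]; field_simp
  obtain ⟨q, b2, hq0, hq⟩ := compact_bounds zc.isCompact
    (v := fun x => bdist Ω x ^ α) (V := fun x => bdist Ω x)
    (fun x hx => ((bdist_cont Ω).continuousAt.rpow_const (Or.inl (hδ x (zs hx)).ne')).continuousWithinAt)
    (bdist_cont Ω).continuousOn (fun x hx => Real.rpow_pos_of_pos (hδ x (zs hx)) α)
  refine ⟨fun x => v1 x + η * E x, v2.add (contDiff_const.mul E2).contDiffOn, ?_, ?_, ?_, ρ', hρ', ?_⟩
  · intro x hx
    show 0 < v1 x + η * E x
    by_cases h : bdist Ω x < τ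
    · have := vpos x hx (h.trans hτσ)
      have := mul_nonneg hη0.le (E0 x)
      linarith
    · have h1 : 0 < E x := by
        simp only [hE, zK x (not_lt.1 h), one_mul]; exact Real.exp_pos _
      have := mul_pos hη0 h1
      linarith [(vb x hx).1]
  · refine ⟨1 + η * B / q, by positivity, fun x hx => ?_⟩
    have hR : 0 < bdist Ω x ^ α := Real.rpow_pos_of_pos (hδ x hx) _
    have h1 : η * E x ≤ η * B / q * bdist Ω x ^ α := by
      by_cases hxs : x ∈ tsupport ζ
      · have h2 := (hq x hxs).1
        have h3 := (le_abs_self _).trans (hB x)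
        calc η * E x ≤ η * B := mul_le_mul_of_nonneg_left h3 hη0.le
          _ = η * B / q * q := by field_simp
          _ ≤ _ := mul_le_mul_of_nonneg_left h2 (by positivity)
      · rw [(Eoff x hxs).1, mul_zero]; positivity
    have := (vb x hx).2
    show v1 x + η * E x ≤ _
    linarith
  · intro x hx
    have hr := hδ x hx
    rw [lap_add' (v2.contDiffAt (hΩ.mem_nhds hx)) (contDiff_const.mul E2).contDiffAt, lap_cmul η E2.contDiffAt]
    show 0 ≤ lap v1 x + η * lap E x + (μ - c0) / bdist Ω x ^ 2 * (v1 x + η * E x)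
    have h1 : c0 / bdist Ω x ^ 2 * v1 x ≤ lap v1 x + (μ - c0) / bdist Ω x ^ 2 * v1 x := by
      have := vl x hx
      have e : (μ - 2 * c0) / bdist Ω x ^ 2 * v1 x = (μ - c0) / bdist Ω x ^ 2 * v1 x - c0 / bdist Ω x ^ 2 * v1 x := by
        ring
      linarith
    have h1' : 0 ≤ c0 / bdist Ω x ^ 2 * v1 x := mul_nonneg (by positivity) (vb x hx).1
    have habs : ∀ ρ, 0 < ρ → ρ ≤ bdist Ω x → -(|μ - c0| / ρ ^ 2) ≤ (μ - c0) / bdist Ω x ^ 2 := by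
      intro ρ hρ hρx
      have a : |(μ - c0) / bdist Ω x ^ 2| ≤ |μ - c0| / ρ ^ 2 := by
        rw [abs_div, abs_of_pos (by positivity : 0 < bdist Ω x ^ 2)]
        gcongr
      exact (abs_le.1 a).1
    suffices h : -(c0 / bdist Ω x ^ 2 * v1 x) ≤ η * (lap E x + (μ - c0) / bdist Ω x ^ 2 * E x) by linarith
    by_cases h : τ < bdist Ω x
    · have h2 : E =ᶠ[nhds x] fun y => Real.exp (K * y i) := by
        filter_upwards [(isOpen_lt continuous_const (bdist_cont Ω)).mem_nhds h] with y hy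
        simp [hE, zK y (le_of_lt hy)]
      rw [lap_congr h2, lap_exp, h2.eq_of_nhds]
      have h3 := habs τ hτ0 h.le
      have h4 : 0 ≤ K ^ 2 + (μ - c0) / bdist Ω x ^ 2 := by linarith
      have h5 := mul_nonneg hη0.le (mul_nonneg h4 (Real.exp_pos (K * x i)).le)
      beta_reduce
      linarith
    · by_cases hxs : x ∈ tsupport ζ
      · have h2 := (hm x ⟨hxs, not_lt.1 h⟩).1
        have h3 := habs δ1 hδ1 (hD x hxs).1
        have h4 := (abs_le.1 (hC x)).1
        have h5 := (le_abs_self _).trans (hB x)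
        have h6 : -(|μ - c0| / δ1 ^ 2 * B) ≤ (μ - c0) / bdist Ω x ^ 2 * E x := by
          have a := mul_le_mul_of_nonneg_right h3 (E0 x)
          have b := mul_le_mul_of_nonneg_left h5 (by positivity : 0 ≤ |μ - c0| / δ1 ^ 2)
          linarith
        have h7 : c0 / τ ^ 2 * m ≤ c0 / bdist Ω x ^ 2 * v1 x := by
          have : bdist Ω x ≤ τ := not_lt.1 h
          gcongr
        have h8 : -(C + |μ - c0| / δ1 ^ 2 * B + 1) ≤ lap E x + (μ - c0) / bdist Ω x ^ 2 * E x := by linarith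
        have h9 := mul_le_mul_of_nonneg_left h8 hη0.le
        linarith
      · rw [(Eoff x hxs).1, (Eoff x hxs).2]
        simpa using h1'
  · intro x hx
    have h1 := vlow x hx
    have h2 := mul_nonneg hη0.le (E0 x)
    show _ ≤ v1 x + η * E x
    linarith

lemma final_aux (hN : 2 ≤ N) (Ω : Set (EuclideanSpace ℝ (Fin N))) (hΩo : IsOpen Ω) (hΩb : Bornology.IsBounded Ω)
    (ρ₀ : ℝ) (hρ₀ : GoodCollar Ω ρ₀) (d : (EuclideanSpace ℝ (Fin N)) → ℝ) (c : ℝ) (hd : RegDist Ω d c)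
    (μ s p : ℝ) (hμ : μ ≤ 1 / 4) (hp : 1 < p)
    (hs : s < (1 / 2 - Real.sqrt (1 / 4 - μ)) * (p - 1) + 2) :
    ∃ U : (EuclideanSpace ℝ (Fin N)) → ℝ, ∃ γ : ℝ,
      ContDiffOn ℝ 2 U Ω ∧ (∀ x ∈ Ω, 0 < U x) ∧
      (∀ x ∈ Ω,
        -(lap U x) - μ / (bdist Ω x) ^ 2 * U x + (U x) ^ p / (bdist Ω x) ^ s = 0) ∧
      0 < γ ∧ γ ≤ 1 ∧
      ∃ ρ', 0 < ρ' ∧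
        ∀ x ∈ collar Ω ρ', γ ≤ U x / bdist Ω x ^ ((s - 2) / (p - 1)) ∧
          U x / bdist Ω x ^ ((s - 2) / (p - 1)) ≤ 1 / γ := by
  have hne : (Ωᶜ).Nonempty := by
    rw [Set.nonempty_compl]
    rintro rfl
    haveI : Nonempty (Fin N) := ⟨⟨0, by omega⟩⟩
    exact NormedSpace.unbounded_univ ℝ (EuclideanSpace ℝ (Fin N)) hΩb
  have hp1 : 0 < p - 1 := by linarith
  obtain ⟨α, hαdef⟩ : ∃ α, α = (s - 2) / (p - 1) := ⟨_, rfl⟩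
  rw [← hαdef]
  have hαs : α * (p - 1) + 2 = s := by rw [hαdef]; field_simp; ring
  have hα1 : α < 1 / 2 - Real.sqrt (1 / 4 - μ) := by
    rw [hαdef, div_lt_iff₀ hp1]; linarith
  have hsq0 := Real.sqrt_nonneg (1 / 4 - μ)
  have hsq := Real.sq_sqrt (by linarith : 0 ≤ 1 / 4 - μ)
  have hα : α < 1 / 2 := by linarith
  have hgap : 0 < μ - α * (1 - α) := by nlinarith
  obtain ⟨c0, hc0d⟩ : ∃ c0, c0 = (μ - α * (1 - α)) / 3 := ⟨_, rfl⟩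
  have hc0 : 0 < c0 := by rw [hc0d]; positivity
  obtain ⟨g, g2, gpos, ⟨C, hC0, gC⟩, gl, ρ', hρ', glow⟩ :=
    sub_g ⟨0, by omega⟩ hΩo hΩb hne hρ₀ hα hc0 (by rw [hc0d]; linarith : 3 * c0 ≤ μ - α * (1 - α))
  obtain ⟨A, hA0, A2, Al⟩ := super_exists hΩo hne hd hp hαs (μ := μ)
  obtain ⟨hc, d2, dpos, dδ, -, -⟩ := hd
  have hc00 : 0 < c := by linarith
  have hδ : ∀ x ∈ Ω, 0 < bdist Ω x := fun x hx => bdist_pos hΩo hne hx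
  have hratio : ∀ x ∈ Ω, c ^ (-|α|) * bdist Ω x ^ α ≤ d x ^ α ∧ d x ^ α ≤ c ^ |α| * bdist Ω x ^ α := by
    intro x hx
    have h0 := hδ x hx
    have hR : 0 < bdist Ω x ^ α := Real.rpow_pos_of_pos h0 _
    obtain ⟨q1, q2⟩ := dδ x hx
    have := ratio_pow (q := d x / bdist Ω x) α hc (by rw [le_div_iff₀ h0]; exact q1) (by rw [div_le_iff₀ h0]; exact q2)
    rw [Real.div_rpow (dpos x hx).le h0.le, le_div_iff₀ hR, div_le_iff₀ hR] at this
    exact this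
  have hcm : 0 < c ^ (-|α|) := Real.rpow_pos_of_pos hc00 _
  have hcp : 0 < c ^ |α| := Real.rpow_pos_of_pos hc00 _
  obtain ⟨ε, hε⟩ : ∃ ε, ε = min (A * c ^ (-|α|) / 4 / C) (c0 ^ (1 / (p - 1)) / C) := ⟨_, rfl⟩
  have hε0 : 0 < ε := by
    have := Real.rpow_pos_of_pos hc0 (1 / (p - 1))
    rw [hε]; positivity
  have hε1 : ε * C ≤ A * c ^ (-|α|) / 4 := by
    rw [← le_div_iff₀ hC0, hε]; exact min_le_left _ _
  have hε2 : (ε * C) ^ (p - 1) ≤ c0 := by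
    have h1 : ε * C ≤ c0 ^ (1 / (p - 1)) := by
      rw [← le_div_iff₀ hC0, hε]; exact min_le_right _ _
    have := Real.rpow_le_rpow (by positivity) h1 hp1.le
    rwa [← Real.rpow_mul hc0.le, one_div_mul_cancel hp1.ne', Real.rpow_one] at this
  obtain ⟨U, U2, hU⟩ := sol_of_subsuper (f := nonl Ω μ s p) (v := fun x => ε * g x) (V := fun x => A * d x ^ α)
    hΩo hΩb (nonl_locLip hΩo hne μ s p) (contDiffOn_const.mul g2) A2
    (fun x hx => mul_pos hε0 (gpos x hx))
    (fun x hx => by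
      have h1 := mul_le_mul_of_nonneg_left (gC x hx) hε0.le
      have h2 := (hratio x hx).1
      have hR : 0 < bdist Ω x ^ α := Real.rpow_pos_of_pos (hδ x hx) _
      have h3 := mul_le_mul_of_nonneg_right hε1 hR.le
      have h4 := mul_le_mul_of_nonneg_left h2 hA0.le
      show ε * g x ≤ A * d x ^ α / 4
      linarith) Al
    (fun x hx => by
      rw [lap_cmul ε (g2.contDiffAt (hΩo.mem_nhds hx))]
      unfold nonl
      have h0 := hδ x hx
      have hg := gpos x hx
      have hR : 0 < bdist Ω x ^ α := Real.rpow_pos_of_pos h0 _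
      have h1 := mul_le_mul_of_nonneg_left (gl x hx) hε0.le
      have hv : 0 < ε * g x := mul_pos hε0 hg
      have h2 : (ε * g x) ^ (p - 1) ≤ c0 * (bdist Ω x) ^ (s - 2) := by
        have a : ε * g x ≤ (ε * C) * bdist Ω x ^ α := by
          have := mul_le_mul_of_nonneg_left (gC x hx) hε0.le
          linarith
        have b := Real.rpow_le_rpow hv.le a hp1.le
        rw [Real.mul_rpow (by positivity) hR.le, ← Real.rpow_mul h0.le,
          (by linarith : α * (p - 1) = s - 2)] at b
        exact b.trans (mul_le_mul_of_nonneg_right hε2 (Real.rpow_pos_of_pos h0 _).le)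
      have h3 : (ε * g x) ^ p / bdist Ω x ^ s ≤ c0 / bdist Ω x ^ 2 * (ε * g x) := by
        have e1 : (ε * g x) ^ p = (ε * g x) * (ε * g x) ^ (p - 1) := by
          rw [mul_comm (ε * g x) ((ε * g x) ^ (p - 1)), ← Real.rpow_add_one hv.ne']; congr 1; ring
        have e2 : bdist Ω x ^ s = bdist Ω x ^ (s - 2) * bdist Ω x ^ 2 := by
          rw [← Real.rpow_natCast, ← Real.rpow_add h0]; congr 1; push_cast; ring
        have hS : 0 < bdist Ω x ^ (s - 2) := Real.rpow_pos_of_pos h0 _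
        rw [e1, e2, div_le_iff₀ (by positivity)]
        calc ε * g x * (ε * g x) ^ (p - 1) ≤ ε * g x * (c0 * (bdist Ω x) ^ (s - 2)) :=
              mul_le_mul_of_nonneg_left h2 hv.le
          _ = _ := by field_simp
      have e : ε * (lap g x + (μ - c0) / bdist Ω x ^ 2 * g x) =
          ε * lap g x + μ / bdist Ω x ^ 2 * (ε * g x) - c0 / bdist Ω x ^ 2 * (ε * g x) := by ring
      rw [mul_zero, e] at h1
      linarith)
  obtain ⟨γ, hγ⟩ : ∃ γ, γ = min 1 (min (ε / 8) (1 / (A * c ^ |α|))) := ⟨_, rfl⟩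
  have hγ0 : 0 < γ := by rw [hγ]; positivity
  have hγ1 : γ ≤ 1 := by rw [hγ]; exact min_le_left _ _
  have hγ2 : γ ≤ ε / 8 := by rw [hγ]; exact (min_le_right _ _).trans (min_le_left _ _)
  have hγ3 : A * c ^ |α| ≤ 1 / γ := by
    have : γ ≤ 1 / (A * c ^ |α|) := by rw [hγ]; exact (min_le_right _ _).trans (min_le_right _ _)
    rw [le_div_iff₀ (by positivity)] at this
    rw [le_div_iff₀ hγ0]; linarith
  refine ⟨U, γ, U2, fun x hx => (mul_pos hε0 (gpos x hx)).trans_le (hU x hx).1, fun x hx => ?_, hγ0, hγ1,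
    ρ', hρ', fun x hx => ?_⟩
  · have := (hU x hx).2.2
    unfold nonl at this
    linarith
  · have hR : 0 < bdist Ω x ^ α := Real.rpow_pos_of_pos (hδ x hx.1) _
    obtain ⟨u1, u2, -⟩ := hU x hx.1
    have h1 := glow x hx
    have h2 := (hratio x hx.1).2
    rw [le_div_iff₀ hR, div_le_iff₀ hR]
    constructor
    · have a := mul_le_mul_of_nonneg_left h1 hε0.le
      have b := mul_le_mul_of_nonneg_right hγ2 hR.le
      have u1' : ε * g x ≤ U x := u1
      linarith
    · have a := mul_le_mul_of_nonneg_left h2 hA0.le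
      have b := mul_le_mul_of_nonneg_right hγ3 hR.le
      have u2' : U x ≤ A * d x ^ α := u2
      linarith

end subsol2

end helpers

/-- (Existence of an `XXL`-solution.) Let `μ ≤ 1/4`, `p > 1` and
`s < β₋(p-1)+2`. Then there are a positive solution `U` of `(*)` on all of `Ω` and a
constant `γ ∈ (0,1]` with `γ ≤ liminf_{δ(x)→0} U(x)/δ(x)^{(s-2)/(p-1)}` and
`limsup_{δ(x)→0} U(x)/δ(x)^{(s-2)/(p-1)} ≤ 1/γ`. -/
theorem stmt17 {N : ℕ} (hN : 2 ≤ N) (Ω : Set (EuclideanSpace ℝ (Fin N)))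
    (hΩo : IsOpen Ω) (hΩne : Ω.Nonempty) (hΩb : Bornology.IsBounded Ω)
    (ρ₀ : ℝ) (hρ₀ : GoodCollar Ω ρ₀)
    (d : EuclideanSpace ℝ (Fin N) → ℝ) (c : ℝ) (hd : RegDist Ω d c)
    (μ s p : ℝ) (hμ : μ ≤ 1 / 4) (hp : 1 < p)
    (hs : s < (1 / 2 - Real.sqrt (1 / 4 - μ)) * (p - 1) + 2) :
    ∃ U : EuclideanSpace ℝ (Fin N) → ℝ, ∃ γ : ℝ,
      ContDiffOn ℝ 2 U Ω ∧ (∀ x ∈ Ω, 0 < U x) ∧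
      (∀ x ∈ Ω,
        -(lap U x) - μ / (bdist Ω x) ^ 2 * U x + (U x) ^ p / (bdist Ω x) ^ s = 0) ∧
      0 < γ ∧ γ ≤ 1 ∧
      (∀ γ', γ' < γ → ∃ ρ', 0 < ρ' ∧
        ∀ x ∈ collar Ω ρ', γ' ≤ U x / bdist Ω x ^ ((s - 2) / (p - 1))) ∧
      (∀ C, 1 / γ < C → ∃ ρ', 0 < ρ' ∧
        ∀ x ∈ collar Ω ρ', U x / bdist Ω x ^ ((s - 2) / (p - 1)) ≤ C) := by
  obtain ⟨U, γ, h1, h2, h3, h4, h5, ρ', hρ', hb⟩ :=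
    final_aux hN Ω hΩo hΩb ρ₀ hρ₀ d c hd μ s p hμ hp hs
  exact ⟨U, γ, h1, h2, h3, h4, h5,
    fun γ' hγ' => ⟨ρ', hρ', fun x hx => hγ'.le.trans (hb x hx).1⟩,
    fun C hC => ⟨ρ', hρ', fun x hx => (hb x hx).2.trans hC.le⟩⟩
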